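/- arXiv:0906.3113 — 2 statements merged into one kernel-verified Lean document; each statement's English description precedes it below -/
import Mathlib

section
/- Let n ≥ 1 be an integer and μ_n = nπ/2 − π/8. Then for every z ∈ (−1,1) the principal value limit 𝒜φ̃_n(z) = (1/π)·lim_{ε→0⁺} ∫_{|x−z|>ε} (φ̃_n(x) − φ̃_n(z))/(x−z)² dx exists, and the L² bound (∫_{−1}^1 (𝒜φ̃_n(z) + μ_n·φ̃_n(z))² dz)^{1/2} < √(1.21 + 8.00/μ_n + 13.66/μ_n²)·(1/μ_n) holds. -/
open Real MeasureTheory Set Filter Topology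

/-- `η t = (1/4)·log(1+t²) − (1/π)·∫₀^t log|s|/(1+s²) ds`. -/
noncomputable def etaF (t : ℝ) : ℝ :=
  Real.log (1 + t ^ 2) / 4 - (1 / Real.pi) * ∫ s in (0 : ℝ)..t, Real.log |s| / (1 + s ^ 2)

/-- The remainder term `r`. -/
noncomputable def rfun (x : ℝ) : ℝ :=
  (Real.sqrt 2 / (2 * Real.pi)) *
    ∫ t in Ioi (0 : ℝ), (t / (1 + t ^ 2)) * Real.exp (-etaF t) * Real.exp (-t * x)

/-- The generalized eigenfunction `ψ_λ` for the half-line. -/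
noncomputable def psi (lam x : ℝ) : ℝ :=
  if 0 < x then Real.sin (lam * x + Real.pi / 8) - rfun (lam * x) else 0

/-- The interpolating cutoff function `q`. -/
noncomputable def qcut (x : ℝ) : ℝ :=
  if x ≤ -(1/3) then 0
  else if x ≤ 0 then (9/2) * (x + 1/3) ^ 2
  else if x ≤ 1/3 then 1 - (9/2) * (x - 1/3) ^ 2
  else 1

/-- The approximate eigenfunction `φ̃_n` on the interval `(−1,1)`,
with `μ_n = nπ/2 − π/8`. -/
noncomputable def phiApprox (n : ℕ) (x : ℝ) : ℝ :=
  qcut (-x) * psi (n * Real.pi / 2 - Real.pi / 8) (1 + x)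
    + (-1 : ℝ) ^ (n + 1) * qcut x * psi (n * Real.pi / 2 - Real.pi / 8) (1 - x)

/-- Cauchy's theorem on a half-plane `a ≤ Im s`, where holomorphy may fail on the line `Re s = 0`:
if `g` decays like `‖s‖ ^ (-3/2)`, its integral over the boundary line vanishes. -/
theorem tendsto_integral_line_of_decay {g : ℂ → ℂ} {a C R : ℝ} (ha : 0 ≤ a)
    (hc : ContinuousOn g {s | a ≤ s.im})
    (hd : ∀ s : ℂ, a < s.im → s.re ≠ 0 → DifferentiableAt ℂ g s)
    (hb : ∀ s : ℂ, a ≤ s.im → R ≤ ‖s‖ → ‖g s‖ ≤ C * ‖s‖ ^ (-(3 / 2) : ℝ)) :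
    Tendsto (fun T : ℝ => ∫ x in (-T)..T, g (x + a * Complex.I)) atTop (𝓝 0) := by
  have key : ∀ T : ℝ, 0 < T → ∫ x in (-T)..T, g (x + a * Complex.I)
      = (∫ x in (-T)..T, g (x + (a + T : ℝ) * Complex.I))
        - Complex.I * (∫ y in a..(a + T), g (T + y * Complex.I))
        + Complex.I * (∫ y in a..(a + T), g ((-T : ℝ) + y * Complex.I)) := by
    intro T hT
    have h1 := Complex.integral_boundary_rect_eq_zero_of_continuousOn_of_differentiableOn g
      ⟨0, a⟩ ⟨T, a + T⟩ (hc.mono (by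
        rintro s ⟨-, hs⟩
        simp only [uIcc_of_le (show a ≤ a + T by linarith), mem_preimage] at hs
        exact hs.1)) (by
        rintro s ⟨hs1, hs2⟩
        simp only [min_eq_left hT.le, max_eq_right hT.le, min_eq_left (show a ≤ a + T by linarith),
          max_eq_right (show a ≤ a + T by linarith), mem_preimage] at hs1 hs2
        exact (hd s hs2.1 hs1.1.ne').differentiableWithinAt)
    have h2 := Complex.integral_boundary_rect_eq_zero_of_continuousOn_of_differentiableOn g
      ⟨-T, a⟩ ⟨0, a + T⟩ (hc.mono (by
        rintro s ⟨-, hs⟩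
        simp only [uIcc_of_le (show a ≤ a + T by linarith), mem_preimage] at hs
        exact hs.1)) (by
        rintro s ⟨hs1, hs2⟩
        simp only [min_eq_left (show -T ≤ 0 by linarith), max_eq_right (show -T ≤ 0 by linarith),
          min_eq_left (show a ≤ a + T by linarith),
          max_eq_right (show a ≤ a + T by linarith), mem_preimage] at hs1 hs2
        exact (hd s hs2.1 hs1.2.ne).differentiableWithinAt)
    have hi : ∀ c : ℝ, a ≤ c → ∀ p q : ℝ,
        IntervalIntegrable (fun x : ℝ => g (x + c * Complex.I)) volume p q := by
      intro c hca p q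
      refine ContinuousOn.intervalIntegrable fun x _ => ?_
      refine ContinuousWithinAt.comp (t := {s : ℂ | a ≤ s.im}) (hc _ (by simpa using hca))
        (by fun_prop) (fun y _ => by simpa using hca)
    rw [← intervalIntegral.integral_add_adjacent_intervals (hi a le_rfl (-T) 0) (hi a le_rfl 0 T),
      ← intervalIntegral.integral_add_adjacent_intervals (hi (a + T) (by linarith) (-T) 0)
        (hi (a + T) (by linarith) 0 T)]
    simp only [smul_eq_mul] at h1 h2
    linear_combination h1 + h2
  have hlen : ∀ T : ℝ, max 1 R ≤ T →
      ‖∫ x in (-T)..T, g (x + a * Complex.I)‖ ≤ 4 * |C| * T ^ (-(1 / 2) : ℝ) := by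
    intro T hT
    have hT1 : 1 ≤ T := (le_max_left _ _).trans hT
    have hTR : R ≤ T := (le_max_right _ _).trans hT
    have hT0 : 0 < T := by linarith
    have hg : ∀ s : ℂ, a ≤ s.im → T ≤ ‖s‖ → ‖g s‖ ≤ |C| * T ^ (-(3 / 2) : ℝ) := by
      intro s hs hTs
      calc ‖g s‖ ≤ C * ‖s‖ ^ (-(3 / 2) : ℝ) := hb s hs (hTR.trans hTs)
        _ ≤ |C| * ‖s‖ ^ (-(3 / 2) : ℝ) := by gcongr; exact le_abs_self C
        _ ≤ |C| * T ^ (-(3 / 2) : ℝ) := mul_le_mul_of_nonneg_left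
            (rpow_le_rpow_of_nonpos hT0 hTs (by norm_num)) (abs_nonneg C)
    have e1 : ‖∫ x in (-T)..T, g (x + (a + T : ℝ) * Complex.I)‖
        ≤ |C| * T ^ (-(3 / 2) : ℝ) * |T - -T| :=
      intervalIntegral.norm_integral_le_of_norm_le_const fun x _ => hg _ (by simp; linarith) (by
        refine le_trans ?_ (Complex.abs_im_le_norm _)
        simp [abs_of_nonneg (show 0 ≤ a + T by linarith), ha])
    have e2 : ∀ r : ℝ, |r| = T → ‖∫ y in a..(a + T), g (r + y * Complex.I)‖
        ≤ |C| * T ^ (-(3 / 2) : ℝ) * |a + T - a| := fun r hr =>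
      intervalIntegral.norm_integral_le_of_norm_le_const fun y hy => by
        rw [uIoc_of_le (by linarith)] at hy
        exact hg _ (by simpa using hy.1.le) (by
          refine le_trans ?_ (Complex.abs_re_le_norm _)
          simp [hr])
    have e3 : T ^ (-(1 / 2) : ℝ) = T ^ (-(3 / 2) : ℝ) * T := by
      rw [← rpow_add_one hT0.ne']; norm_num
    have e4 := e2 T (abs_of_pos hT0)
    have e5 := e2 (-T) (by rw [abs_neg, abs_of_pos hT0])
    rw [show a + T - a = T by ring, abs_of_pos hT0] at e4 e5
    rw [show T - -T = 2 * T by ring, abs_of_pos (show 0 < 2 * T by linarith)] at e1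
    rw [key T hT0, e3]
    refine (norm_add_le _ _).trans ?_
    refine (add_le_add_left (norm_sub_le _ _) _).trans ?_
    simp only [norm_mul, Complex.norm_I, one_mul]
    linarith
  refine squeeze_zero_norm' ((eventually_ge_atTop (max 1 R)).mono hlen) ?_
  simpa using (tendsto_rpow_neg_atTop (show (0 : ℝ) < 1 / 2 by norm_num)).const_mul (4 * |C|)

/-- The Laplace transform on the half-line of a complex-valued function. -/
noncomputable def halfLaplace (h : ℝ → ℂ) (z : ℂ) : ℂ :=
  ∫ t in Ioi (0 : ℝ), h t * Complex.exp (-t * z)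

lemma norm_exp_neg_mul (t : ℝ) (z : ℂ) : ‖Complex.exp (-t * z)‖ = Real.exp (-(t * z.re)) := by
  rw [Complex.norm_exp]; simp

lemma norm_mul_exp_neg_le {h : ℝ → ℂ} {t : ℝ} (ht : 0 < t) {z : ℂ} (hz : 0 ≤ z.re) :
    ‖h t * Complex.exp (-t * z)‖ ≤ ‖h t‖ := by
  rw [norm_mul, norm_exp_neg_mul]
  refine mul_le_of_le_one_right (norm_nonneg _) (exp_le_one_iff.2 ?_)
  nlinarith

lemma halfLaplace_continuousOn {h : ℝ → ℂ} (hi : IntegrableOn h (Ioi 0)) :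
    ContinuousOn (halfLaplace h) {z | 0 ≤ z.re} := by
  refine continuousOn_of_dominated (bound := fun t => ‖h t‖)
    (fun z _ => hi.aestronglyMeasurable.mul (by fun_prop)) (fun z hz => ?_) hi.norm ?_
  · exact (ae_restrict_iff' measurableSet_Ioi).2 (ae_of_all _ fun _ ht => norm_mul_exp_neg_le ht hz)
  · exact ae_of_all _ fun _ => by fun_prop

lemma norm_halfLaplace_le {h : ℝ → ℂ} (hi : IntegrableOn h (Ioi 0)) {z : ℂ} (hz : 0 ≤ z.re) :
    ‖halfLaplace h z‖ ≤ ∫ t in Ioi (0 : ℝ), ‖h t‖ :=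
  norm_integral_le_of_norm_le hi.norm
    ((ae_restrict_iff' measurableSet_Ioi).2 (ae_of_all _ fun _ ht => norm_mul_exp_neg_le ht hz))

lemma mul_exp_neg_le {a t : ℝ} (ha : 0 < a) : t * Real.exp (-(a * t)) ≤ 1 / a := by
  rw [Real.exp_neg, ← div_eq_mul_inv, div_le_div_iff₀ (Real.exp_pos _) ha]
  nlinarith [Real.add_one_le_exp (a * t)]

/-- Exponential integrability at every positive rate passes to `t ↦ t * h t`. -/
lemma integrableOn_id_mul_exp {h : ℝ → ℂ}
    (hi : ∀ a : ℝ, 0 < a → IntegrableOn (fun t => ‖h t‖ * Real.exp (-(a * t))) (Ioi 0))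
    (hm : AEStronglyMeasurable h (volume.restrict (Ioi 0))) (a : ℝ) (ha : 0 < a) :
    IntegrableOn (fun t : ℝ => ‖(t : ℂ) * h t‖ * Real.exp (-(a * t))) (Ioi 0) := by
  refine Integrable.mono' ((hi (a / 2) (by linarith)).const_mul (1 / (a / 2))) ?_ ?_
  · exact ((Complex.continuous_ofReal.aestronglyMeasurable.mul hm).norm).mul (by fun_prop)
  · refine (ae_restrict_iff' measurableSet_Ioi).2 (ae_of_all _ fun t (ht : 0 < t) => ?_)
    have h1 := mul_exp_neg_le (a := a / 2) (t := t) (by linarith)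
    have h2 : Real.exp (-(a * t)) = Real.exp (-(a / 2 * t)) * Real.exp (-(a / 2 * t)) := by
      rw [← Real.exp_add]; ring_nf
    rw [norm_mul, norm_norm, norm_mul, Complex.norm_real, norm_of_nonneg ht.le,
      norm_of_nonneg (Real.exp_pos _).le, h2]
    calc t * ‖h t‖ * (Real.exp (-(a / 2 * t)) * Real.exp (-(a / 2 * t)))
        = (t * Real.exp (-(a / 2 * t))) * (‖h t‖ * Real.exp (-(a / 2 * t))) := by ring
      _ ≤ 1 / (a / 2) * (‖h t‖ * Real.exp (-(a / 2 * t))) := by gcongr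

lemma halfLaplace_hasDerivAt {h : ℝ → ℂ}
    (hi : ∀ a : ℝ, 0 < a → IntegrableOn (fun t => ‖h t‖ * Real.exp (-(a * t))) (Ioi 0))
    (hm : AEStronglyMeasurable h (volume.restrict (Ioi 0))) {z : ℂ} (hz : 0 < z.re) :
    HasDerivAt (halfLaplace h) (-halfLaplace (fun t => t * h t) z) z := by
  have hs : {w : ℂ | z.re / 2 < w.re} ∈ 𝓝 z :=
    (isOpen_lt continuous_const Complex.continuous_re).mem_nhds (by simp; linarith)
  have := (hasDerivAt_integral_of_dominated_loc_of_deriv_le (μ := volume.restrict (Ioi (0 : ℝ)))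
    (F := fun w t => h t * Complex.exp (-t * w))
    (F' := fun w t => h t * (Complex.exp (-t * w) * (-t))) (x₀ := z)
    (bound := fun t => ‖(t : ℂ) * h t‖ * Real.exp (-(z.re / 2 * t)))
    hs (.of_forall fun w => hm.mul (by fun_prop)) ?_ (hm.mul (by fun_prop)) ?_
    (integrableOn_id_mul_exp hi hm _ (by linarith)) ?_).2
  · refine HasDerivAt.congr_deriv (f := halfLaplace h) this ?_
    unfold halfLaplace
    rw [← integral_neg]
    refine integral_congr_ae (ae_of_all _ fun t => ?_)
    dsimp only
    ring
  · refine Integrable.mono' (hi z.re hz) (hm.mul (by fun_prop)) (ae_of_all _ fun t => ?_)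
    rw [norm_mul, norm_exp_neg_mul, mul_comm t]
  · refine (ae_restrict_iff' measurableSet_Ioi).2 (ae_of_all _ fun t (ht : 0 < t) w hw => ?_)
    rw [norm_mul, norm_mul, norm_exp_neg_mul, norm_neg, norm_mul]
    have : Real.exp (-(t * w.re)) ≤ Real.exp (-(z.re / 2 * t)) := by
      rw [exp_le_exp]; have : z.re / 2 < w.re := hw; nlinarith
    nlinarith [mul_le_mul_of_nonneg_left this (mul_nonneg (norm_nonneg (h t)) (norm_nonneg (t : ℂ)))]
  · refine ae_of_all _ fun t w _ => ?_
    have : HasDerivAt (fun w : ℂ => -(t : ℂ) * w) (-t) w := by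
      simpa using (hasDerivAt_id w).const_mul (-(t : ℂ))
    exact (this.cexp).const_mul _

/-- The segment `cos θ + s sin θ`, whose logarithm is averaged in the Wiener-Hopf factor. -/
noncomputable def pencil (s : ℂ) (θ : ℝ) : ℂ := (Real.cos θ : ℂ) + s * (Real.sin θ : ℂ)

/-- The logarithm of the Wiener-Hopf factor. -/
noncomputable def whExponent (s : ℂ) : ℂ :=
  (Real.log 2 / 2 : ℝ) + (1 / π : ℝ) * ∫ θ in (0:ℝ)..(π / 2), Complex.log (pencil s θ)

/-- The Wiener-Hopf factor; it extends `t ↦ exp (-η t)` to the upper half-plane. -/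
noncomputable def whFactor (s : ℂ) : ℂ := Complex.exp (-whExponent s)

lemma pencil_re (s : ℂ) (θ : ℝ) : (pencil s θ).re = Real.cos θ + s.re * Real.sin θ := by
  simp only [pencil, Complex.add_re, Complex.re_mul_ofReal, Complex.ofReal_re]

lemma pencil_im (s : ℂ) (θ : ℝ) : (pencil s θ).im = s.im * Real.sin θ := by
  simp only [pencil, Complex.add_im, Complex.im_mul_ofReal, Complex.ofReal_im, zero_add]

lemma pencil_ofReal (x : ℝ) (θ : ℝ) :
    pencil (x : ℂ) θ = ((Real.cos θ + x * Real.sin θ : ℝ) : ℂ) := by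
  simp [pencil]

lemma continuous_pencil : Continuous (fun p : ℂ × ℝ => pencil p.1 p.2) := by
  unfold pencil; fun_prop

lemma intervalIntegrable_log_norm_pencil (s : ℂ) (a b : ℝ) :
    IntervalIntegrable (fun θ => Real.log ‖pencil s θ‖) volume a b := by
  apply MeromorphicOn.intervalIntegrable_log_norm
  intro θ _
  apply AnalyticAt.meromorphicAt
  unfold pencil
  have h1 : AnalyticAt ℝ (fun x : ℝ => ((Real.cos x : ℝ) : ℂ)) θ :=
    (Complex.ofRealCLM.analyticAt _).comp Real.analyticAt_cos
  have h2 : AnalyticAt ℝ (fun x : ℝ => ((Real.sin x : ℝ) : ℂ)) θ :=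
    (Complex.ofRealCLM.analyticAt _).comp Real.analyticAt_sin
  exact h1.add (analyticAt_const.mul h2)

lemma measurable_log_pencil : Measurable (fun p : ℂ × ℝ => Complex.log (pencil p.1 p.2)) :=
  Complex.measurable_log.comp continuous_pencil.measurable

lemma norm_log_le (w : ℂ) : ‖Complex.log w‖ ≤ |Real.log ‖w‖| + π := by
  refine (Complex.norm_le_abs_re_add_abs_im _).trans ?_
  rw [Complex.log_re, Complex.log_im]
  gcongr
  exact Complex.abs_arg_le_pi w

lemma intervalIntegrable_log_pencil (s : ℂ) (a b : ℝ) :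
    IntervalIntegrable (fun θ => Complex.log (pencil s θ)) volume a b := by
  have h : IntervalIntegrable (fun θ => |Real.log ‖pencil s θ‖| + π) volume a b :=
    (intervalIntegrable_log_norm_pencil s a b).abs.add intervalIntegrable_const
  refine h.mono_fun ?_ ?_
  · exact (measurable_log_pencil.comp (measurable_const.prodMk measurable_id)).aestronglyMeasurable
  · refine Eventually.of_forall fun θ => (norm_log_le _).trans (le_abs_self _)

lemma measurable_whFactor : Measurable whFactor := by
  unfold whFactor whExponent
  have h : Measurable (fun s : ℂ => ∫ θ in (0:ℝ)..(π / 2), Complex.log (pencil s θ)) := by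
    simp_rw [intervalIntegral.integral_of_le (by positivity : (0:ℝ) ≤ π / 2)]
    exact (measurable_log_pencil.stronglyMeasurable.integral_prod_right'
      (ν := volume.restrict (Ioc 0 (π/2)))).measurable
  exact Complex.measurable_exp.comp ((measurable_const.add (measurable_const.mul h)).neg)

lemma whExponent_re (s : ℂ) : (whExponent s).re =
    Real.log 2 / 2 + (1 / π) * ∫ θ in (0:ℝ)..(π / 2), Real.log ‖pencil s θ‖ := by
  have h : (∫ θ in (0:ℝ)..(π / 2), Complex.log (pencil s θ)).re
      = ∫ θ in (0:ℝ)..(π / 2), Real.log ‖pencil s θ‖ := by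
    have := Complex.reCLM.intervalIntegral_comp_comm (intervalIntegrable_log_pencil s 0 (π/2))
    simpa [Complex.log_re] using this.symm
  unfold whExponent
  rw [Complex.add_re, Complex.re_ofReal_mul, h, Complex.ofReal_re]

lemma whExponent_im (s : ℂ) : (whExponent s).im =
    (1 / π) * ∫ θ in (0:ℝ)..(π / 2), Complex.arg (pencil s θ) := by
  have h : (∫ θ in (0:ℝ)..(π / 2), Complex.log (pencil s θ)).im
      = ∫ θ in (0:ℝ)..(π / 2), Complex.arg (pencil s θ) := by
    have := Complex.imCLM.intervalIntegral_comp_comm (intervalIntegrable_log_pencil s 0 (π/2))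
    simpa [Complex.log_im] using this.symm
  unfold whExponent
  rw [Complex.add_im, Complex.im_ofReal_mul, h, Complex.ofReal_im, zero_add]

lemma norm_whFactor (s : ℂ) : ‖whFactor s‖ = Real.exp (-(whExponent s).re) := by
  rw [whFactor, Complex.norm_exp, Complex.neg_re]

lemma cos_sub_mul_sin (ρ θ : ℝ) :
    Real.cos θ - ρ * Real.sin θ = √(1 + ρ ^ 2) * Real.cos (θ + Real.arctan ρ) := by
  have h : √(1 + ρ ^ 2) ≠ 0 := by positivity
  rw [Real.cos_add, Real.cos_arctan, Real.sin_arctan]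
  field_simp

lemma norm_pencil_ge {s : ℂ} {θ : ℝ} (h : θ ∈ Icc 0 (π / 2)) :
    |Real.cos θ - ‖s‖ * Real.sin θ| ≤ ‖pencil s θ‖ := by
  have h1 : 0 ≤ Real.sin θ := Real.sin_nonneg_of_nonneg_of_le_pi h.1 (by linarith [h.2, Real.pi_pos])
  have h2 : 0 ≤ Real.cos θ := Real.cos_nonneg_of_neg_pi_div_two_le_of_le (by linarith [h.1, Real.pi_pos]) h.2
  have := abs_norm_sub_norm_le ((Real.cos θ : ℂ)) (-(s * (Real.sin θ : ℂ)))
  rw [sub_neg_eq_add, norm_neg, norm_mul, Complex.norm_real, Complex.norm_real,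
    Real.norm_of_nonneg h1, Real.norm_of_nonneg h2] at this
  exact this

lemma norm_whFactor_le : ∃ C, 0 < C ∧ ∀ s, ‖whFactor s‖ ≤ C * (1 + ‖s‖ ^ 2) ^ (-(1/4) : ℝ) := by
  refine ⟨Real.exp (-(1/π) * ∫ θ in (0:ℝ)..π, Real.log (Real.cos θ)), Real.exp_pos _, fun s => ?_⟩
  set ρ := ‖s‖
  have hpi := Real.pi_pos
  have hα : 0 ≤ Real.arctan ρ := Real.arctan_nonneg.2 (norm_nonneg s)
  have hα2 : Real.arctan ρ < π / 2 := Real.arctan_lt_pi_div_two ρ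
  have hcos : IntervalIntegrable (fun θ => Real.log (Real.cos (θ + Real.arctan ρ))) volume 0 (π/2) := by
    have := (intervalIntegrable_log_cos (a := 0 + Real.arctan ρ) (b := π/2 + Real.arctan ρ)).comp_add_right
      (Real.arctan ρ)
    simpa [Function.comp_def] using this
  have key : ∫ θ in (0:ℝ)..(π / 2), (Real.log (1 + ρ^2) / 2 + Real.log (Real.cos (θ + Real.arctan ρ)))
      ≤ ∫ θ in (0:ℝ)..(π / 2), Real.log ‖pencil s θ‖ := by
    apply intervalIntegral.integral_mono_ae_restrict (by positivity)
      (intervalIntegrable_const.add hcos) (intervalIntegrable_log_norm_pencil s _ _)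
    have hne : ∀ᵐ θ ∂(volume.restrict (Icc 0 (π/2))), θ ≠ π/2 - Real.arctan ρ :=
      ae_restrict_of_ae (Measure.ae_ne volume _)
    filter_upwards [hne, ae_restrict_mem measurableSet_Icc] with θ h1 h2
    have h3 : Real.cos (θ + Real.arctan ρ) ≠ 0 := by
      intro h0
      rcases lt_trichotomy (θ + Real.arctan ρ) (π/2) with h | h | h
      · exact (Real.cos_pos_of_mem_Ioo ⟨by linarith [h2.1], h⟩).ne' h0
      · exact h1 (by linarith)
      · exact (Real.cos_neg_of_pi_div_two_lt_of_lt h (by linarith [h2.2])).ne h0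
    have h4 : Real.log (1 + ρ^2) / 2 + Real.log (Real.cos (θ + Real.arctan ρ))
        = Real.log |Real.cos θ - ρ * Real.sin θ| := by
      rw [cos_sub_mul_sin, Real.log_abs, Real.log_mul (by positivity) h3, Real.log_sqrt (by positivity)]
    rw [h4]
    apply Real.log_le_log _ (norm_pencil_ge h2)
    rw [cos_sub_mul_sin]
    have : √(1 + ρ ^ 2) ≠ 0 := by positivity
    positivity
  rw [intervalIntegral.integral_add intervalIntegrable_const hcos,
    intervalIntegral.integral_const, intervalIntegral.integral_comp_add_right
      (fun θ => Real.log (Real.cos θ))] at key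
  have hmono : ∫ θ in (0:ℝ)..π, Real.log (Real.cos θ) ≤
      ∫ θ in (0 + Real.arctan ρ)..(π/2 + Real.arctan ρ), Real.log (Real.cos θ) := by
    rw [← neg_le_neg_iff, ← intervalIntegral.integral_neg, ← intervalIntegral.integral_neg]
    apply intervalIntegral.integral_mono_interval (by linarith) (by linarith) (by linarith)
    · refine Eventually.of_forall fun θ => ?_
      simp only [Pi.zero_apply, Left.nonneg_neg_iff]
      rw [← Real.log_abs]
      exact Real.log_nonpos (abs_nonneg _) (Real.abs_cos_le_one θ)
    · exact intervalIntegrable_log_cos.neg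
  rw [norm_whFactor, Real.rpow_def_of_pos (by positivity), ← Real.exp_add, whExponent_re]
  apply Real.exp_le_exp.2
  have h5 := mul_le_mul_of_nonneg_left (key.trans' (add_le_add_right hmono _)) (by positivity : 0 ≤ 1/π)
  have h6 : 1/π * ((π/2 - 0) • (Real.log (1 + ρ^2) / 2)) = Real.log (1+ρ^2) / 4 := by
    rw [smul_eq_mul]; field_simp; ring
  rw [mul_add, h6] at h5
  have := Real.log_pos (by norm_num : (1:ℝ) < 2)
  linarith

lemma whFactor_tendsto {ι : Type*} {l : Filter ι} [l.IsCountablyGenerated] {u : ι → ℂ} {x : ℝ}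
    (hu : Tendsto u l (𝓝 (x:ℂ))) (him : ∀ᶠ i in l, 0 ≤ (u i).im)
    (hlow : ∀ᶠ i in l, ∀ θ ∈ Icc 0 (π/2), ‖pencil x θ‖ ≤ ‖pencil (u i) θ‖) :
    Tendsto (fun i => whFactor (u i)) l (𝓝 (whFactor x)) := by
  unfold whFactor whExponent
  refine (Complex.continuous_exp.tendsto _).comp (Tendsto.neg (tendsto_const_nhds.add
    (tendsto_const_nhds.mul ?_)))
  have hpi := Real.pi_pos
  have hne : ∀ᵐ θ ∂volume, θ ∈ Set.uIoc 0 (π/2) → pencil x θ ≠ 0 := by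
    filter_upwards [Measure.ae_ne volume (π/2 - Real.arctan (-x))] with θ h1 h2 h0
    rw [uIoc_of_le (by positivity)] at h2
    have h3 : Real.cos θ - (-x) * Real.sin θ = 0 := by
      have := congrArg Complex.re h0
      rw [pencil_re] at this; simp at this; linarith
    rw [cos_sub_mul_sin] at h3
    have h4 : Real.cos (θ + Real.arctan (-x)) = 0 := by
      rcases mul_eq_zero.1 h3 with h | h
      · exact absurd h (by positivity)
      · exact h
    have := Real.arctan_lt_pi_div_two (-x)
    have := Real.neg_pi_div_two_lt_arctan (-x)
    rcases lt_trichotomy (θ + Real.arctan (-x)) (π/2) with h | h | h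
    · exact (Real.cos_pos_of_mem_Ioo ⟨by linarith [h2.1], h⟩).ne' h4
    · exact h1 (by linarith)
    · exact (Real.cos_neg_of_pi_div_two_lt_of_lt h (by linarith [h2.2])).ne h4
  have hbd : ∀ᶠ i in l, ‖u i‖ ≤ |x| + 1 := by
    have h := hu.norm
    rw [Complex.norm_real, Real.norm_eq_abs] at h
    exact (h.eventually_lt_const (lt_add_one _)).mono fun _ h => h.le
  apply intervalIntegral.tendsto_integral_filter_of_dominated_convergence
    (fun θ => |Real.log ‖pencil x θ‖| + Real.log (|x| + 2) + π)
  · exact Eventually.of_forall fun i =>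
      (measurable_log_pencil.comp (measurable_const.prodMk measurable_id)).aestronglyMeasurable
  · filter_upwards [hlow, hbd] with i hi hb
    filter_upwards [hne] with θ h1 h2
    have h0 := h1 h2
    rw [uIoc_of_le (by positivity)] at h2
    refine (norm_log_le _).trans ?_
    gcongr
    have h3 := hi θ ⟨h2.1.le, h2.2⟩
    have hpos : 0 < ‖pencil x θ‖ := norm_pos_iff.2 h0
    have h4 : ‖pencil (u i) θ‖ ≤ |x| + 2 := by
      unfold pencil
      refine (norm_add_le _ _).trans ?_
      rw [norm_mul, Complex.norm_real, Complex.norm_real, Real.norm_eq_abs, Real.norm_eq_abs]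
      nlinarith [Real.abs_cos_le_one θ, Real.abs_sin_le_one θ, norm_nonneg (u i), abs_nonneg (Real.sin θ)]
    rw [abs_le]
    have h5 := Real.log_le_log hpos h3
    have h6 := Real.log_le_log (hpos.trans_le h3) h4
    have h7 : 0 ≤ Real.log (|x| + 2) := Real.log_nonneg (by linarith [abs_nonneg x])
    constructor
    · linarith [neg_abs_le (Real.log ‖pencil x θ‖)]
    · linarith [abs_nonneg (Real.log ‖pencil x θ‖)]
  · exact (((intervalIntegrable_log_norm_pencil x _ _).abs.add intervalIntegrable_const).add
      intervalIntegrable_const)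
  · filter_upwards [hne] with θ h1 h2
    have h0 := h1 h2
    rw [uIoc_of_le (by positivity)] at h2
    have hs : 0 ≤ Real.sin θ := Real.sin_nonneg_of_nonneg_of_le_pi h2.1.le (by linarith [h2.2])
    have hp : Tendsto (fun i => pencil (u i) θ) l (𝓝[{z | 0 ≤ z.im}] (pencil x θ)) := by
      refine tendsto_nhdsWithin_iff.2 ⟨?_, ?_⟩
      · unfold pencil
        exact tendsto_const_nhds.add (hu.mul tendsto_const_nhds)
      · filter_upwards [him] with i hi
        rw [pencil_im]; positivity
    suffices h : ContinuousWithinAt Complex.log {z : ℂ | 0 ≤ z.im} (pencil x θ) from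
      Tendsto.comp h.tendsto hp
    have him0 : (pencil x θ).im = 0 := by simp [pencil_im]
    by_cases hre : (pencil x θ).re < 0
    · exact Complex.continuousWithinAt_log_of_re_neg_of_im_zero hre him0
    · refine (continuousAt_clog ?_).continuousWithinAt
      left
      refine lt_of_le_of_ne (not_lt.1 hre) fun h => h0 (Complex.ext h.symm him0)

lemma whFactor_tendsto_vertical (x : ℝ) :
    Tendsto (fun δ : ℝ => whFactor (x + δ * Complex.I)) (𝓝[>] 0) (𝓝 (whFactor x)) := by
  apply whFactor_tendsto
  · have : Continuous fun δ : ℝ => (x:ℂ) + δ * Complex.I := by fun_prop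
    simpa using (this.tendsto 0).mono_left nhdsWithin_le_nhds
  · filter_upwards [self_mem_nhdsWithin] with δ hδ
    simpa using le_of_lt hδ
  · refine Eventually.of_forall fun δ θ _ => ?_
    have h : ‖pencil x θ‖ = |(pencil (x + δ * Complex.I) θ).re| := by
      rw [pencil_ofReal, Complex.norm_real, Real.norm_eq_abs, pencil_re]; simp
    rw [h]; exact Complex.abs_re_le_norm _

lemma mul_sin_le_norm_pencil {s : ℂ} {c θ : ℝ} (hc : c ≤ s.im ∨ c ≤ s.re) (h : θ ∈ Icc 0 (π / 2)) :
    c * Real.sin θ ≤ ‖pencil s θ‖ := by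
  have h1 : 0 ≤ Real.sin θ := Real.sin_nonneg_of_nonneg_of_le_pi h.1 (by linarith [h.2, Real.pi_pos])
  have h2 : 0 ≤ Real.cos θ := Real.cos_nonneg_of_neg_pi_div_two_le_of_le (by linarith [h.1, Real.pi_pos]) h.2
  rcases hc with hc | hc
  · refine le_trans ?_ (Complex.im_le_norm _)
    rw [pencil_im]; gcongr
  · refine le_trans ?_ (Complex.re_le_norm _)
    rw [pencil_re]; nlinarith

lemma pencil_mem_slitPlane {s : ℂ} {θ : ℝ} (hc : 0 < s.im ∨ 0 < s.re) (h : θ ∈ Icc 0 (π / 2)) :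
    pencil s θ ∈ Complex.slitPlane := by
  have hpi := Real.pi_pos
  rcases h.1.eq_or_lt with h0 | h0
  · left; rw [pencil_re, ← h0]; simp
  · have h1 : 0 < Real.sin θ := Real.sin_pos_of_pos_of_lt_pi h0 (by linarith [h.2])
    have h2 : 0 ≤ Real.cos θ := Real.cos_nonneg_of_neg_pi_div_two_le_of_le (by linarith [h.1]) h.2
    rcases hc with hc | hc
    · right; rw [pencil_im]; positivity
    · left; rw [pencil_re]; positivity

lemma whExponent_hasDerivAt {s : ℂ} (hs : 0 < s.im ∨ 0 < s.re) :
    HasDerivAt whExponent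
      ((1 / π : ℝ) * ∫ θ in (0:ℝ)..(π / 2), (Real.sin θ : ℂ) / pencil s θ) s := by
  have hpi := Real.pi_pos
  obtain ⟨c, hc, hcs⟩ : ∃ c, 0 < c ∧ (2 * c ≤ s.im ∨ 2 * c ≤ s.re) := by
    rcases hs with h | h
    · exact ⟨s.im / 2, by positivity, Or.inl (by linarith)⟩
    · exact ⟨s.re / 2, by positivity, Or.inr (by linarith)⟩
  have hball : ∀ w ∈ Metric.ball s c, c ≤ w.im ∨ c ≤ w.re := by
    intro w hw
    rw [Metric.mem_ball, dist_eq_norm] at hw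
    rcases hcs with h | h
    · left; have := (abs_le.1 ((Complex.abs_im_le_norm (w - s)).trans hw.le)).1
      rw [Complex.sub_im] at this; linarith
    · right; have := (abs_le.1 ((Complex.abs_re_le_norm (w - s)).trans hw.le)).1
      rw [Complex.sub_re] at this; linarith
  unfold whExponent
  refine HasDerivAt.const_add _ (HasDerivAt.const_mul _ ?_)
  refine (intervalIntegral.hasDerivAt_integral_of_dominated_loc_of_deriv_le
    (F := fun w θ => Complex.log (pencil w θ)) (F' := fun w θ => (Real.sin θ : ℂ) / pencil w θ) (bound := fun _ => 1 / c)
    (Metric.ball_mem_nhds s hc) ?_ (intervalIntegrable_log_pencil s _ _) ?_ ?_ ?_ ?_).2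
  · exact Eventually.of_forall fun i =>
      (measurable_log_pencil.comp (measurable_const.prodMk measurable_id)).aestronglyMeasurable
  · refine Measurable.aestronglyMeasurable ?_
    refine Measurable.div (by fun_prop) ?_
    exact (continuous_pencil.comp (Continuous.prodMk_right s)).measurable
  · refine Eventually.of_forall fun θ hθ w hw => ?_
    rw [uIoc_of_le (by positivity)] at hθ
    have hθ' : θ ∈ Icc 0 (π/2) := ⟨hθ.1.le, hθ.2⟩
    have h1 : 0 < Real.sin θ := Real.sin_pos_of_pos_of_lt_pi hθ.1 (by linarith [hθ.2])
    have h2 := mul_sin_le_norm_pencil (hball w hw) hθ'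
    rw [norm_div, Complex.norm_real, Real.norm_of_nonneg h1.le, div_le_div_iff₀
      (lt_of_lt_of_le (by positivity) h2) hc]
    linarith
  · exact intervalIntegrable_const
  · refine Eventually.of_forall fun θ hθ w hw => ?_
    rw [uIoc_of_le (by positivity)] at hθ
    have hθ' : θ ∈ Icc 0 (π/2) := ⟨hθ.1.le, hθ.2⟩
    have hsl : pencil w θ ∈ Complex.slitPlane := pencil_mem_slitPlane
      ((hball w hw).imp (fun h => hc.trans_le h) (fun h => hc.trans_le h)) hθ'
    have hd : HasDerivAt (fun w => pencil w θ) (Real.sin θ : ℂ) w := by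
      unfold pencil
      simpa using ((hasDerivAt_id w).mul_const (Real.sin θ : ℂ)).const_add (Real.cos θ : ℂ)
    have := hd.clog hsl
    exact this

lemma whFactor_differentiableAt {s : ℂ} (hs : 0 < s.im ∨ 0 < s.re) :
    DifferentiableAt ℂ whFactor s :=
  (whExponent_hasDerivAt hs).differentiableAt.neg.cexp

lemma whExponent_im_of_nonneg {t : ℝ} (ht : 0 ≤ t) : (whExponent t).im = 0 := by
  rw [whExponent_im]
  have : ∫ θ in (0:ℝ)..(π / 2), Complex.arg (pencil t θ) = ∫ θ in (0:ℝ)..(π / 2), (0:ℝ) := by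
    apply intervalIntegral.integral_congr
    intro θ hθ
    rw [uIcc_of_le (by positivity)] at hθ
    have h1 : 0 ≤ Real.sin θ := Real.sin_nonneg_of_nonneg_of_le_pi hθ.1 (by linarith [hθ.2, Real.pi_pos])
    have h2 : 0 ≤ Real.cos θ := Real.cos_nonneg_of_neg_pi_div_two_le_of_le (by linarith [hθ.1, Real.pi_pos]) hθ.2
    simp only [pencil_ofReal]
    exact Complex.arg_ofReal_of_nonneg (by positivity)
  rw [this]; simp

lemma whExponent_re_zero : (whExponent 0).re = 0 := by
  have hpi := Real.pi_pos
  rw [whExponent_re]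
  have : ∫ θ in (0:ℝ)..(π / 2), Real.log ‖pencil 0 θ‖ = ∫ θ in (0:ℝ)..(π / 2), Real.log (Real.sin θ) := by
    have := intervalIntegral.integral_comp_sub_left (fun θ => Real.log (Real.sin θ)) (a := 0) (b := π/2) (π/2)
    rw [sub_self, sub_zero] at this
    rw [← this]
    apply intervalIntegral.integral_congr
    intro θ _
    have h := pencil_ofReal 0 θ
    simp only [Complex.ofReal_zero] at h
    simp only [h, Complex.norm_real, Real.norm_eq_abs, Real.log_abs, Real.sin_pi_div_two_sub]
    congr 1; ring
  rw [this, integral_log_sin_zero_pi_div_two]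
  field_simp; ring

lemma whExponent_re_nonneg {t : ℝ} (ht : 0 ≤ t) : 0 ≤ (whExponent t).re := by
  rw [← whExponent_re_zero, whExponent_re, whExponent_re]
  have hpi := Real.pi_pos
  gcongr
  apply intervalIntegral.integral_mono_ae_restrict (by positivity)
      (intervalIntegrable_log_norm_pencil 0 _ _) (intervalIntegrable_log_norm_pencil t _ _)
  have hne : ∀ᵐ θ ∂(volume.restrict (Icc 0 (π/2))), θ ≠ π/2 :=
      ae_restrict_of_ae (Measure.ae_ne volume _)
  filter_upwards [hne, ae_restrict_mem measurableSet_Icc] with θ hn hθ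
  have h1 : 0 ≤ Real.sin θ := Real.sin_nonneg_of_nonneg_of_le_pi hθ.1 (by linarith [hθ.2])
  have h2 : 0 < Real.cos θ := Real.cos_pos_of_mem_Ioo ⟨by linarith [hθ.1], lt_of_le_of_ne hθ.2 hn⟩
  have h := pencil_ofReal 0 θ
  simp only [Complex.ofReal_zero] at h
  rw [h, pencil_ofReal, Complex.norm_real, Complex.norm_real, Real.norm_of_nonneg (by positivity),
    Real.norm_of_nonneg (by positivity)]
  apply Real.log_le_log (by simpa using h2)
  nlinarith

lemma integral_sin_div_pencil {t : ℝ} (ht : 0 < t) :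
    ∫ θ in (0:ℝ)..(π / 2), Real.sin θ / (Real.cos θ + t * Real.sin θ)
      = (t * (π / 2) - Real.log t) / (1 + t ^ 2) := by
  have hpi := Real.pi_pos
  have hpos : ∀ θ ∈ uIcc 0 (π/2), 0 < Real.cos θ + t * Real.sin θ := by
    intro θ hθ
    rw [uIcc_of_le (by positivity)] at hθ
    have h2 : 0 ≤ Real.cos θ := Real.cos_nonneg_of_neg_pi_div_two_le_of_le (by linarith [hθ.1]) hθ.2
    rcases hθ.1.eq_or_lt with h | h
    · rw [← h]; simp
    · have h1 : 0 < Real.sin θ := Real.sin_pos_of_pos_of_lt_pi h (by linarith [hθ.2])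
      positivity
  have hderiv : ∀ θ ∈ uIcc 0 (π/2), HasDerivAt
      (fun θ => (t * θ - Real.log (Real.cos θ + t * Real.sin θ)) / (1 + t^2))
      (Real.sin θ / (Real.cos θ + t * Real.sin θ)) θ := by
    intro θ hθ
    have h := hpos θ hθ
    have hd : HasDerivAt (fun θ => Real.cos θ + t * Real.sin θ) (-Real.sin θ + t * Real.cos θ) θ :=
      (Real.hasDerivAt_cos θ).add ((Real.hasDerivAt_sin θ).const_mul t)
    refine (((hasDerivAt_id θ).const_mul t).sub (hd.log h.ne')).div_const (1 + t^2)
      |>.congr_deriv ?_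
    field_simp
    ring
  rw [intervalIntegral.integral_eq_sub_of_hasDerivAt hderiv]
  · simp
  · apply ContinuousOn.intervalIntegrable
    apply ContinuousOn.div (by fun_prop) (by fun_prop)
    exact fun θ hθ => (hpos θ hθ).ne'

lemma intervalIntegrable_etaF_integrand (a b : ℝ) :
    IntervalIntegrable (fun s => Real.log |s| / (1 + s ^ 2)) volume a b := by
  have h : IntervalIntegrable (fun s : ℝ => Real.log s * (1 + s^2)⁻¹) volume a b := by
    apply intervalIntegral.intervalIntegrable_log'.mul_continuousOn
    apply Continuous.continuousOn
    exact (by fun_prop : Continuous fun s : ℝ => 1 + s^2).inv₀ (fun s => by positivity)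
  simpa [div_eq_mul_inv] using h

lemma etaF_hasDerivAt {t : ℝ} (ht : 0 < t) :
    HasDerivAt etaF (1 / π * ((t * (π / 2) - Real.log t) / (1 + t ^ 2))) t := by
  have hpi := Real.pi_pos
  have hc : ContinuousAt (fun s : ℝ => Real.log |s| / (1 + s ^ 2)) t := by
    apply ContinuousAt.div
    · simp only [Real.log_abs]; exact Real.continuousAt_log ht.ne'
    · fun_prop
    · positivity
  have h1 : HasDerivAt (fun t => ∫ s in (0 : ℝ)..t, Real.log |s| / (1 + s ^ 2))
      (Real.log |t| / (1 + t ^ 2)) t := by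
    apply intervalIntegral.integral_hasDerivAt_right (intervalIntegrable_etaF_integrand 0 t) _ hc
    apply StronglyMeasurable.stronglyMeasurableAtFilter
    apply Measurable.stronglyMeasurable
    fun_prop
  have h2 : HasDerivAt (fun t : ℝ => 1 + t^2) (2 * t) t := by
    simpa using ((hasDerivAt_id t).pow 2).const_add 1
  have h3 := ((h2.log (by positivity)).div_const 4).sub (h1.const_mul (1/π))
  unfold etaF
  refine h3.congr_deriv ?_
  rw [abs_of_pos ht]
  field_simp
  ring

lemma whExponent_re_hasDerivAt {t : ℝ} (ht : 0 < t) :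
    HasDerivAt (fun t : ℝ => (whExponent t).re) (1 / π * ((t * (π / 2) - Real.log t) / (1 + t ^ 2))) t := by
  have h := (whExponent_hasDerivAt (s := (t:ℂ)) (Or.inr (by simpa using ht))).real_of_complex
  convert h using 1
  rw [Complex.re_ofReal_mul, ← integral_sin_div_pencil ht]
  congr 1
  have h3 : (∫ θ in (0:ℝ)..(π / 2), (Real.sin θ : ℂ) / pencil t θ)
      = ((∫ θ in (0:ℝ)..(π / 2), Real.sin θ / (Real.cos θ + t * Real.sin θ) : ℝ) : ℂ) := by
    rw [← intervalIntegral.integral_ofReal]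
    simp only [pencil_ofReal, Complex.ofReal_div]
  rw [h3, Complex.ofReal_re]

lemma whExponent_re_eq_etaF {t : ℝ} (ht : 0 < t) : (whExponent t).re = etaF t := by
  set d : ℝ → ℝ := fun t => (whExponent t).re - etaF t
  have hd : ∀ t ∈ Ioi (0:ℝ), HasDerivAt d 0 t := by
    intro t ht
    exact ((whExponent_re_hasDerivAt ht).sub (etaF_hasDerivAt ht)).congr_deriv (sub_self _)
  have hconst : ∀ s ∈ Ioi (0:ℝ), d s = d t := by
    intro s hs
    exact (isOpen_Ioi.is_const_of_deriv_eq_zero isPreconnected_Ioi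
      (fun x hx => (hd x hx).differentiableAt.differentiableWithinAt)
      (fun x hx => (hd x hx).deriv)) hs ht
  have hE : Tendsto (fun t : ℝ => (whExponent t).re) (𝓝[>] 0) (𝓝 0) := by
    have h := whFactor_tendsto (l := 𝓝[>] (0:ℝ)) (u := fun t => (t:ℂ)) (x := 0)
      (by simpa using (Complex.continuous_ofReal.tendsto 0).mono_left nhdsWithin_le_nhds)
      (Eventually.of_forall fun t => by simp) (by
        filter_upwards [self_mem_nhdsWithin] with t (ht : 0 < t) θ hθ
        have h1 : 0 ≤ Real.sin θ := Real.sin_nonneg_of_nonneg_of_le_pi hθ.1 (by linarith [hθ.2, Real.pi_pos])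
        have h2 : 0 ≤ Real.cos θ := Real.cos_nonneg_of_neg_pi_div_two_le_of_le (by linarith [hθ.1, Real.pi_pos]) hθ.2
        rw [pencil_ofReal, pencil_ofReal, Complex.norm_real, Complex.norm_real, Real.norm_of_nonneg (by positivity),
          Real.norm_of_nonneg (by positivity)]
        nlinarith [mul_nonneg ht.le h1])
    have h2 := h.norm
    simp only [norm_whFactor] at h2
    have h3 := (h2.log (by positivity)).neg
    simp only [Real.log_exp, neg_neg, Complex.ofReal_zero, whExponent_re_zero] at h3
    exact h3
  have heta : Tendsto etaF (𝓝[>] 0) (𝓝 0) := by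
    have hc : Continuous etaF := by
      unfold etaF
      apply Continuous.sub
      · apply Continuous.div_const
        exact (by fun_prop : Continuous fun s : ℝ => 1 + s^2).log (fun s => by positivity)
      · exact continuous_const.mul
          (intervalIntegral.continuous_primitive intervalIntegrable_etaF_integrand 0)
    have h0 : etaF 0 = 0 := by simp [etaF]
    simpa [h0] using (hc.tendsto 0).mono_left (nhdsWithin_le_nhds (s := Ioi 0))
  have h1 : Tendsto d (𝓝[>] 0) (𝓝 0) := by simpa using hE.sub heta
  have h2 : Tendsto d (𝓝[>] 0) (𝓝 (d t)) :=
    tendsto_const_nhds.congr' (by filter_upwards [self_mem_nhdsWithin] with s hs using (hconst s hs).symm)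
  have := tendsto_nhds_unique h2 h1
  exact sub_eq_zero.1 this

lemma etaF_nonneg {t : ℝ} (ht : 0 < t) : 0 ≤ etaF t :=
  whExponent_re_eq_etaF ht ▸ whExponent_re_nonneg ht.le

lemma whFactor_ofReal {t : ℝ} (ht : 0 < t) : whFactor t = (Real.exp (-etaF t) : ℝ) := by
  rw [whFactor, Complex.ofReal_exp, ← whExponent_re_eq_etaF ht]
  congr 1
  apply Complex.ext <;> simp [whExponent_im_of_nonneg ht.le]

lemma whExponent_im_neg {σ : ℝ} (hσ : 0 < σ) : (whExponent (-σ)).im = Real.arctan σ := by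
  have hpi := Real.pi_pos
  have h0 : 0 < Real.arctan σ := Real.arctan_pos.2 hσ
  have h1 : Real.arctan σ < π/2 := Real.arctan_lt_pi_div_two σ
  set β := π/2 - Real.arctan σ with hβ
  have harg : ∀ θ, pencil (-σ) θ = ((√(1 + σ^2) * Real.cos (θ + Real.arctan σ) : ℝ) : ℂ) := by
    intro θ
    rw [← cos_sub_mul_sin, show (-σ : ℂ) = ((-σ:ℝ):ℂ) by simp, pencil_ofReal]
    congr 1; ring
  have hInt : ∀ a b, IntervalIntegrable (fun θ => Complex.arg (pencil (-σ) θ)) volume a b := by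
    intro a b
    have := Complex.imCLM.integrable_comp (intervalIntegrable_log_pencil (-σ) a b).1
    have h2 := Complex.imCLM.integrable_comp (intervalIntegrable_log_pencil (-σ) a b).2
    simp only [Complex.imCLM_apply, Complex.log_im] at this h2
    exact ⟨this, h2⟩
  rw [whExponent_im, ← intervalIntegral.integral_add_adjacent_intervals (hInt 0 β) (hInt β (π/2))]
  have e1 : ∫ θ in (0:ℝ)..β, Complex.arg (pencil (-σ) θ) = ∫ θ in (0:ℝ)..β, (0:ℝ) := by
    apply intervalIntegral.integral_congr
    intro θ hθ
    rw [uIcc_of_le (by linarith)] at hθ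
    simp only [harg]
    apply Complex.arg_ofReal_of_nonneg
    have : 0 ≤ Real.cos (θ + Real.arctan σ) :=
      Real.cos_nonneg_of_neg_pi_div_two_le_of_le (by linarith [hθ.1]) (by linarith [hθ.2])
    positivity
  have e2 : ∫ θ in β..(π/2), Complex.arg (pencil (-σ) θ) = ∫ θ in β..(π/2), π := by
    apply intervalIntegral.integral_congr_ae
    refine Eventually.of_forall fun θ hθ => ?_
    rw [uIoc_of_le (by linarith)] at hθ
    rw [harg]
    apply Complex.arg_ofReal_of_neg
    have : Real.cos (θ + Real.arctan σ) < 0 :=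
      Real.cos_neg_of_pi_div_two_lt_of_lt (by linarith [hθ.1]) (by linarith [hθ.2])
    exact mul_neg_of_pos_of_neg (by positivity) this
  rw [e1, e2, intervalIntegral.integral_const, intervalIntegral.integral_const, hβ]
  simp only [smul_eq_mul]
  field_simp; ring

lemma whFactor_neg_div_re {σ : ℝ} (hσ : 0 < σ) :
    whFactor (-σ) / (-σ - Complex.I)
      = ((Real.exp (-(whExponent (-σ)).re) / √(1 + σ ^ 2) : ℝ) : ℂ) * Complex.I := by
  have hne : (-σ - Complex.I : ℂ) ≠ 0 := by
    intro h; have := congrArg Complex.im h; simp at this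
  rw [div_eq_iff hne, whFactor]
  have : -whExponent (-σ) = ((-(whExponent (-σ)).re : ℝ) : ℂ) + ((-Real.arctan σ : ℝ) : ℂ) * Complex.I := by
    apply Complex.ext
    · rw [Complex.add_re, Complex.re_ofReal_mul]; simp
    · rw [Complex.add_im, Complex.im_ofReal_mul]; simp [whExponent_im_neg hσ]
  rw [this, Complex.exp_add, Complex.exp_mul_I, ← Complex.ofReal_cos, ← Complex.ofReal_sin,
    ← Complex.ofReal_exp, Real.cos_neg, Real.sin_neg, Real.cos_arctan, Real.sin_arctan]
  have hs : √(1 + σ ^ 2) ≠ 0 := by positivity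
  have hs' : ((√(1 + σ ^ 2) : ℝ) : ℂ) ≠ 0 := by exact_mod_cast hs
  push_cast
  field_simp
  linear_combination (1 : ℂ) * Complex.I_sq

lemma whFactor_I : whFactor Complex.I = (1 / √2 : ℝ) * Complex.exp (-(π / 8) * Complex.I) := by
  have hpi := Real.pi_pos
  have hInt : ∫ θ in (0:ℝ)..(π / 2), Complex.log (pencil Complex.I θ)
      = ∫ θ in (0:ℝ)..(π / 2), (θ : ℂ) * Complex.I := by
    apply intervalIntegral.integral_congr
    intro θ hθ
    rw [uIcc_of_le (by positivity)] at hθ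
    simp only
    have : pencil Complex.I θ = Complex.exp (θ * Complex.I) := by
      rw [Complex.exp_mul_I, pencil]; push_cast; ring
    rw [this, Complex.log_exp] <;> simp <;> linarith [hθ.1, hθ.2]
  have h2 : ∫ θ in (0:ℝ)..(π / 2), (θ : ℂ) * Complex.I = ((π^2/8 : ℝ) : ℂ) * Complex.I := by
    rw [intervalIntegral.integral_mul_const, intervalIntegral.integral_ofReal, integral_id]
    congr 2; ring
  have hpc : (π : ℂ) ≠ 0 := by exact_mod_cast hpi.ne'
  rw [whFactor, whExponent, hInt, h2]
  have : -(((Real.log 2 / 2 : ℝ) : ℂ) + ((1 / π : ℝ) : ℂ) * (((π^2/8 : ℝ) : ℂ) * Complex.I))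
      = ((-(Real.log 2 / 2) : ℝ) : ℂ) + -(π / 8) * Complex.I := by
    push_cast; field_simp; ring
  rw [this, Complex.exp_add, ← Complex.ofReal_exp]
  congr 2
  rw [Real.exp_neg, ← Real.log_sqrt (by norm_num), Real.exp_log (by positivity), one_div]

lemma integrable_japanese : Integrable (fun x : ℝ => (1 + x ^ 2) ^ (-(3/4) : ℝ)) := by
  have h := integrable_rpow_neg_one_add_norm_sq (E := ℝ) (μ := volume) (r := 3/2) (by norm_num)
  refine h.congr (Eventually.of_forall fun x => ?_)
  simp only [Real.norm_eq_abs, sq_abs]; norm_num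

lemma integrable_whFactor_div : Integrable (fun x : ℝ => whFactor x / (x - Complex.I)) := by
  obtain ⟨C, hC, hf⟩ := norm_whFactor_le
  refine (integrable_japanese.const_mul C).mono' ?_ ?_
  · refine Measurable.aestronglyMeasurable ?_
    have := measurable_whFactor
    fun_prop
  · refine Eventually.of_forall fun x => ?_
    have h1 : ‖(x - Complex.I : ℂ)‖ = (1 + x^2) ^ (1/2 : ℝ) := by
      rw [← Real.sqrt_eq_rpow, Complex.norm_def, Complex.normSq_apply]; congr 1; simp; ring
    rw [norm_div, h1, div_eq_mul_inv, ← Real.rpow_neg (by positivity)]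
    have h2 := hf x
    rw [Complex.norm_real, Real.norm_eq_abs, sq_abs] at h2
    calc _ ≤ C * (1 + x ^ 2) ^ (-(1/4) : ℝ) * (1 + x ^ 2) ^ (-(1/2):ℝ) := by gcongr
      _ = _ := by rw [mul_assoc, ← Real.rpow_add (by positivity)]; norm_num

/-- The modulated factor, corrected by a rational function so that it vanishes at `I`. -/
noncomputable def whReduced (τ : ℝ) (s : ℂ) : ℂ :=
  Complex.exp (Complex.I * s * τ) * whFactor s -
    Complex.exp (-τ) * whFactor Complex.I * (2 * Complex.I / (s + Complex.I))

lemma norm_whReduced_le {τ : ℝ} (hτ : 0 ≤ τ) : ∃ C, 0 < C ∧ ∀ s : ℂ, 0 ≤ s.im →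
    ‖whReduced τ s‖ ≤ C * (1 + ‖s‖ ^ 2) ^ (-(1/4) : ℝ) := by
  obtain ⟨C, hC, hf⟩ := norm_whFactor_le
  set K := ‖Complex.exp (-τ) * whFactor Complex.I‖ * 2
  refine ⟨C + K, by positivity, fun s hs => ?_⟩
  rw [add_mul]
  refine (norm_sub_le _ _).trans (add_le_add ?_ ?_)
  · rw [norm_mul, Complex.norm_exp]
    have h1 : Real.exp (Complex.I * s * τ).re ≤ 1 := by
      apply Real.exp_le_one_iff.2; simp; positivity
    have := hf s
    nlinarith [norm_nonneg (whFactor s)]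
  · have hp : 0 < 1 + ‖s‖^2 := by positivity
    have h1 : (1 + ‖s‖^2) ≤ ‖s + Complex.I‖ ^ 2 := by
      rw [Complex.sq_norm, Complex.sq_norm, Complex.normSq_apply, Complex.normSq_apply]; simp; nlinarith
    have h2 : (1 + ‖s‖^2) ^ (1/2:ℝ) ≤ ‖s + Complex.I‖ := by
      rw [← Real.sqrt_eq_rpow]; exact Real.sqrt_le_iff.2 ⟨norm_nonneg _, h1⟩
    have h3 : (1 + ‖s‖^2) ^ (1/4:ℝ) ≤ (1 + ‖s‖^2) ^ (1/2:ℝ) :=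
      Real.rpow_le_rpow_of_exponent_le (by nlinarith [norm_nonneg s]) (by norm_num)
    rw [norm_mul, norm_div, norm_mul (2:ℂ), Complex.norm_I, Real.rpow_neg hp.le]
    simp only [Complex.norm_ofNat, mul_one, K]
    rw [div_eq_mul_inv, ← mul_assoc]
    gcongr
    exact h3.trans h2

lemma whReduced_differentiableOn (τ : ℝ) :
    DifferentiableOn ℂ (whReduced τ) {s | 0 < s.im} := by
  intro s (hs : 0 < s.im)
  have h1 := whFactor_differentiableAt (Or.inl hs)
  have h2 : s + Complex.I ≠ 0 := by
    intro h; have := congrArg Complex.im h; simp at this; linarith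
  apply DifferentiableAt.differentiableWithinAt
  unfold whReduced
  fun_prop (disch := exact h2)

lemma whReduced_I (τ : ℝ) : whReduced τ Complex.I = 0 := by
  have h : Complex.I * Complex.I * τ = -τ := by rw [Complex.I_mul_I]; ring
  rw [whReduced, h, ← two_mul, div_self (by simp), mul_one, sub_self]

lemma dslope_whReduced {τ : ℝ} {s : ℂ} (hs : s ≠ Complex.I) :
    dslope (whReduced τ) Complex.I s = whReduced τ s / (s - Complex.I) := by
  rw [dslope_of_ne _ hs, slope_def_field, whReduced_I, sub_zero]

lemma measurable_whReduced (τ : ℝ) : Measurable (whReduced τ) := by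
  have := measurable_whFactor
  unfold whReduced
  fun_prop

lemma norm_whReduced_div_le {τ : ℝ} (hτ : 0 ≤ τ) : ∃ C, 0 < C ∧ ∀ x δ : ℝ, 0 ≤ δ → δ < 1/2 →
    ‖whReduced τ (x + δ * Complex.I) / (x + δ * Complex.I - Complex.I)‖
      ≤ C * (1 + x ^ 2) ^ (-(3/4) : ℝ) := by
  obtain ⟨C, hC, hf⟩ := norm_whReduced_le hτ
  refine ⟨C * 2, by positivity, fun x δ h0 h1 => ?_⟩
  have hp : 0 < 1 + x ^ 2 := by positivity
  have h2 := hf (x + δ * Complex.I) (by simpa using h0)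
  have h3 : 1 + x^2 ≤ 1 + ‖(x + δ * Complex.I : ℂ)‖^2 := by
    rw [Complex.sq_norm, Complex.normSq_apply]; simp; nlinarith
  have h4 : ‖whReduced τ (x + δ * Complex.I)‖ ≤ C * (1 + x^2) ^ (-(1/4) : ℝ) := by
    refine h2.trans ?_
    gcongr ?_ * ?_
    exact Real.rpow_le_rpow_of_nonpos hp h3 (by norm_num)
  have h5 : (1 + x^2) ^ (1/2 : ℝ) / 2 ≤ ‖(x + δ * Complex.I - Complex.I : ℂ)‖ := by
    rw [← Real.sqrt_eq_rpow, div_le_iff₀ (by norm_num)]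
    refine Real.sqrt_le_iff.2 ⟨by positivity, ?_⟩
    rw [mul_pow, Complex.sq_norm, Complex.normSq_apply]; simp; nlinarith
  rw [norm_div]
  have hq : 0 < (1 + x^2) ^ (1/2 : ℝ) := by positivity
  calc _ ≤ C * (1 + x^2) ^ (-(1/4) : ℝ) / ((1 + x^2) ^ (1/2 : ℝ) / 2) := by gcongr
    _ = C * 2 * ((1 + x^2) ^ (-(1/4) : ℝ) * (1 + x^2) ^ (-(1/2) : ℝ)) := by
        rw [Real.rpow_neg hp.le (1/2)]; field_simp
    _ = _ := by rw [← Real.rpow_add hp]; norm_num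

lemma integrable_whReduced_line {τ : ℝ} (hτ : 0 ≤ τ) {δ : ℝ} (h0 : 0 < δ) (h1 : δ < 1 / 2) :
    Integrable (fun x : ℝ => whReduced τ (x + δ * Complex.I) / (x + δ * Complex.I - Complex.I)) := by
  obtain ⟨C, hC, hb⟩ := norm_whReduced_div_le hτ
  refine (integrable_japanese.const_mul C).mono' ?_ (Eventually.of_forall fun x => hb x δ h0.le h1)
  have := measurable_whReduced τ
  exact Measurable.aestronglyMeasurable (by fun_prop)

lemma integral_whReduced_line {τ : ℝ} (hτ : 0 ≤ τ) {δ : ℝ} (h0 : 0 < δ) (h1 : δ < 1 / 2) :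
    ∫ x : ℝ, whReduced τ (x + δ * Complex.I) / (x + δ * Complex.I - Complex.I) = 0 := by
  have hopen : IsOpen {s : ℂ | 0 < s.im} := isOpen_lt continuous_const Complex.continuous_im
  have hd : DifferentiableOn ℂ (dslope (whReduced τ) Complex.I) {s | 0 < s.im} :=
    (Complex.differentiableOn_dslope (hopen.mem_nhds (by simp))).2 (whReduced_differentiableOn τ)
  obtain ⟨C, hC, hf⟩ := norm_whReduced_le hτ
  have hline := tendsto_integral_line_of_decay (g := dslope (whReduced τ) Complex.I)
    (a := δ) (C := C * 2) (R := 2) h0.le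
    (hd.continuousOn.mono fun s (hs : δ ≤ s.im) => h0.trans_le hs)
    (fun s hs _ => hd.differentiableAt (hopen.mem_nhds (h0.trans hs))) (by
      intro s hs hR
      have hne : s ≠ Complex.I := by rintro rfl; norm_num at hR
      have hn : 0 < ‖s‖ := by linarith
      have h2 : ‖s‖ / 2 ≤ ‖s - Complex.I‖ := by
        have := norm_sub_norm_le s Complex.I
        rw [Complex.norm_I] at this; linarith
      rw [dslope_whReduced hne, norm_div]
      have h3 : ‖whReduced τ s‖ ≤ C * ‖s‖ ^ (-(1/2):ℝ) := by
        refine (hf s (h0.le.trans hs)).trans ?_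
        gcongr ?_ * ?_
        calc _ ≤ (‖s‖^2) ^ (-(1/4):ℝ) :=
              Real.rpow_le_rpow_of_nonpos (by positivity) (by linarith) (by norm_num)
          _ = _ := by rw [← Real.rpow_natCast, ← Real.rpow_mul hn.le]; norm_num
      calc _ ≤ C * ‖s‖ ^ (-(1/2):ℝ) / (‖s‖ / 2) := by gcongr
        _ = C * 2 * (‖s‖ ^ (-(1/2):ℝ) * ‖s‖ ^ (-1:ℝ)) := by rw [Real.rpow_neg_one]; field_simp
        _ = _ := by rw [← Real.rpow_add hn]; norm_num)
  refine tendsto_nhds_unique (intervalIntegral_tendsto_integral (integrable_whReduced_line hτ h0 h1)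
    tendsto_neg_atTop_atBot tendsto_id) (hline.congr fun T => ?_)
  apply intervalIntegral.integral_congr
  intro x _
  refine dslope_whReduced fun h => ?_
  have := congrArg Complex.im h
  simp at this; linarith

theorem integral_whFactor_div {τ : ℝ} (hτ : 0 ≤ τ) :
    ∫ x : ℝ, Complex.exp (Complex.I * x * τ) * (whFactor x / (x - Complex.I))
      = 2 * π * Complex.I * (Complex.exp (-τ) * whFactor Complex.I) := by
  obtain ⟨C, hC, hb⟩ := norm_whReduced_div_le hτ
  have hmeas := measurable_whReduced τ
  have hlim : Tendsto (fun δ : ℝ =>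
      ∫ x : ℝ, whReduced τ (x + δ * Complex.I) / (x + δ * Complex.I - Complex.I)) (𝓝[>] 0)
      (𝓝 (∫ x : ℝ, whReduced τ x / (x - Complex.I))) := by
    apply tendsto_integral_filter_of_dominated_convergence (fun x => C * (1 + x ^ 2) ^ (-(3/4) : ℝ))
    · exact Eventually.of_forall fun δ => Measurable.aestronglyMeasurable (by fun_prop)
    · filter_upwards [Ioo_mem_nhdsGT (by norm_num : (0:ℝ) < 1/2)] with δ hδ
      exact Eventually.of_forall fun x => hb x δ hδ.1.le hδ.2
    · exact integrable_japanese.const_mul C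
    · refine Eventually.of_forall fun x => ?_
      have hl : Tendsto (fun δ : ℝ => (x + δ * Complex.I : ℂ)) (𝓝[>] 0) (𝓝 x) := by
        have : Continuous fun δ : ℝ => (x:ℂ) + δ * Complex.I := by fun_prop
        simpa using (this.tendsto 0).mono_left nhdsWithin_le_nhds
      have hxI : (x:ℂ) - Complex.I ≠ 0 := by
        intro h; have := congrArg Complex.im h; simp at this
      have hxI' : (x:ℂ) + Complex.I ≠ 0 := by
        intro h; have := congrArg Complex.im h; simp at this
      refine Tendsto.div ?_ (hl.sub tendsto_const_nhds) hxI
      unfold whReduced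
      refine Tendsto.sub (Tendsto.mul ?_ (whFactor_tendsto_vertical x)) ?_
      · exact (Complex.continuous_exp.tendsto _).comp
          ((tendsto_const_nhds.mul hl).mul tendsto_const_nhds)
      · exact tendsto_const_nhds.mul
          (tendsto_const_nhds.div (hl.add tendsto_const_nhds) hxI')
  have hzero : ∫ x : ℝ, whReduced τ x / (x - Complex.I) = 0 := by
    refine tendsto_nhds_unique hlim (tendsto_const_nhds.congr' ?_)
    filter_upwards [Ioo_mem_nhdsGT (by norm_num : (0:ℝ) < 1/2)] with δ hδ
    exact (integral_whReduced_line hτ hδ.1 hδ.2).symm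
  have hsplit : ∀ x : ℝ, whReduced τ x / (x - Complex.I)
      = Complex.exp (Complex.I * x * τ) * (whFactor x / (x - Complex.I))
        - 2 * Complex.I * (Complex.exp (-τ) * whFactor Complex.I) * (((1 + x^2)⁻¹ : ℝ) : ℂ) := by
    intro x
    have hxI : (x:ℂ) - Complex.I ≠ 0 := by
      intro h; have := congrArg Complex.im h; simp at this
    have hxI' : (x:ℂ) + Complex.I ≠ 0 := by
      intro h; have := congrArg Complex.im h; simp at this
    have h1 : (((1 + x^2)⁻¹ : ℝ) : ℂ) = ((x - Complex.I) * (x + Complex.I))⁻¹ := by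
      push_cast; congr 1; linear_combination Complex.I_sq
    rw [h1, whReduced]
    field_simp
  have hi1 : Integrable fun x : ℝ =>
      Complex.exp (Complex.I * x * τ) * (whFactor x / (x - Complex.I)) := by
    refine integrable_whFactor_div.bdd_mul (c := 1) (by fun_prop) (Eventually.of_forall fun x => ?_)
    rw [Complex.norm_exp]; simp
  have hi2 : Integrable fun x : ℝ => 2 * Complex.I * (Complex.exp (-τ) * whFactor Complex.I) *
      (((1 + x^2)⁻¹ : ℝ) : ℂ) := (integrable_inv_one_add_sq.ofReal).const_mul _
  simp_rw [hsplit] at hzero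
  rw [integral_sub hi1 hi2, integral_const_mul, integral_complex_ofReal,
    integral_univ_inv_one_add_sq, sub_eq_zero] at hzero
  rw [hzero]; ring

lemma integral_Iic_eq_integral_Ioi_neg (g : ℝ → ℂ) :
    ∫ x in Iic (0:ℝ), g x = ∫ t in Ioi (0:ℝ), g (-t) := by
  have := integral_comp_neg_Ioi (0:ℝ) g
  rw [this, neg_zero]

lemma integral_eq_integral_Ioi_add_neg {g : ℝ → ℂ} (hg : Integrable g) :
    ∫ x, g x = ∫ t in Ioi (0:ℝ), (g t + g (-t)) := by
  rw [integral_add hg.integrableOn hg.comp_neg.integrableOn, ← integral_Iic_eq_integral_Ioi_neg,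
    add_comm, intervalIntegral.integral_Iic_add_Ioi hg.integrableOn hg.integrableOn]

/-- The square of a difference quotient, with its simple pole at `c` moved to `c - I`. -/
noncomputable def regQuotient (W : ℂ → ℂ) (c : ℂ) (s : ℂ) : ℂ :=
  dslope (dslope W c) c s + deriv W c / (s - c + Complex.I)

lemma regQuotient_of_ne {W : ℂ → ℂ} {c s : ℂ} (h : s ≠ c) (h' : s - c + Complex.I ≠ 0) :
    regQuotient W c s = (W s - W c) / (s - c) ^ 2
      - Complex.I * deriv W c / ((s - c) * (s - c + Complex.I)) := by
  have : s - c ≠ 0 := sub_ne_zero.2 h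
  rw [regQuotient, dslope_of_ne _ h, slope_def_field, dslope_same, dslope_of_ne _ h, slope_def_field]
  field_simp
  ring

lemma add_I_ne_zero {s : ℂ} (h : 0 ≤ s.im) : s + Complex.I ≠ 0 := by
  intro h0; have := congrArg Complex.im h0; simp at this; linarith

section
variable {W : ℂ → ℂ} {c B : ℝ}

lemma regQuotient_decay (hb : ∀ s : ℂ, 0 ≤ s.im → ‖W s‖ ≤ B) :
    ∃ C, ∀ s : ℂ, 0 ≤ s.im → 2 * |c| + 2 ≤ ‖s‖ →
      ‖regQuotient W c s‖ ≤ C * ‖s‖ ^ (-(3/2) : ℝ) := by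
  have hB : 0 ≤ B := (norm_nonneg _).trans (hb 0 (by simp))
  refine ⟨8 * B + 4 * ‖deriv W c‖, fun s hs hR => ?_⟩
  have hc := abs_nonneg c
  have hs1 : 1 ≤ ‖s‖ := by linarith
  have hs0 : 0 < ‖s‖ := by linarith
  have h1 : ‖s‖ / 2 ≤ ‖s - c‖ := by
    have := norm_sub_norm_le s c
    rw [Complex.norm_real, Real.norm_eq_abs] at this; linarith
  have him : 0 ≤ (s - c).im := by simpa using hs
  have h2 : ‖s - c‖ ≤ ‖s - c + Complex.I‖ := by
    rw [Complex.norm_def, Complex.norm_def]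
    apply Real.sqrt_le_sqrt
    rw [Complex.normSq_apply, Complex.normSq_apply]; simp; nlinarith
  have hne : s ≠ c := by
    rintro rfl
    rw [sub_self, norm_zero] at h1; linarith
  rw [regQuotient_of_ne hne (add_I_ne_zero him)]
  have hW : ‖W s - W c‖ ≤ 2 * B :=
    (norm_sub_le _ _).trans (by linarith [hb s hs, hb c (by simp)])
  have hfin : (‖s‖^2)⁻¹ ≤ ‖s‖ ^ (-(3/2) : ℝ) := by
    rw [← Real.rpow_natCast, ← Real.rpow_neg hs0.le]
    exact Real.rpow_le_rpow_of_exponent_le hs1 (by norm_num)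
  calc _ ≤ ‖W s - W c‖ / ‖s - c‖ ^ 2 + ‖deriv W c‖ / (‖s - c‖ * ‖s - c + Complex.I‖) := by
        refine (norm_sub_le _ _).trans (le_of_eq ?_)
        simp
    _ ≤ 2 * B / (‖s‖ / 2) ^ 2 + ‖deriv W c‖ / (‖s‖ / 2 * (‖s‖ / 2)) := by
        gcongr
        exact h1.trans h2
    _ = (8 * B + 4 * ‖deriv W c‖) * (‖s‖^2)⁻¹ := by field_simp; ring
    _ ≤ _ := by gcongr

variable (hc : c < 0) (hcont : ContinuousOn W {s | s.re ≤ 0 ∨ 0 ≤ s.im})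
  (hdl : DifferentiableOn ℂ W {s | s.re < 0})
  (hdr : ∀ s : ℂ, 0 < s.im → s.re ≠ 0 → DifferentiableAt ℂ W s)
  (hb : ∀ s : ℂ, 0 ≤ s.im → ‖W s‖ ≤ B)
include hc hcont hdl

lemma regQuotient_continuousOn : ContinuousOn (regQuotient W c) {s | 0 ≤ s.im} := by
  have hopen : IsOpen {s : ℂ | s.re < 0} := isOpen_lt Complex.continuous_re continuous_const
  have hcm : {s : ℂ | s.re < 0} ∈ 𝓝 (c:ℂ) := hopen.mem_nhds (by simpa using hc)
  have hS : {s : ℂ | s.re ≤ 0 ∨ 0 ≤ s.im} ∈ 𝓝 (c:ℂ) :=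
    mem_of_superset hcm fun s (hs : s.re < 0) => Or.inl hs.le
  have hd1 : DifferentiableOn ℂ (dslope W c) {s | s.re < 0} :=
    (Complex.differentiableOn_dslope hcm).2 hdl
  have h1 : ContinuousOn (dslope W c) {s | s.re ≤ 0 ∨ 0 ≤ s.im} :=
    (continuousOn_dslope hS).2 ⟨hcont, hdl.differentiableAt hcm⟩
  have h2 : ContinuousOn (dslope (dslope W c) c) {s | s.re ≤ 0 ∨ 0 ≤ s.im} :=
    (continuousOn_dslope hS).2 ⟨h1, hd1.differentiableAt hcm⟩
  refine (h2.mono fun s (hs : 0 ≤ s.im) => Or.inr hs).add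
    (ContinuousOn.div (by fun_prop) (by fun_prop) fun s (hs : 0 ≤ s.im) => ?_)
  exact add_I_ne_zero (by simpa using hs)

include hb

lemma integrable_regQuotient : Integrable (fun x : ℝ => regQuotient W c x) := by
  obtain ⟨C, hC⟩ := regQuotient_decay (c := c) hb
  have hcg : Continuous (fun x : ℝ => regQuotient W c x) := by
    rw [← continuousOn_univ]
    exact (regQuotient_continuousOn hc hcont hdl).comp Complex.continuous_ofReal.continuousOn
      fun x _ => by simp
  refine hcg.locallyIntegrable.integrable_of_isBigO_cocompact
    (g := fun x : ℝ => (1 + x^2) ^ (-(3/4):ℝ)) ?_ (integrable_japanese.integrableAtFilter _)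
  refine Asymptotics.IsBigO.of_bound (|C| * 2) ?_
  have hev : ∀ᶠ x : ℝ in cocompact ℝ, 2 * |c| + 2 ≤ ‖x‖ :=
    tendsto_norm_cocompact_atTop.eventually_ge_atTop _
  filter_upwards [hev] with x hx
  have hx0 : 0 < ‖x‖ := by linarith [abs_nonneg c]
  have hx1 : 1 ≤ ‖x‖ := by linarith [abs_nonneg c]
  have h := hC x (by simp) (by rwa [Complex.norm_real])
  rw [Complex.norm_real] at h
  rw [Real.norm_of_nonneg (by positivity : 0 ≤ (1 + x^2) ^ (-(3/4):ℝ))]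
  have h3 : ‖x‖ ^ (-(3/2):ℝ) ≤ 2 * (1 + x^2) ^ (-(3/4):ℝ) := by
    have h4 : (1 + x^2) ≤ 2 * ‖x‖^2 := by rw [← sq_abs x, ← Real.norm_eq_abs]; nlinarith
    have h5 := Real.rpow_le_rpow_of_nonpos (by positivity) h4 (by norm_num : (-(3/4):ℝ) ≤ 0)
    rw [Real.mul_rpow (by norm_num) (by positivity), ← Real.rpow_natCast, ← Real.rpow_mul hx0.le] at h5
    have h6 : (1/2:ℝ) ≤ 2 ^ (-(3/4):ℝ) := by
      rw [show (1/2:ℝ) = 2 ^ (-1:ℝ) by rw [Real.rpow_neg_one]; norm_num]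
      exact Real.rpow_le_rpow_of_exponent_le (by norm_num) (by norm_num)
    norm_num at h5 ⊢
    have h7 : 0 < ‖x‖ ^ (-(3/2):ℝ) := by positivity
    norm_num at h6 h7
    nlinarith
  calc _ ≤ C * ‖x‖ ^ (-(3/2):ℝ) := h
    _ ≤ |C| * ‖x‖ ^ (-(3/2):ℝ) := by gcongr; exact le_abs_self C
    _ ≤ |C| * (2 * (1 + x^2) ^ (-(3/4):ℝ)) := by gcongr
    _ = _ := by ring

include hdr

lemma integral_regQuotient : ∫ x : ℝ, regQuotient W c x = 0 := by
  obtain ⟨C, hC⟩ := regQuotient_decay (c := c) hb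
  have hline := tendsto_integral_line_of_decay (g := regQuotient W c) (a := 0) le_rfl
    (regQuotient_continuousOn hc hcont hdl) (fun s hs hre => by
      have hne : s ≠ c := by rintro rfl; simp at hs
      have h1 : DifferentiableAt ℂ (dslope (dslope W c) c) s := by
        rw [differentiableAt_dslope_of_ne hne, differentiableAt_dslope_of_ne hne]
        exact hdr s hs hre
      have h2 : s - c + Complex.I ≠ 0 := add_I_ne_zero (by simpa using hs.le)
      exact h1.add (DifferentiableAt.div (by fun_prop) (by fun_prop) h2)) hC
  refine tendsto_nhds_unique (intervalIntegral_tendsto_integral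
    (integrable_regQuotient hc hcont hdl hb) tendsto_neg_atTop_atBot tendsto_id) ?_
  simpa using hline

/-- The second-difference integral of a boundary value of a bounded holomorphic function. -/
theorem integral_secondDiff_boundary :
    IntegrableOn (fun t : ℝ => (W (c + t) + W (c - t) - 2 * W c) / t ^ 2) (Ioi 0) ∧
    ∫ t in Ioi (0:ℝ), (W (c + t) + W (c - t) - 2 * W c) / t ^ 2 = Complex.I * π * deriv W c := by
  have hi := integrable_regQuotient hc hcont hdl hb
  have h0 := integral_regQuotient hc hcont hdl hdr hb
  have hi' : Integrable fun t : ℝ => regQuotient W c ((t + c : ℝ)) := hi.comp_add_right c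
  have h0' : ∫ t : ℝ, regQuotient W c ((t + c : ℝ)) = 0 := by
    rw [← h0]; exact integral_add_right_eq_self (fun t : ℝ => regQuotient W c t) c
  rw [integral_eq_integral_Ioi_add_neg hi'] at h0'
  have hsum : IntegrableOn (fun t : ℝ => regQuotient W c ((t + c : ℝ)) +
    regQuotient W c ((-t + c : ℝ))) (Ioi 0) := hi'.integrableOn.add hi'.comp_neg.integrableOn
  have hinv : IntegrableOn (fun t : ℝ => 2 * Complex.I * deriv W c * (((1 + t^2)⁻¹ : ℝ) : ℂ)) (Ioi 0) :=
    ((integrable_inv_one_add_sq.ofReal).const_mul _).integrableOn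
  have heq : EqOn (fun t : ℝ => regQuotient W c ((t + c : ℝ)) + regQuotient W c ((-t + c : ℝ))
      + 2 * Complex.I * deriv W c * (((1 + t^2)⁻¹ : ℝ) : ℂ))
      (fun t : ℝ => (W (c + t) + W (c - t) - 2 * W c) / t ^ 2) (Ioi 0) := by
    intro t (ht : 0 < t)
    have htc : (t:ℂ) ≠ 0 := by exact_mod_cast ht.ne'
    have hp : (t:ℂ) + Complex.I ≠ 0 := add_I_ne_zero (by simp)
    have hm : -(t:ℂ) + Complex.I ≠ 0 := add_I_ne_zero (by simp)
    simp only
    push_cast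
    have e1 : (t:ℂ) + c - c = t := by ring
    have e2 : -(t:ℂ) + c - c = -t := by ring
    rw [regQuotient_of_ne (by simpa using htc) (by rwa [e1]),
      regQuotient_of_ne (by simpa using htc) (by rwa [e2]), e1, e2]
    have h3 : ((1:ℂ) + t^2)⁻¹ = -((t + Complex.I) * (-t + Complex.I))⁻¹ := by
      rw [← inv_neg]; congr 1; linear_combination Complex.I_sq
    rw [h3, show (t:ℂ) + c = c + t by ring, show -(t:ℂ) + c = c - t by ring]
    field_simp
    ring
  refine ⟨(hsum.add hinv).congr_fun heq measurableSet_Ioi, ?_⟩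
  rw [← setIntegral_congr_fun measurableSet_Ioi heq, integral_add hsum hinv, h0', zero_add,
    integral_const_mul, integral_complex_ofReal, integral_Ioi_inv_one_add_sq]
  simp
  ring

end

/-- Boundary density of the factor on the positive half-line. -/
noncomputable def densPos (t : ℝ) : ℂ := whFactor t / (t - Complex.I)

/-- Boundary density of the factor on the negative half-line. -/
noncomputable def densNeg (t : ℝ) : ℂ := whFactor (-t) / (-t - Complex.I)

lemma integrable_densNeg : Integrable densNeg := by
  have := integrable_whFactor_div.comp_neg
  unfold densNeg
  simpa using this

lemma integrable_densPos : Integrable densPos := integrable_whFactor_div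

lemma integrableOn_norm_mul_exp {h : ℝ → ℂ} (hh : IntegrableOn h (Ioi 0)) {a : ℝ} (ha : 0 < a) :
    IntegrableOn (fun t => ‖h t‖ * Real.exp (-(a * t))) (Ioi 0) := by
  refine hh.norm.mono' (hh.norm.aestronglyMeasurable.mul (by fun_prop)) ?_
  filter_upwards [ae_restrict_mem measurableSet_Ioi] with t (ht : 0 < t)
  rw [norm_mul, norm_norm, Real.norm_of_nonneg (Real.exp_pos _).le]
  exact mul_le_of_le_one_right (norm_nonneg _) (Real.exp_le_one_iff.2 (by nlinarith))

lemma halfLaplace_hasDerivAt_of_integrable {h : ℝ → ℂ} (hh : IntegrableOn h (Ioi 0)) {z : ℂ}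
    (hz : 0 < z.re) : HasDerivAt (halfLaplace h) (-halfLaplace (fun t => t * h t) z) z :=
  halfLaplace_hasDerivAt (fun _ ha => integrableOn_norm_mul_exp hh ha) hh.aestronglyMeasurable hz

/-- The holomorphic function whose real boundary value is a multiple of the eigenfunction. -/
noncomputable def whWave (s : ℂ) : ℂ :=
  if s.re ≤ 0 then 2 * π * Complex.I * whFactor Complex.I * Complex.exp (Complex.I * s)
    - halfLaplace densPos (-s)
  else halfLaplace densNeg s

lemma whWave_of_nonpos {s : ℂ} (h : s.re ≤ 0) : whWave s =
    2 * π * Complex.I * whFactor Complex.I * Complex.exp (Complex.I * s)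
    - halfLaplace densPos (-s) := if_pos h

lemma whWave_of_nonneg {s : ℂ} (h : 0 ≤ s.re) (h' : 0 ≤ s.im) :
    whWave s = halfLaplace densNeg s := by
  rcases h.eq_or_lt with h0 | h0
  · have hs : s = Complex.I * (s.im : ℂ) := by
      apply Complex.ext <;> simp [← h0]
    rw [whWave_of_nonpos h0.symm.le, sub_eq_iff_eq_add]
    have key := integral_whFactor_div h'
    have hi : Integrable fun x : ℝ =>
        Complex.exp (Complex.I * x * s.im) * (whFactor x / (x - Complex.I)) := by
      refine integrable_whFactor_div.bdd_mul (c := 1) (by fun_prop) (Eventually.of_forall fun x => ?_)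
      rw [Complex.norm_exp]; simp
    rw [integral_eq_integral_Ioi_add_neg hi, integral_add hi.integrableOn hi.comp_neg.integrableOn] at key
    have e1 : Complex.I * s = -s.im := by
      conv_lhs => rw [hs]
      linear_combination (s.im : ℂ) * Complex.I_sq
    rw [e1, halfLaplace, halfLaplace]
    have e2 : ∀ t : ℝ, Complex.I * t * s.im = -t * -s := by
      intro t; conv_rhs => rw [hs]
      ring
    have e3 : ∀ t : ℝ, Complex.I * (-t : ℝ) * s.im = -t * s := by
      intro t; conv_rhs => rw [hs]
      push_cast; ring
    simp only [e3] at key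
    simp only [e2] at key
    rw [show 2 * π * Complex.I * whFactor Complex.I * Complex.exp (-s.im)
      = 2 * π * Complex.I * (Complex.exp (-s.im) * whFactor Complex.I) by ring, ← key, add_comm]
    congr 1
    · refine setIntegral_congr_fun measurableSet_Ioi fun t _ => ?_
      simp only [densNeg]; push_cast; ring
    · refine setIntegral_congr_fun measurableSet_Ioi fun t _ => ?_
      simp only [densPos]; ring
  · exact if_neg (not_le.2 h0)

lemma whWave_continuousOn : ContinuousOn whWave {s | s.re ≤ 0 ∨ 0 ≤ s.im} := by
  have hset : {s : ℂ | s.re ≤ 0 ∨ 0 ≤ s.im} = {s | s.re ≤ 0} ∪ {s | 0 ≤ s.re ∧ 0 ≤ s.im} := by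
    ext s
    constructor
    · rintro (h | h)
      · exact Or.inl h
      · exact (le_total s.re 0).imp id fun h' => ⟨h', h⟩
    · rintro (h | h)
      · exact Or.inl h
      · exact Or.inr h.2
  rw [hset]
  have c1 : IsClosed {s : ℂ | s.re ≤ 0} := isClosed_le Complex.continuous_re continuous_const
  have c2 : IsClosed {s : ℂ | 0 ≤ s.re ∧ 0 ≤ s.im} :=
    (isClosed_le continuous_const Complex.continuous_re).inter
      (isClosed_le continuous_const Complex.continuous_im)
  refine ContinuousOn.union_of_isClosed ?_ ?_ c1 c2
  · refine ContinuousOn.congr ?_ fun s hs => whWave_of_nonpos hs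
    refine ContinuousOn.sub (by fun_prop) ?_
    exact (halfLaplace_continuousOn integrable_densPos.integrableOn).comp (by fun_prop)
      fun s (hs : s.re ≤ 0) => by simpa using hs
  · refine ContinuousOn.congr ?_ fun s hs => whWave_of_nonneg hs.1 hs.2
    exact (halfLaplace_continuousOn integrable_densNeg.integrableOn).mono fun s hs => hs.1

lemma whWave_hasDerivAt {s : ℂ} (hs : s.re < 0) : HasDerivAt whWave
    (2 * π * Complex.I * whFactor Complex.I * (Complex.exp (Complex.I * s) * Complex.I)
    - halfLaplace (fun t => t * densPos t) (-s)) s := by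
  have hopen : IsOpen {s : ℂ | s.re < 0} := isOpen_lt Complex.continuous_re continuous_const
  have h1 := (halfLaplace_hasDerivAt_of_integrable integrable_densPos.integrableOn
    (z := -s) (by simpa using hs)).comp s (hasDerivAt_neg s)
  have h2 : HasDerivAt (fun s => Complex.exp (Complex.I * s)) (Complex.exp (Complex.I * s) * Complex.I) s := by
    simpa using ((hasDerivAt_id s).const_mul Complex.I).cexp
  have h3 := (h2.const_mul (2 * π * Complex.I * whFactor Complex.I)).sub h1
  rw [neg_mul_neg, mul_one] at h3
  refine h3.congr_of_eventuallyEq ?_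
  filter_upwards [hopen.mem_nhds hs] with w hw
  exact whWave_of_nonpos (le_of_lt hw)

lemma whWave_differentiableAt {s : ℂ} (hre : s.re ≠ 0) :
    DifferentiableAt ℂ whWave s := by
  rcases lt_or_gt_of_ne hre with h | h
  · exact (whWave_hasDerivAt h).differentiableAt
  · have hopen : IsOpen {s : ℂ | 0 < s.re} := isOpen_lt continuous_const Complex.continuous_re
    refine ((halfLaplace_hasDerivAt_of_integrable integrable_densNeg.integrableOn h).congr_of_eventuallyEq
      ?_).differentiableAt
    filter_upwards [hopen.mem_nhds h] with w hw
    exact if_neg (not_le.2 hw)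

lemma norm_whWave_le : ∃ B, ∀ s : ℂ, 0 ≤ s.im → ‖whWave s‖ ≤ B := by
  refine ⟨max (‖2 * π * Complex.I * whFactor Complex.I‖ + ∫ t in Ioi (0:ℝ), ‖densPos t‖)
    (∫ t in Ioi (0:ℝ), ‖densNeg t‖), fun s hs => ?_⟩
  rcases le_or_gt s.re 0 with h | h
  · rw [whWave_of_nonpos h]
    refine le_max_of_le_left ((norm_sub_le _ _).trans (add_le_add ?_ ?_))
    · rw [norm_mul, Complex.norm_exp]
      exact mul_le_of_le_one_right (norm_nonneg _) (Real.exp_le_one_iff.2 (by simpa using hs))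
    · exact norm_halfLaplace_le integrable_densPos.integrableOn (by simpa using h)
  · rw [whWave_of_nonneg h.le hs]
    exact le_max_of_le_right (norm_halfLaplace_le integrable_densNeg.integrableOn h.le)

lemma halfLaplace_ofReal_re {h : ℝ → ℂ} {y : ℝ} (hi : IntegrableOn (fun t => h t * Complex.exp (-t * y)) (Ioi 0)) :
    (halfLaplace h y).re = ∫ t in Ioi (0:ℝ), (h t).re * Real.exp (-t * y) := by
  have h1 := integral_re (𝕜 := ℂ) hi
  rw [halfLaplace]
  simp only [RCLike.re_eq_complex_re] at h1
  rw [← h1]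
  refine integral_congr_ae (Eventually.of_forall fun t => ?_)
  have : Complex.exp (-t * y) = ((Real.exp (-t * y) : ℝ) : ℂ) := by push_cast; rfl
  simp only [this, Complex.re_mul_ofReal]

lemma integrableOn_mul_cexp {h : ℝ → ℂ} (hh : IntegrableOn h (Ioi 0)) {y : ℝ} (hy : 0 ≤ y) :
    IntegrableOn (fun t => h t * Complex.exp (-t * y)) (Ioi 0) := by
  refine hh.norm.mono' (hh.aestronglyMeasurable.mul (by fun_prop)) ?_
  filter_upwards [ae_restrict_mem measurableSet_Ioi] with t (ht : 0 < t)
  rw [norm_mul, Complex.norm_exp]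
  refine mul_le_of_le_one_right (norm_nonneg _) (Real.exp_le_one_iff.2 ?_)
  have : (-(t:ℂ) * y).re = -(t * y) := by simp
  rw [this]; nlinarith [mul_nonneg ht.le hy]

lemma whWave_re_of_nonneg {y : ℝ} (hy : 0 ≤ y) : (whWave y).re = 0 := by
  rw [whWave_of_nonneg (by simpa using hy) (by simp),
    halfLaplace_ofReal_re (integrableOn_mul_cexp integrable_densNeg.integrableOn hy)]
  rw [setIntegral_congr_fun (g := fun _ => (0:ℝ)) measurableSet_Ioi, integral_zero]
  intro t ht
  simp only [densNeg, whFactor_neg_div_re ht]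
  rw [Complex.re_ofReal_mul, Complex.I_re, mul_zero, zero_mul]

lemma densPos_re {t : ℝ} (ht : 0 < t) : (densPos t).re = t / (1 + t^2) * Real.exp (-etaF t) := by
  rw [densPos, whFactor_ofReal ht, Complex.div_re]
  simp [Complex.normSq_apply, -Complex.ofReal_exp]; ring

lemma densPos_im {t : ℝ} (ht : 0 < t) : (densPos t).im = 1 / (1 + t^2) * Real.exp (-etaF t) := by
  rw [densPos, whFactor_ofReal ht, Complex.div_im]
  simp [Complex.normSq_apply, -Complex.ofReal_exp]; ring

lemma residue_eq (y : ℝ) : 2 * π * Complex.I * whFactor Complex.I * Complex.exp (Complex.I * (-y : ℝ))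
    = ((√2 * π : ℝ) : ℂ) * ((Real.sin (y + π / 8) : ℝ) + (Real.cos (y + π/8) : ℝ) * Complex.I) := by
  have h : Complex.exp (-(π / 8) * Complex.I) * Complex.exp (Complex.I * (-y:ℝ))
      = (Real.cos (y + π/8) : ℝ) - (Real.sin (y + π / 8) : ℝ) * Complex.I := by
    rw [← Complex.exp_add, show -(π / 8 : ℂ) * Complex.I + Complex.I * (-y:ℝ)
      = ((-(y + π/8) : ℝ) : ℂ) * Complex.I by push_cast; ring, Complex.exp_mul_I,
      ← Complex.ofReal_cos, ← Complex.ofReal_sin, Real.cos_neg, Real.sin_neg]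
    push_cast; ring
  have h2 : (2:ℂ) * ((1 / √2 : ℝ) : ℂ) = ((√2 : ℝ) : ℂ) := by
    have : (2:ℝ) * (1 / √2) = √2 := by
      field_simp; rw [Real.sq_sqrt (by norm_num)]
    exact_mod_cast this
  rw [whFactor_I, show 2 * π * Complex.I * (((1 / √2 : ℝ) : ℂ) * Complex.exp (-(π / 8) * Complex.I))
      * Complex.exp (Complex.I * (-y : ℝ)) = (2 * ((1 / √2 : ℝ) : ℂ)) * π * Complex.I *
      (Complex.exp (-(π / 8) * Complex.I) * Complex.exp (Complex.I * (-y:ℝ))) by ring, h, h2]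
  push_cast
  linear_combination (-(√2:ℂ) * π * Complex.sin (y + π/8)) * Complex.I_sq

lemma sqrt_two_mul_pi_mul : √2 * π * (√2 / (2 * π)) = 1 := by
  have := Real.pi_pos
  field_simp; rw [Real.sq_sqrt (by norm_num)]

lemma whWave_re_neg {y : ℝ} (hy : 0 < y) : (whWave (-y : ℝ)).re = √2 * π * psi 1 y := by
  rw [whWave_of_nonpos (by simpa using hy.le), residue_eq]
  have e : -((-y:ℝ):ℂ) = y := by push_cast; ring
  rw [e, Complex.sub_re, halfLaplace_ofReal_re (integrableOn_mul_cexp integrable_densPos.integrableOn hy.le),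
    psi, if_pos hy, rfun, one_mul, mul_sub, ← mul_assoc, sqrt_two_mul_pi_mul, one_mul]
  congr 1
  · rw [Complex.re_ofReal_mul]; simp [-Complex.ofReal_sin, -Complex.ofReal_cos]
  · refine setIntegral_congr_fun measurableSet_Ioi fun t ht => ?_
    simp only [densPos_re ht]

lemma deriv_whWave_re {y : ℝ} (hy : 0 < y) :
    (Complex.I * π * deriv whWave (-y : ℝ)).re = -π * (√2 * π * psi 1 y) := by
  have hi : IntegrableOn (fun t : ℝ => (t * densPos t) * Complex.exp (-t * y)) (Ioi 0) := by
    have h := integrableOn_id_mul_exp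
      (fun a ha => integrableOn_norm_mul_exp integrable_densPos.integrableOn ha)
      integrable_densPos.integrableOn.aestronglyMeasurable y hy
    refine h.mono' ?_ (Eventually.of_forall fun t => ?_)
    · exact (AEStronglyMeasurable.mul (by fun_prop)
        integrable_densPos.integrableOn.aestronglyMeasurable).mul (by fun_prop)
    · rw [norm_mul, norm_exp_neg_mul, Complex.ofReal_re, mul_comm t y]
  rw [(whWave_hasDerivAt (by simpa using hy)).deriv]
  have e : -((-y:ℝ):ℂ) = y := by push_cast; ring
  rw [e, ← mul_assoc _ (Complex.exp _), residue_eq]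
  have him : (halfLaplace (fun t => t * densPos t) y).im
      = ∫ t in Ioi (0:ℝ), (t / (1 + t ^ 2)) * Real.exp (-etaF t) * Real.exp (-t * y) := by
    have h1 := integral_im (𝕜 := ℂ) hi
    rw [halfLaplace]
    simp only [RCLike.im_eq_complex_im] at h1
    rw [← h1]
    refine setIntegral_congr_fun measurableSet_Ioi fun t ht => ?_
    have : Complex.exp (-t * y) = ((Real.exp (-t * y) : ℝ) : ℂ) := by push_cast; rfl
    simp only [this, Complex.im_mul_ofReal, Complex.im_ofReal_mul, densPos_im ht]
    ring
  have e2 : ∀ w : ℂ, (Complex.I * π * w).re = -π * w.im := by intro w; simp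
  rw [e2, Complex.sub_im, him]
  congr 1
  rw [psi, if_pos hy, rfun, one_mul, mul_sub, ← mul_assoc, sqrt_two_mul_pi_mul, one_mul]
  congr 1
  rw [mul_assoc, Complex.im_ofReal_mul]
  congr 1
  rw [Complex.mul_I_im]; simp [-Complex.ofReal_sin, -Complex.ofReal_cos]

/-- `ψ` is an eigenfunction on the half-line. -/
theorem integral_secondDiff_psi_one {x : ℝ} (hx : 0 < x) :
    IntegrableOn (fun t : ℝ => (psi 1 (x + t) + psi 1 (x - t) - 2 * psi 1 x) / t ^ 2) (Ioi 0) ∧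
    ∫ t in Ioi (0:ℝ), (psi 1 (x + t) + psi 1 (x - t) - 2 * psi 1 x) / t ^ 2 = -π * psi 1 x := by
  obtain ⟨B, hB⟩ := norm_whWave_le
  have h := integral_secondDiff_boundary (c := -x) (by linarith) whWave_continuousOn
    (fun _ hs => (whWave_hasDerivAt hs).differentiableAt.differentiableWithinAt)
    (fun _ _ => whWave_differentiableAt) hB
  have hre : ∀ y : ℝ, (whWave (-y : ℝ)).re = √2 * π * psi 1 y := by
    intro y
    rcases lt_or_ge 0 y with hy | hy
    · exact whWave_re_neg hy
    · rw [whWave_re_of_nonneg (by linarith), psi, if_neg (not_lt.2 hy), mul_zero]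
  have hD : ∀ t : ℝ, ((whWave ((-x : ℝ) + t) + whWave ((-x:ℝ) - t) - 2 * whWave (-x:ℝ)) / t ^ 2).re
      = √2 * π * ((psi 1 (x + t) + psi 1 (x - t) - 2 * psi 1 x) / t ^ 2) := by
    intro t
    rw [← Complex.ofReal_pow, Complex.div_ofReal_re, ← Complex.ofReal_add, ← Complex.ofReal_sub,
      Complex.sub_re, Complex.add_re, show -x + t = -(x - t) by ring,
      show -x - t = -(x + t) by ring, hre, hre, show (2:ℂ) = ((2:ℝ):ℂ) by simp, Complex.re_ofReal_mul, hre]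
    ring
  have hp : √2 * π ≠ 0 := by have := Real.pi_pos; positivity
  have hInt := h.1.re
  simp only [RCLike.re_eq_complex_re] at hInt
  constructor
  · refine (integrable_const_mul_iff (IsUnit.mk0 _ hp) _).1 (hInt.congr (Eventually.of_forall fun t => ?_))
    exact hD t
  · have h2 := integral_re (𝕜 := ℂ) h.1
    simp only [RCLike.re_eq_complex_re] at h2
    rw [h.2, deriv_whWave_re hx] at h2
    simp only [hD] at h2
    rw [integral_const_mul] at h2
    apply mul_left_cancel₀ hp
    rw [h2]; ring

/-- The symmetric second difference quotient of `f` at `z`. -/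
noncomputable def secondDiff (f : ℝ → ℝ) (z t : ℝ) : ℝ := (f (z + t) + f (z - t) - 2 * f z) / t ^ 2

lemma secondDiff_add (f g : ℝ → ℝ) (z t : ℝ) :
    secondDiff (fun x => f x + g x) z t = secondDiff f z t + secondDiff g z t := by
  simp only [secondDiff]; ring

lemma integral_eq_integral_Ioi_add_neg_real {g : ℝ → ℝ} (hg : Integrable g) :
    ∫ x, g x = ∫ t in Ioi (0:ℝ), (g t + g (-t)) := by
  rw [integral_add hg.integrableOn hg.comp_neg.integrableOn, integral_comp_neg_Ioi, neg_zero,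
    add_comm, intervalIntegral.integral_Iic_add_Ioi hg.integrableOn hg.integrableOn]

lemma integrableOn_inv_sq_Ioi {a : ℝ} (ha : 0 < a) : IntegrableOn (fun t : ℝ => 1 / t ^ 2) (Ioi a) := by
  have h := integrableOn_Ioi_rpow_of_lt (a := -2) (by norm_num) ha
  refine h.congr_fun (fun t (ht : a < t) => ?_) measurableSet_Ioi
  have : 0 < t := ha.trans ht
  simp only
  rw [Real.rpow_neg this.le, one_div]; norm_cast

lemma integral_inv_sq_Ioi {a : ℝ} (ha : 0 < a) : ∫ t in Ioi a, 1 / t ^ 2 = 1 / a := by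
  have h := integral_Ioi_rpow_of_lt (a := -2) (by norm_num) ha
  rw [setIntegral_congr_fun (g := fun t : ℝ => t ^ (-2:ℝ)) measurableSet_Ioi, h]
  · norm_num [Real.rpow_neg_one]
  · intro t (ht : a < t)
    have : 0 < t := ha.trans ht
    simp only
    rw [Real.rpow_neg this.le, one_div]; norm_cast

lemma measurableSet_abs_gt (ε : ℝ) : MeasurableSet {t : ℝ | ε < |t|} :=
  measurableSet_lt measurable_const measurable_id.abs

lemma integrable_truncated {f : ℝ → ℝ} {B : ℝ} (hm : Measurable f) (hb : ∀ x, |f x| ≤ B) (z : ℝ)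
    {ε : ℝ} (hε : 0 < ε) :
    Integrable (indicator {t : ℝ | ε < |t|} fun t => (f (z + t) - f z) / t ^ 2) := by
  have h2 : IntegrableOn (fun t : ℝ => 1 / t ^ 2) {t : ℝ | ε < |t|} := by
    have h := (integrable_indicator_iff measurableSet_Ioi).2 (integrableOn_inv_sq_Ioi hε)
    rw [← integrable_indicator_iff (measurableSet_abs_gt ε)]
    refine (h.add h.comp_neg).congr (Eventually.of_forall fun t => ?_)
    simp only [Pi.add_apply, indicator, mem_Ioi, mem_ofPred_eq, lt_abs, neg_sq]
    split_ifs with h1 h2 h3 h3 <;> first | (simp; done) | (exfalso; grind)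
  rw [integrable_indicator_iff (measurableSet_abs_gt ε)]
  refine (h2.const_mul (2 * B)).mono' (((hm.comp (measurable_const_add z)).sub_const _).div
      (measurable_id.pow_const 2)).aestronglyMeasurable (Eventually.of_forall fun t => ?_)
  rw [norm_div, Real.norm_eq_abs, Real.norm_of_nonneg (sq_nonneg t), mul_one_div]
  gcongr
  exact (abs_sub _ _).trans (by linarith [hb (z + t), hb z])

/-- The principal value integral is the integral of the second difference quotient. -/
theorem tendsto_pv {f : ℝ → ℝ} {B : ℝ} (hm : Measurable f) (hb : ∀ x, |f x| ≤ B) {z : ℝ}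
    (hi : IntegrableOn (secondDiff f z) (Ioi 0)) :
    Tendsto (fun ε : ℝ => ∫ x in {x : ℝ | ε < |x - z|}, (f x - f z) / (x - z) ^ 2)
      (𝓝[>] 0) (𝓝 (∫ t in Ioi (0:ℝ), secondDiff f z t)) := by
  have heq : ∀ ε : ℝ, 0 < ε → ∫ x in {x : ℝ | ε < |x - z|}, (f x - f z) / (x - z) ^ 2
      = ∫ t in Ioi (0:ℝ), indicator (Ioi ε) (secondDiff f z) t := by
    intro ε hε
    have hms : MeasurableSet {x : ℝ | ε < |x - z|} :=
      measurableSet_lt measurable_const (measurable_id.sub_const z).abs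
    rw [← integral_indicator hms, ← integral_add_left_eq_self _ z]
    have e1 : (fun t => indicator {x : ℝ | ε < |x - z|} (fun x => (f x - f z) / (x - z) ^ 2) (z + t))
        = indicator {t : ℝ | ε < |t|} fun t => (f (z + t) - f z) / t ^ 2 := by
      ext t; simp [indicator]
    rw [e1, integral_eq_integral_Ioi_add_neg_real (integrable_truncated hm hb z hε)]
    refine setIntegral_congr_fun measurableSet_Ioi fun t (ht : 0 < t) => ?_
    simp only [indicator, mem_ofPred_eq, mem_Ioi, abs_neg, abs_of_pos ht, secondDiff, ← sub_eq_add_neg]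
    split_ifs
    · ring
    · ring
  have hlim : Tendsto (fun ε : ℝ => ∫ t in Ioi (0:ℝ), indicator (Ioi ε) (secondDiff f z) t)
      (𝓝[>] 0) (𝓝 (∫ t in Ioi (0:ℝ), secondDiff f z t)) := by
    apply tendsto_integral_filter_of_dominated_convergence (fun t => ‖secondDiff f z t‖)
    · exact Eventually.of_forall fun ε => hi.aestronglyMeasurable.indicator measurableSet_Ioi
    · exact Eventually.of_forall fun ε => Eventually.of_forall fun t => norm_indicator_le_norm_self _ _
    · exact hi.norm
    · filter_upwards [ae_restrict_mem measurableSet_Ioi] with t (ht : 0 < t)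
      refine tendsto_const_nhds.congr' ?_
      filter_upwards [Ioo_mem_nhdsGT ht] with ε hε
      rw [indicator_of_mem (show t ∈ Ioi ε from hε.2)]
  refine hlim.congr' ?_
  filter_upwards [self_mem_nhdsWithin] with ε hε using (heq ε hε).symm

lemma psi_eq_psi_one {μ : ℝ} (hμ : 0 < μ) (y : ℝ) : psi μ y = psi 1 (μ * y) := by
  simp only [psi, one_mul, mul_pos_iff_of_pos_left hμ]

lemma psi_one_eq_whWave (y : ℝ) : (whWave (-y : ℝ)).re = √2 * π * psi 1 y := by
  rcases lt_or_ge 0 y with hy | hy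
  · exact whWave_re_neg hy
  · rw [whWave_re_of_nonneg (by linarith), psi, if_neg (not_lt.2 hy), mul_zero]

lemma continuous_psi_one : Continuous (psi 1) := by
  have hp : √2 * π ≠ 0 := by have := Real.pi_pos; positivity
  have h : psi 1 = fun y => (whWave (-y : ℝ)).re / (√2 * π) := by
    ext y; rw [psi_one_eq_whWave]; field_simp
  rw [h]
  have hc : Continuous fun y : ℝ => whWave (-y : ℝ) := by
    rw [← continuousOn_univ]
    exact whWave_continuousOn.comp (by fun_prop) fun y _ => by simp
  exact (Complex.continuous_re.comp hc).div_const _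

lemma psi_one_bounded : ∃ B, ∀ y, |psi 1 y| ≤ B := by
  obtain ⟨B, hB⟩ := norm_whWave_le
  have hp : 0 < √2 * π := by have := Real.pi_pos; positivity
  refine ⟨B / (√2 * π), fun y => ?_⟩
  have h : |psi 1 y| * (√2 * π) = |√2 * π * psi 1 y| := by rw [abs_mul, abs_of_pos hp, mul_comm]
  rw [le_div_iff₀ hp, h, ← psi_one_eq_whWave]
  exact (Complex.abs_re_le_norm _).trans (hB _ (by simp))

/-- The shifted eigenfunction on `(-1, ∞)`. -/
noncomputable def psiShift (μ x : ℝ) : ℝ := psi μ (1 + x)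

theorem integral_secondDiff_psiShift {μ z : ℝ} (hμ : 0 < μ) (hz : -1 < z) :
    IntegrableOn (secondDiff (psiShift μ) z) (Ioi 0) ∧
    ∫ t in Ioi (0:ℝ), secondDiff (psiShift μ) z t = -π * μ * psiShift μ z := by
  obtain ⟨h1, h2⟩ := integral_secondDiff_psi_one (x := μ * (1 + z)) (by nlinarith)
  set G : ℝ → ℝ := fun t => (psi 1 (μ * (1 + z) + t) + psi 1 (μ * (1 + z) - t) -
    2 * psi 1 (μ * (1 + z))) / t ^ 2 with hG
  have heq : secondDiff (psiShift μ) z = fun t => μ^2 * G (μ * t) := by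
    ext t
    simp only [secondDiff, psiShift, psi_eq_psi_one hμ, hG]
    rw [show μ * (1 + (z + t)) = μ * (1 + z) + μ * t by ring,
      show μ * (1 + (z - t)) = μ * (1 + z) - μ * t by ring, mul_pow, ← mul_div_assoc,
      mul_div_mul_left _ _ (by positivity)]
  rw [heq]
  constructor
  · exact ((integrableOn_Ioi_comp_mul_left_iff G 0 hμ).2 (by rwa [mul_zero])).const_mul (μ^2)
  · rw [integral_const_mul, integral_comp_mul_left_Ioi G 0 hμ, mul_zero, h2, psiShift,
      psi_eq_psi_one hμ, smul_eq_mul]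
    field_simp

lemma integrableOn_mul_cexp_of_norm {h : ℝ → ℂ} {y : ℝ}
    (hi : IntegrableOn (fun t => ‖h t‖ * Real.exp (-(y * t))) (Ioi 0))
    (hm : AEStronglyMeasurable h (volume.restrict (Ioi 0))) :
    IntegrableOn (fun t : ℝ => h t * Complex.exp (-t * y)) (Ioi 0) := by
  refine Integrable.mono' hi (hm.mul (by fun_prop)) (Eventually.of_forall fun t => ?_)
  rw [norm_mul, norm_exp_neg_mul, Complex.ofReal_re, mul_comm t]

lemma halfLaplace_re_mem_Icc {h : ℝ → ℂ} {y : ℝ} {k : ℕ} (hy : 0 < y)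
    (hi : IntegrableOn (fun t : ℝ => h t * Complex.exp (-t * y)) (Ioi 0))
    (h0 : ∀ t, 0 < t → 0 ≤ (h t).re) (h1 : ∀ t, 0 < t → (h t).re ≤ t ^ k) :
    (halfLaplace h y).re ∈ Icc 0 (k.factorial / y ^ (k + 1)) := by
  rw [halfLaplace_ofReal_re hi]
  have hg : ∀ t : ℝ, 0 < t → t ^ (((k + 1 : ℕ) : ℝ) - 1) * Real.exp (-(y * t)) = t ^ k * Real.exp (-t * y) := by
    intro t ht
    rw [Nat.cast_add_one, add_sub_cancel_right, Real.rpow_natCast]; ring_nf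
  have hI : ∫ t in Ioi (0:ℝ), t ^ k * Real.exp (-t * y) = k.factorial / y ^ (k + 1) := by
    have := Real.integral_rpow_mul_exp_neg_mul_Ioi (a := (k + 1 : ℕ)) (r := y) (by positivity) hy
    rw [Nat.cast_add_one, Real.Gamma_nat_eq_factorial, ← Nat.cast_add_one, Real.rpow_natCast] at this
    rw [← setIntegral_congr_fun measurableSet_Ioi hg, this, one_div, inv_pow]
    field_simp
  have hInt : IntegrableOn (fun t : ℝ => t ^ k * Real.exp (-t * y)) (Ioi 0) := by
    by_contra hcon
    rw [integral_undef hcon] at hI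
    have : (0:ℝ) < k.factorial / y ^ (k + 1) := by positivity
    linarith
  constructor
  · exact setIntegral_nonneg measurableSet_Ioi fun t ht => mul_nonneg (h0 t ht) (Real.exp_pos _).le
  · rw [← hI]
    refine integral_mono_of_nonneg ?_ hInt ?_
    · filter_upwards [ae_restrict_mem measurableSet_Ioi] with t ht
      exact mul_nonneg (h0 t ht) (Real.exp_pos _).le
    · filter_upwards [ae_restrict_mem measurableSet_Ioi] with t ht
      exact mul_le_mul_of_nonneg_right (h1 t ht) (Real.exp_pos _).le

/-- The derivatives of the density with respect to the Laplace variable. -/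
noncomputable def densPow : ℕ → ℝ → ℂ
  | 0 => densPos
  | k + 1 => fun t => t * densPow k t

lemma densPow_integrableOn (k : ℕ) : ∀ a, 0 < a →
    IntegrableOn (fun t => ‖densPow k t‖ * Real.exp (-(a * t))) (Ioi 0) := by
  have hm : ∀ k, AEStronglyMeasurable (densPow k) (volume.restrict (Ioi 0)) := by
    intro k
    induction k with
    | zero => exact integrable_densPos.integrableOn.aestronglyMeasurable
    | succ k ih => exact (Complex.continuous_ofReal.aestronglyMeasurable).mul ih
  induction k with
  | zero => exact fun a ha => integrableOn_norm_mul_exp integrable_densPos.integrableOn ha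
  | succ k ih => exact fun a ha => integrableOn_id_mul_exp ih (hm k) a ha

lemma densPow_aestronglyMeasurable (k : ℕ) :
    AEStronglyMeasurable (densPow k) (volume.restrict (Ioi 0)) := by
  induction k with
  | zero => exact integrable_densPos.integrableOn.aestronglyMeasurable
  | succ k ih => exact (Complex.continuous_ofReal.aestronglyMeasurable).mul ih

lemma densPow_re (k : ℕ) (t : ℝ) : (densPow k t).re = t ^ k * (densPos t).re := by
  induction k with
  | zero => simp [densPow]
  | succ k ih => simp only [densPow, Complex.re_ofReal_mul, ih]; ring

lemma densPos_re_mem {t : ℝ} (ht : 0 < t) : (densPos t).re ∈ Icc 0 t := by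
  rw [densPos_re ht]
  have h1 : Real.exp (-etaF t) ≤ 1 := by
    rw [Real.exp_le_one_iff]; linarith [etaF_nonneg ht]
  have h2 : t / (1 + t ^ 2) ≤ t := div_le_self ht.le (by nlinarith)
  have h3 : 0 ≤ t / (1 + t ^ 2) := by positivity
  exact ⟨by positivity, by nlinarith [Real.exp_pos (-etaF t)]⟩

lemma halfLaplace_densPow_re_mem {y : ℝ} (hy : 0 < y) (k : ℕ) :
    (halfLaplace (densPow k) y).re ∈ Icc 0 ((k + 1).factorial / y ^ (k + 2)) := by
  refine halfLaplace_re_mem_Icc hy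
    (integrableOn_mul_cexp_of_norm (densPow_integrableOn k y hy) (densPow_aestronglyMeasurable k)) ?_ ?_
  · intro t ht
    rw [densPow_re]
    exact mul_nonneg (by positivity) (densPos_re_mem ht).1
  · intro t ht
    rw [densPow_re, pow_succ]
    exact mul_le_mul_of_nonneg_left (densPos_re_mem ht).2 (by positivity)

lemma halfLaplace_densPow_hasDerivAt {y : ℝ} (hy : 0 < y) (k : ℕ) :
    HasDerivAt (fun y : ℝ => halfLaplace (densPow k) y) (-halfLaplace (densPow (k + 1)) y) y :=
  (halfLaplace_hasDerivAt (densPow_integrableOn k) (densPow_aestronglyMeasurable k)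
    (z := y) (by simpa using hy)).comp_ofReal

/-- The iterated derivatives of `rfun`. -/
noncomputable def rDeriv (k : ℕ) (y : ℝ) : ℝ :=
  (√2 / (2 * π)) * ((-1) ^ k * (halfLaplace (densPow k) y).re)

lemma rfun_eq_rDeriv {y : ℝ} (hy : 0 ≤ y) : rfun y = rDeriv 0 y := by
  rw [rfun, rDeriv, pow_zero, one_mul, densPow,
    halfLaplace_ofReal_re (integrableOn_mul_cexp integrable_densPos.integrableOn hy)]
  congr 1
  exact setIntegral_congr_fun measurableSet_Ioi fun t ht => by simp only [densPos_re ht]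

lemma rDeriv_hasDerivAt {y : ℝ} (hy : 0 < y) (k : ℕ) :
    HasDerivAt (rDeriv k) (rDeriv (k + 1) y) y := by
  have h := (Complex.reCLM.hasFDerivAt.comp_hasDerivAt y (halfLaplace_densPow_hasDerivAt hy k))
  refine ((h.const_mul ((-1) ^ k)).const_mul (√2 / (2 * π))).congr_deriv ?_
  simp only [rDeriv, Complex.reCLM_apply, Complex.neg_re, pow_succ]
  ring

lemma abs_rDeriv_le {y : ℝ} (hy : 0 < y) (k : ℕ) :
    |rDeriv k y| ≤ √2 / (2 * π) * ((k + 1).factorial / y ^ (k + 2)) := by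
  have h := halfLaplace_densPow_re_mem hy k
  have hc : 0 ≤ √2 / (2 * π) := by have := Real.pi_pos; positivity
  rw [rDeriv, abs_mul, abs_mul, abs_pow, abs_neg, abs_one, one_pow, one_mul, abs_of_nonneg hc,
    abs_of_nonneg h.1]
  exact mul_le_mul_of_nonneg_left h.2 hc

lemma rfun_nonneg (y : ℝ) : 0 ≤ rfun y := by
  have hc : 0 ≤ √2 / (2 * π) := by have := Real.pi_pos; positivity
  refine mul_nonneg hc (setIntegral_nonneg measurableSet_Ioi fun t (ht : 0 < t) => ?_)
  positivity

lemma rfun_le {y : ℝ} (hy : 0 < y) : rfun y ≤ √2 / (2 * π) / y ^ 2 := by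
  rw [rfun_eq_rDeriv hy.le]
  refine (le_abs_self _).trans ((abs_rDeriv_le hy 0).trans (le_of_eq ?_))
  simp [div_eq_mul_inv]

lemma rfun_continuousOn : ContinuousOn rfun (Ici 0) := by
  have h : ContinuousOn (rDeriv 0) (Ici 0) := by
    refine continuousOn_const.mul (continuousOn_const.mul (Complex.continuous_re.comp_continuousOn ?_))
    exact (halfLaplace_continuousOn integrable_densPos.integrableOn).comp (by fun_prop)
      fun y hy => by simpa using hy
  exact h.congr fun y hy => rfun_eq_rDeriv hy

/-- The total mass of the remainder is at most `√2/4`. -/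
lemma integral_rfun_le {Y : ℝ} (hY : 0 ≤ Y) : ∫ y in (0:ℝ)..Y, rfun y ≤ √2 / 4 := by
  have hc : 0 ≤ √2 / (2 * π) := by have := Real.pi_pos; positivity
  have him : ∀ y : ℝ, 0 ≤ y → (halfLaplace densPos y).im
      = ∫ t in Ioi (0:ℝ), 1 / (1 + t^2) * Real.exp (-etaF t) * Real.exp (-t * y) := by
    intro y hy
    have := integral_im (𝕜 := ℂ) (integrableOn_mul_cexp integrable_densPos.integrableOn hy)
    simp only [RCLike.im_eq_complex_im] at this
    rw [halfLaplace, ← this]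
    refine setIntegral_congr_fun measurableSet_Ioi fun t ht => ?_
    have e : Complex.exp (-t * y) = (Real.exp (-t * y) : ℝ) := by push_cast; rfl
    simp only [e, Complex.im_mul_ofReal, densPos_im ht]
  have hD : ∀ y ∈ Ioo 0 Y, HasDerivAt (fun y : ℝ => -(√2 / (2 * π)) * (halfLaplace densPos y).im)
      (rfun y) y := by
    intro y hy
    have h := Complex.imCLM.hasFDerivAt.comp_hasDerivAt y (halfLaplace_densPow_hasDerivAt hy.1 0)
    refine (h.const_mul (-(√2 / (2 * π)))).congr_deriv ?_
    rw [Complex.imCLM_apply, Complex.neg_im, neg_mul_neg, rfun]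
    congr 1
    have hi := integrableOn_mul_cexp_of_norm (densPow_integrableOn 1 y hy.1) (densPow_aestronglyMeasurable 1)
    have := integral_im (𝕜 := ℂ) hi
    simp only [RCLike.im_eq_complex_im] at this
    rw [halfLaplace, ← this]
    refine setIntegral_congr_fun measurableSet_Ioi fun t ht => ?_
    have e : Complex.exp (-t * y) = (Real.exp (-t * y) : ℝ) := by push_cast; rfl
    simp only [e, Complex.im_mul_ofReal, densPow, Complex.im_ofReal_mul, densPos_im ht]
    ring
  have hcont : ContinuousOn (fun y : ℝ => -(√2 / (2 * π)) * (halfLaplace densPos y).im) (Icc 0 Y) := by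
    refine continuousOn_const.mul (Complex.continuous_im.comp_continuousOn ?_)
    exact (halfLaplace_continuousOn integrable_densPos.integrableOn).comp (by fun_prop)
      fun y hy => by simpa using hy.1
  have hInt : IntervalIntegrable rfun volume 0 Y :=
    (rfun_continuousOn.mono (by rw [uIcc_of_le hY]; exact fun y hy => hy.1)).intervalIntegrable
  rw [intervalIntegral.integral_eq_sub_of_hasDerivAt_of_le hY hcont hD hInt]
  have h1 : 0 ≤ (halfLaplace densPos (Y:ℂ)).im := by
    rw [him Y hY]
    exact setIntegral_nonneg measurableSet_Ioi fun t (ht : 0 < t) => by positivity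
  have h2 : (halfLaplace densPos ((0:ℝ):ℂ)).im ≤ π / 2 := by
    rw [him 0 le_rfl, show π / 2 = ∫ t in Ioi (0:ℝ), (1 + t ^ 2)⁻¹ by simp]
    refine integral_mono_of_nonneg ?_ integrable_inv_one_add_sq.integrableOn ?_
    · filter_upwards with t
      positivity
    · filter_upwards [ae_restrict_mem measurableSet_Ioi] with t ht
      have h1 : Real.exp (-etaF t) ≤ 1 := by
        rw [Real.exp_le_one_iff]; linarith [etaF_nonneg ht]
      rw [mul_zero, Real.exp_zero, mul_one, ← one_div]
      exact mul_le_of_le_one_right (by positivity) h1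
  have h3 : √2 / (2 * π) * (π / 2) = √2 / 4 := by
    have := Real.pi_pos.ne'
    field_simp; norm_num
  nlinarith [mul_nonneg hc h1, mul_le_mul_of_nonneg_left h2 hc]

lemma hasDerivAt_max_zero_sq (y : ℝ) : HasDerivAt (fun y : ℝ => (max y 0) ^ 2) (2 * max y 0) y := by
  rcases lt_trichotomy y 0 with h | rfl | h
  · rw [max_eq_right h.le, mul_zero]
    refine (hasDerivAt_const y (0:ℝ)).congr_of_eventuallyEq ?_
    filter_upwards [Iio_mem_nhds h] with w (hw : w < 0)
    rw [max_eq_right hw.le]; norm_num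
  · rw [max_self, mul_zero, hasDerivAt_iff_isLittleO]
    have h1 : (fun y : ℝ => y ^ 2) =o[𝓝 0] fun y : ℝ => y := by
      simpa using (Asymptotics.isLittleO_pow_pow (𝕜 := ℝ) (m := 1) (n := 2) (by norm_num))
    refine (Asymptotics.IsBigO.of_bound 1 (Eventually.of_forall fun w => ?_)).trans_isLittleO
      (h1.trans_isBigO (Asymptotics.isBigO_of_le _ fun w => by simp))
    rcases le_total w 0 with hw | hw
    · simp [max_eq_right hw]; positivity
    · simp [max_eq_left hw]
  · rw [max_eq_left h.le]
    refine (HasDerivAt.congr_deriv (hasDerivAt_pow 2 y) (by norm_num)).congr_of_eventuallyEq ?_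
    filter_upwards [Ioi_mem_nhds h] with w (hw : 0 < w)
    rw [max_eq_left hw.le]

lemma qcut_eq (x : ℝ) : qcut x = (9/2) * ((max (x + 1/3) 0) ^ 2 - 2 * (max x 0) ^ 2 +
    (max (x - 1/3) 0) ^ 2) := by
  unfold qcut
  split_ifs with h1 h2 h3
  · rw [max_eq_right (by linarith), max_eq_right (by linarith), max_eq_right (by linarith)]; ring
  · rw [max_eq_left (by linarith), max_eq_right (by linarith), max_eq_right (by linarith)]; ring
  · rw [max_eq_left (by linarith), max_eq_left (by linarith), max_eq_right (by linarith)]; ring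
  · rw [max_eq_left (by linarith), max_eq_left (by linarith), max_eq_left (by linarith)]; ring

/-- The derivative of the cutoff. -/
noncomputable def qcutDeriv (x : ℝ) : ℝ := max 0 (3 - 9 * |x|)

lemma qcut_hasDerivAt (x : ℝ) : HasDerivAt qcut (qcutDeriv x) x := by
  have h1 := (hasDerivAt_max_zero_sq (x + 1/3)).comp_add_const x (1/3)
  have h2 := (hasDerivAt_max_zero_sq x).const_mul 2
  have h3 := (hasDerivAt_max_zero_sq (x - 1/3)).comp_sub_const x (1/3)
  have h := ((h1.sub h2).add h3).const_mul (9/2)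
  have e : qcut = fun x => (9/2) * ((max (x + 1/3) 0) ^ 2 - 2 * (max x 0) ^ 2 +
    (max (x - 1/3) 0) ^ 2) := funext qcut_eq
  rw [e]
  refine HasDerivAt.congr_deriv h ?_
  unfold qcutDeriv
  rcases le_total x 0 with h0 | h0
  · rw [abs_of_nonpos h0, max_eq_right h0, max_eq_right (a := x - 1/3) (by linarith)]
    rcases le_total (x + 1/3) 0 with h | h
    · rw [max_eq_right h, max_eq_left (by linarith)]; ring
    · rw [max_eq_left h, max_eq_right (by linarith)]; ring
  · rw [abs_of_nonneg h0, max_eq_left h0, max_eq_left (a := x + 1/3) (by linarith)]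
    rcases le_total (x - 1/3) 0 with h | h
    · rw [max_eq_right h, max_eq_right (by linarith)]; ring
    · rw [max_eq_left h, max_eq_left (by linarith)]; ring

lemma continuous_qcut : Continuous qcut :=
  continuous_iff_continuousAt.2 fun x => (qcut_hasDerivAt x).continuousAt

lemma qcutDeriv_nonneg (x : ℝ) : 0 ≤ qcutDeriv x := le_max_left _ _

lemma qcutDeriv_le (x : ℝ) : qcutDeriv x ≤ 3 := max_le (by norm_num) (by linarith [abs_nonneg x])

lemma qcutDeriv_of_le {x : ℝ} (h : x ≤ -(1/3)) : qcutDeriv x = 0 :=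
  max_eq_left (by rw [abs_of_nonpos (by linarith)]; linarith)

lemma abs_qcutDeriv_sub_le (x y : ℝ) : |qcutDeriv x - qcutDeriv y| ≤ 9 * |x - y| := by
  have h1 : |qcutDeriv x - qcutDeriv y| ≤ |(3 - 9 * |x|) - (3 - 9 * |y|)| := by
    unfold qcutDeriv
    rw [max_comm 0, max_comm 0]
    exact abs_max_sub_max_le_abs _ _ _
  refine h1.trans ?_
  rw [show (3 - 9 * |x|) - (3 - 9 * |y|) = 9 * (|y| - |x|) by ring, abs_mul, abs_of_pos (by norm_num : (0:ℝ) < 9),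
    abs_sub_comm x y]
  exact mul_le_mul_of_nonneg_left (abs_abs_sub_abs_le _ _) (by norm_num)

lemma abs_qcut_sub_le (x y : ℝ) : |qcut x - qcut y| ≤ 3 * |x - y| := by
  have := Convex.norm_image_sub_le_of_norm_hasDerivWithin_le (f := qcut) (f' := qcutDeriv)
    (s := univ) (x := y) (y := x) (C := 3) (fun x _ => (qcut_hasDerivAt x).hasDerivWithinAt)
    (fun x _ => by rw [Real.norm_of_nonneg (qcutDeriv_nonneg x)]; exact qcutDeriv_le x)
    convex_univ trivial trivial
  exact this

lemma qcut_of_le {x : ℝ} (h : x ≤ -(1/3)) : qcut x = 0 := if_pos h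

lemma qcut_of_ge {x : ℝ} (h : 1/3 ≤ x) : qcut x = 1 := by
  rw [qcut_eq, max_eq_left (by linarith), max_eq_left (by linarith), max_eq_left (by linarith)]; ring

lemma qcut_mono : Monotone qcut :=
  monotone_of_hasDerivAt_nonneg qcut_hasDerivAt qcutDeriv_nonneg

lemma qcut_nonneg (x : ℝ) : 0 ≤ qcut x := by
  have h := qcut_mono (min_le_left x (-(1/3)))
  rwa [qcut_of_le (min_le_right _ _)] at h

lemma qcut_le_one (x : ℝ) : qcut x ≤ 1 := by
  have h := qcut_mono (le_max_left x (1/3))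
  rwa [qcut_of_ge (le_max_right _ _)] at h

lemma qcut_add_neg (x : ℝ) : qcut (-x) + qcut x = 1 := by
  simp only [qcut_eq]
  rw [show -x + 1/3 = -(x - 1/3) by ring, show -x - 1/3 = -(x + 1/3) by ring]
  have h : ∀ y : ℝ, (max (-y) 0) ^ 2 = y ^ 2 - (max y 0) ^ 2 := by
    intro y
    rcases le_total y 0 with hy | hy
    · rw [max_eq_left (by linarith), max_eq_right hy]; ring
    · rw [max_eq_right (by linarith), max_eq_left hy]; ring
  rw [h, h, h]
  ring

lemma qcut_le_sq {x : ℝ} (h : -(1/3) ≤ x) : qcut x ≤ (9/2) * (x + 1/3) ^ 2 := by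
  rw [qcut_eq, max_eq_left (by linarith)]
  rcases le_total x (1/3) with h1 | h1
  · rw [max_eq_right (a := x - 1/3) (by linarith)]
    nlinarith [sq_nonneg (max x 0)]
  · rw [max_eq_left (by linarith), max_eq_left (by linarith)]
    nlinarith

lemma qcut_of_mem {x : ℝ} (h : x ∈ Icc (-(1/3)) 0) : qcut x = (9/2) * (x + 1/3) ^ 2 := by
  rw [qcut_eq, max_eq_left (by linarith [h.1]), max_eq_right h.2, max_eq_right (by linarith [h.2])]
  ring

/-- `f` is integrable on `s` and its integral is bounded by `B` in absolute value. -/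
def IntBd (f : ℝ → ℝ) (s : Set ℝ) (B : ℝ) : Prop := IntegrableOn f s ∧ |∫ x in s, f x| ≤ B

lemma IntBd.of_abs_le {f h : ℝ → ℝ} {s : Set ℝ} {B : ℝ} (hs : MeasurableSet s) (hf : Measurable f)
    (hh : IntegrableOn h s) (hle : ∀ x ∈ s, |f x| ≤ h x) (hB : ∫ x in s, h x ≤ B) : IntBd f s B := by
  have hae : ∀ᵐ x ∂volume.restrict s, ‖f x‖ ≤ h x := by
    filter_upwards [ae_restrict_mem hs] with x hx using hle x hx
  have hi : IntegrableOn f s := Integrable.mono' hh hf.aestronglyMeasurable hae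
  exact ⟨hi, (norm_integral_le_of_norm_le hh hae).trans hB⟩

lemma IntBd.mono {f : ℝ → ℝ} {s : Set ℝ} {B C : ℝ} (h : IntBd f s B) (hBC : B ≤ C) : IntBd f s C :=
  ⟨h.1, h.2.trans hBC⟩

lemma IntBd.congr {f g : ℝ → ℝ} {s : Set ℝ} {B : ℝ} (hs : MeasurableSet s) (h : IntBd f s B)
    (hfg : ∀ x ∈ s, g x = f x) : IntBd g s B := by
  refine ⟨h.1.congr_fun (fun x hx => (hfg x hx).symm) hs, ?_⟩
  rw [setIntegral_congr_fun hs hfg]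
  exact h.2

lemma IntBd.add {f g : ℝ → ℝ} {s : Set ℝ} {B C : ℝ} (hf : IntBd f s B) (hg : IntBd g s C) :
    IntBd (fun x => f x + g x) s (B + C) := by
  refine ⟨hf.1.add hg.1, ?_⟩
  rw [integral_add hf.1 hg.1]
  exact (abs_add_le _ _).trans (add_le_add hf.2 hg.2)

lemma IntBd.Ioc_of_Ioo {f : ℝ → ℝ} {a b B : ℝ} (h : IntBd f (Ioo a b) B) : IntBd f (Ioc a b) B := by
  refine ⟨(integrableOn_Ioc_iff_integrableOn_Ioo).2 h.1, ?_⟩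
  rw [integral_Ioc_eq_integral_Ioo]
  exact h.2

lemma IntBd.Ioi_of_Ioo {f : ℝ → ℝ} {a b B C : ℝ} (hab : a ≤ b) (h : IntBd f (Ioo a b) B)
    (h' : IntBd f (Ioi b) C) : IntBd f (Ioi a) (B + C) := by
  have h := h.Ioc_of_Ioo
  rw [← Ioc_union_Ioi_eq_Ioi hab]
  refine ⟨h.1.union h'.1, ?_⟩
  rw [setIntegral_union Ioc_disjoint_Ioi_same measurableSet_Ioi h.1 h'.1]
  exact (abs_add_le _ _).trans (add_le_add h.2 h'.2)

lemma integral_inv_cube_Ioi {a : ℝ} (ha : 0 < a) :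
    IntegrableOn (fun t : ℝ => 1 / t ^ 3) (Ioi a) ∧ ∫ t in Ioi a, 1 / t ^ 3 = 1 / (2 * a ^ 2) := by
  have h0 : ∀ t ∈ Ioi a, t ^ (-3:ℝ) = 1 / t ^ 3 := by
    intro t (ht : a < t)
    rw [Real.rpow_neg (ha.trans ht).le, one_div]; norm_cast
  refine ⟨(integrableOn_Ioi_rpow_of_lt (a := -3) (by norm_num) ha).congr_fun h0 measurableSet_Ioi, ?_⟩
  rw [← setIntegral_congr_fun measurableSet_Ioi h0, integral_Ioi_rpow_of_lt (a := -3) (by norm_num) ha]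
  norm_num [Real.rpow_neg ha.le]
  ring

lemma intBd_sin_div_sq {μ d : ℝ} (hμ : 0 < μ) (hd : 0 < d) (α : ℝ) :
    IntBd (fun t => Real.sin (α + μ * t) / t ^ 2) (Ioi d) (2 / (μ * d ^ 2)) := by
  have hi1 : IntegrableOn (fun t => Real.sin (α + μ * t) / t ^ 2) (Ioi d) := by
    refine Integrable.mono' (integrableOn_inv_sq_Ioi hd) (((Real.measurable_sin.comp
      (by fun_prop)).div (measurable_id.pow_const 2)).aestronglyMeasurable) (Eventually.of_forall fun t => ?_)
    rw [norm_div, Real.norm_of_nonneg (sq_nonneg t)]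
    gcongr
    exact Real.abs_sin_le_one _
  obtain ⟨hi, hv⟩ := integral_inv_cube_Ioi hd
  have hae : ∀ᵐ t ∂volume.restrict (Ioi d), ‖Real.cos (α + μ * t) / t ^ 3‖ ≤ 1 / t ^ 3 := by
    filter_upwards [ae_restrict_mem measurableSet_Ioi] with t (ht : d < t)
    have : 0 < t := hd.trans ht
    rw [norm_div, Real.norm_of_nonneg (pow_pos this 3).le]
    gcongr
    exact Real.abs_cos_le_one _
  have hi2 : IntegrableOn (fun t => Real.cos (α + μ * t) / t ^ 3) (Ioi d) :=
    Integrable.mono' hi (((Real.measurable_cos.comp (by fun_prop)).div (measurable_id.pow_const 3)).aestronglyMeasurable) hae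
  refine ⟨hi1, ?_⟩
  have hD : ∀ t ∈ Ici d, HasDerivAt (fun t => -(Real.cos (α + μ * t) / (μ * t ^ 2)))
      (Real.sin (α + μ * t) / t ^ 2 + 2 / μ * (Real.cos (α + μ * t) / t ^ 3)) t := by
    intro t (ht : d ≤ t)
    have h0 : 0 < t := hd.trans_le ht
    have h1 : HasDerivAt (fun t => α + μ * t) μ t := by
      simpa using ((hasDerivAt_id t).const_mul μ).const_add α
    have h2 := (h1.cos.div ((hasDerivAt_pow 2 t).const_mul μ) (by positivity)).neg
    refine h2.congr_deriv ?_
    field_simp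
    ring
  have hlim : Tendsto (fun t => -(Real.cos (α + μ * t) / (μ * t ^ 2))) atTop (𝓝 0) := by
    have h1 : Tendsto (fun t : ℝ => (1 / μ) * (1 / t ^ 2)) atTop (𝓝 0) := by
      have := (tendsto_pow_atTop (α := ℝ) (n := 2) (by norm_num)).inv_tendsto_atTop.const_mul (1 / μ)
      simpa using this
    refine squeeze_zero_norm (fun t => ?_) h1
    rw [norm_neg, norm_div, norm_mul, Real.norm_of_nonneg hμ.le, Real.norm_of_nonneg (sq_nonneg t),
      one_div_mul_one_div]
    gcongr
    exact Real.abs_cos_le_one _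
  have hFT := integral_Ioi_of_hasDerivAt_of_tendsto' hD (hi1.add (hi2.const_mul (2 / μ))) hlim
  rw [integral_add hi1 (hi2.const_mul _), integral_const_mul] at hFT
  have h3 : |∫ t in Ioi d, Real.cos (α + μ * t) / t ^ 3| ≤ 1 / (2 * d ^ 2) := by
    rw [← hv]; exact norm_integral_le_of_norm_le hi hae
  have h4 : |Real.cos (α + μ * d) / (μ * d ^ 2)| ≤ 1 / (μ * d ^ 2) := by
    rw [abs_div, abs_of_pos (a := μ * d ^ 2) (by positivity)]
    gcongr
    exact Real.abs_cos_le_one _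
  have e : ∫ t in Ioi d, Real.sin (α + μ * t) / t ^ 2 = Real.cos (α + μ * d) / (μ * d ^ 2) -
      2 / μ * ∫ t in Ioi d, Real.cos (α + μ * t) / t ^ 3 := by linarith
  rw [e]
  refine (abs_sub _ _).trans ?_
  rw [abs_mul, abs_of_pos (a := 2 / μ) (by positivity)]
  calc _ ≤ 1 / (μ * d ^ 2) + 2 / μ * (1 / (2 * d ^ 2)) := by gcongr
    _ = 2 / (μ * d ^ 2) := by field_simp; norm_num

/-- Half-line eigenfunctions glued from both endpoints, with relative sign `s`. -/
noncomputable def glue (μ s x : ℝ) : ℝ :=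
  qcut (-x) * psi μ (1 + x) + s * qcut x * psi μ (1 - x)

/-- The `k`-th derivative of the combined remainder term on `(-1, 1)`. -/
noncomputable def remDeriv (μ s : ℝ) (k : ℕ) (x : ℝ) : ℝ :=
  μ ^ k * (rDeriv k (μ * (1 + x)) - s * (-1) ^ k * rDeriv k (μ * (1 - x)))

/-- The difference between the glued function and the left eigenfunction. -/
noncomputable def glueErr (μ s x : ℝ) : ℝ := glue μ s x - psiShift μ x

lemma continuous_psi {μ : ℝ} (hμ : 0 < μ) : Continuous (psi μ) := by
  have : psi μ = fun y => psi 1 (μ * y) := funext fun y => psi_eq_psi_one hμ y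
  rw [this]
  exact continuous_psi_one.comp (by fun_prop)

lemma continuous_psiShift {μ : ℝ} (hμ : 0 < μ) : Continuous (psiShift μ) :=
  (continuous_psi hμ).comp (by fun_prop)

lemma continuous_glue {μ : ℝ} (hμ : 0 < μ) (s : ℝ) : Continuous (glue μ s) := by
  have h1 := continuous_psi hμ
  have h2 := continuous_qcut
  unfold glue
  fun_prop

lemma continuous_glueErr {μ : ℝ} (hμ : 0 < μ) (s : ℝ) : Continuous (glueErr μ s) :=
  (continuous_glue hμ s).sub (continuous_psiShift hμ)

lemma measurable_secondDiff {f : ℝ → ℝ} (hf : Measurable f) (z : ℝ) : Measurable (secondDiff f z) :=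
  (((hf.comp (measurable_const_add z)).add (hf.comp (measurable_id.const_sub z))).sub_const _).div
    (measurable_id.pow_const 2)

lemma glue_bounded {μ s : ℝ} (hμ : 0 < μ) (hs : |s| = 1) : ∃ B, ∀ x, |glue μ s x| ≤ B := by
  obtain ⟨B, hB⟩ := psi_one_bounded
  have hB' : ∀ y, |psi μ y| ≤ B := fun y => by rw [psi_eq_psi_one hμ]; exact hB _
  have hB0 : 0 ≤ B := (abs_nonneg _).trans (hB 0)
  refine ⟨B, fun x => ?_⟩
  calc |glue μ s x| ≤ qcut (-x) * |psi μ (1 + x)| + qcut x * |psi μ (1 - x)| := by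
        unfold glue
        refine (abs_add_le _ _).trans (le_of_eq ?_)
        rw [abs_mul, abs_mul, abs_mul, hs, one_mul, abs_of_nonneg (qcut_nonneg _),
          abs_of_nonneg (qcut_nonneg _)]
    _ ≤ qcut (-x) * B + qcut x * B := add_le_add
        (mul_le_mul_of_nonneg_left (hB' _) (qcut_nonneg _))
        (mul_le_mul_of_nonneg_left (hB' _) (qcut_nonneg _))
    _ = B := by rw [← add_mul, qcut_add_neg, one_mul]

lemma glue_neg {μ s : ℝ} (hs : s * s = 1) (x : ℝ) : glue μ s (-x) = s * glue μ s x := by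
  simp only [glue, neg_neg, ← sub_eq_add_neg, sub_neg_eq_add, mul_add, ← mul_assoc, hs]
  ring

lemma glueErr_of_le {μ s x : ℝ} (hx : x ≤ -(1/3)) : glueErr μ s x = 0 := by
  rw [glueErr, glue, qcut_of_le hx, qcut_of_ge (by linarith), psiShift]; ring

lemma glueErr_of_mem {μ s : ℝ} (hμ : 0 < μ) (hs : s * s = 1)
    (hsin : ∀ x, Real.sin (μ * (1 - x) + π / 8) = s * Real.sin (μ * (1 + x) + π / 8))
    {x : ℝ} (hx : x ∈ Ioo (-1:ℝ) 1) : glueErr μ s x = qcut x * remDeriv μ s 0 x := by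
  have h1 : 0 < 1 + x := by linarith [hx.1]
  have h2 : 0 < 1 - x := by linarith [hx.2]
  have h3 : qcut (-x) = 1 - qcut x := by linarith [qcut_add_neg x]
  rw [glueErr, glue, psiShift, psi, psi, if_pos h1, if_pos h2, hsin, remDeriv,
    rfun_eq_rDeriv (by positivity), rfun_eq_rDeriv (by positivity), h3]
  linear_combination (qcut x * Real.sin (μ * (1 + x) + π / 8)) * hs

lemma glueErr_of_ge {μ s : ℝ} {x : ℝ} (hx : 1 ≤ x) :
    glueErr μ s x = rfun (μ * (1 + x)) - Real.sin (μ * (1 + x) + π / 8) := by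
  rw [glueErr, glue, qcut_of_le (x := -x) (by linarith), psiShift, psi, psi, if_pos (by linarith),
    if_neg (by linarith)]
  ring

lemma remDeriv_hasDerivAt {μ : ℝ} (hμ : 0 < μ) (s : ℝ) (k : ℕ) {x : ℝ} (hx : x ∈ Ioo (-1:ℝ) 1) :
    HasDerivAt (remDeriv μ s k) (remDeriv μ s (k + 1) x) x := by
  have h1 : 0 < μ * (1 + x) := mul_pos hμ (by linarith [hx.1])
  have h2 : 0 < μ * (1 - x) := mul_pos hμ (by linarith [hx.2])
  have e1 : HasDerivAt (fun x => μ * (1 + x)) μ x := by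
    simpa using ((hasDerivAt_id x).const_add 1).const_mul μ
  have e2 : HasDerivAt (fun x => μ * (1 - x)) (-μ) x := by
    simpa using ((hasDerivAt_id x).const_sub 1).const_mul μ
  have d1 := (rDeriv_hasDerivAt h1 k).comp x e1
  have d2 := (rDeriv_hasDerivAt h2 k).comp x e2
  refine ((d1.sub (d2.const_mul (s * (-1) ^ k))).const_mul (μ ^ k)).congr_deriv ?_
  simp only [remDeriv, pow_succ]
  ring

lemma abs_remDeriv_le {μ s : ℝ} (hμ : 0 < μ) (hs : |s| = 1) (k : ℕ) {x : ℝ} (hx : x ∈ Ioo (-1:ℝ) 1) :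
    |remDeriv μ s k x| ≤ √2 / (2 * π) / μ ^ 2 * ((k + 1).factorial *
      (1 / (1 + x) ^ (k + 2) + 1 / (1 - x) ^ (k + 2))) := by
  have h1 : 0 < 1 + x := by linarith [hx.1]
  have h2 : 0 < 1 - x := by linarith [hx.2]
  have b1 := abs_rDeriv_le (mul_pos hμ h1) k
  have b2 := abs_rDeriv_le (mul_pos hμ h2) k
  have hk : |s * (-1) ^ k * rDeriv k (μ * (1 - x))| = |rDeriv k (μ * (1 - x))| := by
    rw [abs_mul, abs_mul, hs, abs_pow, abs_neg, abs_one, one_pow, one_mul, one_mul]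
  rw [remDeriv, abs_mul, abs_of_pos (pow_pos hμ k)]
  calc _ ≤ μ ^ k * (√2 / (2 * π) * ((k + 1).factorial / (μ * (1 + x)) ^ (k + 2)) +
        √2 / (2 * π) * ((k + 1).factorial / (μ * (1 - x)) ^ (k + 2))) := by
        refine mul_le_mul_of_nonneg_left ?_ (by positivity)
        refine (abs_sub _ _).trans ?_
        rw [hk]
        exact add_le_add b1 b2
    _ = _ := by
        have := Real.pi_pos
        rw [mul_pow, mul_pow, pow_add μ k 2]
        field_simp

/-- The derivative of `glueErr` on `(-1, 1)`. -/
noncomputable def glueErrDeriv (μ s x : ℝ) : ℝ :=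
  qcutDeriv x * remDeriv μ s 0 x + qcut x * remDeriv μ s 1 x

lemma abs_remDeriv_sub_le {μ s : ℝ} (hμ : 0 < μ) (k : ℕ) {C : ℝ}
    (hC : ∀ x ∈ Icc (-(1/3):ℝ) (1/3), |remDeriv μ s (k + 1) x| ≤ C) {x y : ℝ}
    (hx : x ∈ Icc (-(1/3):ℝ) (1/3)) (hy : y ∈ Icc (-(1/3):ℝ) (1/3)) :
    |remDeriv μ s k x - remDeriv μ s k y| ≤ C * |x - y| :=
  Convex.norm_image_sub_le_of_norm_hasDerivWithin_le (f := remDeriv μ s k)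
    (f' := remDeriv μ s (k + 1)) (s := Icc (-(1/3):ℝ) (1/3)) (x := y) (y := x)
    (fun w hw => (remDeriv_hasDerivAt hμ s k ⟨by linarith [hw.1], by linarith [hw.2]⟩).hasDerivWithinAt)
    hC (convex_Icc _ _) hy hx

section
variable {μ s : ℝ} (hμ : 0 < μ) (hs : |s| = 1)
  (hsin : ∀ x, Real.sin (μ * (1 - x) + π / 8) = s * Real.sin (μ * (1 + x) + π / 8))
include hμ hs

lemma abs_remDeriv_le_of_abs_le (k : ℕ) {x C : ℝ} (hx : x ∈ Icc (-(1/3):ℝ) (1/3))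
    (hC : (k + 1).factorial * (1 / (1 + x) ^ (k + 2) + 1 / (1 - x) ^ (k + 2)) ≤ C) :
    |remDeriv μ s k x| ≤ √2 / (2 * π) / μ ^ 2 * C := by
  refine (abs_remDeriv_le hμ hs k ⟨by linarith [hx.1], by linarith [hx.2]⟩).trans ?_
  exact mul_le_mul_of_nonneg_left hC (by have := Real.pi_pos; positivity)

lemma abs_remDeriv_zero_le {x : ℝ} (hx : x ∈ Icc (-(1/3):ℝ) (1/3)) :
    |remDeriv μ s 0 x| ≤ √2 / (2 * π) / μ ^ 2 * 2.8125 := by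
  refine abs_remDeriv_le_of_abs_le hμ hs 0 hx ?_
  have h1 : 0 < 1 + x := by linarith [hx.1]
  have h2 : 0 < 1 - x := by linarith [hx.2]
  have hx2 : x ^ 2 ≤ 1 / 9 := by nlinarith [hx.1, hx.2]
  have e : 1 / (1 + x) ^ 2 + 1 / (1 - x) ^ 2 = (2 + 2 * x ^ 2) / (1 - x ^ 2) ^ 2 := by
    rw [show 1 - x ^ 2 = (1 + x) * (1 - x) by ring]
    field_simp; ring
  norm_num only [Nat.factorial]
  rw [e]
  calc _ ≤ (1:ℝ) * ((2 + 2 * (1 / 9)) / (1 - 1 / 9) ^ 2) := by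
        gcongr
    _ ≤ _ := by norm_num

lemma abs_remDeriv_one_le {x : ℝ} (hx : x ∈ Icc (-(1/3):ℝ) (1/3)) :
    |remDeriv μ s 1 x| ≤ √2 / (2 * π) / μ ^ 2 * 7.594 := by
  refine abs_remDeriv_le_of_abs_le hμ hs 1 hx ?_
  have h1 : 0 < 1 + x := by linarith [hx.1]
  have h2 : 0 < 1 - x := by linarith [hx.2]
  have hx2 : x ^ 2 ≤ 1 / 9 := by nlinarith [hx.1, hx.2]
  have e : 1 / (1 + x) ^ 3 + 1 / (1 - x) ^ 3 = (2 + 6 * x ^ 2) / (1 - x ^ 2) ^ 3 := by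
    rw [show 1 - x ^ 2 = (1 + x) * (1 - x) by ring]
    field_simp; ring
  norm_num only [Nat.factorial]
  rw [e]
  calc _ ≤ (2:ℝ) * ((2 + 6 * (1 / 9)) / (1 - 1 / 9) ^ 3) := by
        gcongr
    _ ≤ _ := by norm_num

lemma abs_remDeriv_two_le {x : ℝ} (hx : x ∈ Icc (-(1/3):ℝ) (1/3)) :
    |remDeriv μ s 2 x| ≤ √2 / (2 * π) / μ ^ 2 * 32.28 := by
  refine abs_remDeriv_le_of_abs_le hμ hs 2 hx ?_
  have h1 : 0 < 1 + x := by linarith [hx.1]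
  have h2 : 0 < 1 - x := by linarith [hx.2]
  have hx2 : x ^ 2 ≤ 1 / 9 := by nlinarith [hx.1, hx.2]
  have e : 1 / (1 + x) ^ 4 + 1 / (1 - x) ^ 4 =
      (2 + 12 * x ^ 2 + 2 * (x ^ 2) ^ 2) / (1 - x ^ 2) ^ 4 := by
    rw [show 1 - x ^ 2 = (1 + x) * (1 - x) by ring]
    field_simp; ring
  norm_num only [Nat.factorial]
  rw [e]
  calc _ ≤ (6:ℝ) * ((2 + 12 * (1 / 9) + 2 * (1 / 9) ^ 2) / (1 - 1 / 9) ^ 4) := by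
        gcongr
    _ ≤ _ := by norm_num

lemma abs_glueErrDeriv_sub_le {x y : ℝ} (hx : x ∈ Ioc (-1:ℝ) (1/3)) (hy : y ∈ Ioc (-1:ℝ) (1/3)) :
    |glueErrDeriv μ s x - glueErrDeriv μ s y| ≤ √2 / (2 * π) / μ ^ 2 * 103.2 * |x - y| := by
  set K := √2 / (2 * π) / μ ^ 2 with hK
  have hK0 : 0 ≤ K := by have := Real.pi_pos; positivity
  have main : ∀ x ∈ Icc (-(1/3):ℝ) (1/3), ∀ y ∈ Icc (-(1/3):ℝ) (1/3),
      |glueErrDeriv μ s x - glueErrDeriv μ s y| ≤ K * 103.2 * |x - y| := by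
    intro x hx y hy
    have a0 := abs_remDeriv_zero_le hμ hs hx
    have a1 := abs_remDeriv_one_le hμ hs hx
    have b0 := abs_remDeriv_sub_le hμ 0 (fun w hw => abs_remDeriv_one_le hμ hs hw) hx hy
    have b1 := abs_remDeriv_sub_le hμ 1 (fun w hw => abs_remDeriv_two_le hμ hs hw) hx hy
    have c0 := abs_qcutDeriv_sub_le x y
    have c1 := abs_qcut_sub_le x y
    have d := abs_nonneg (x - y)
    rw [← hK] at a0 a1 b0 b1
    have e : glueErrDeriv μ s x - glueErrDeriv μ s y =
        ((qcutDeriv x - qcutDeriv y) * remDeriv μ s 0 x +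
        qcutDeriv y * (remDeriv μ s 0 x - remDeriv μ s 0 y)) +
        ((qcut x - qcut y) * remDeriv μ s 1 x +
        qcut y * (remDeriv μ s 1 x - remDeriv μ s 1 y)) := by
      unfold glueErrDeriv; ring
    rw [e]
    have t1 : |(qcutDeriv x - qcutDeriv y) * remDeriv μ s 0 x| ≤ (9 * |x - y|) * (K * 2.8125) := by
      rw [abs_mul]; gcongr
    have t2 : |qcutDeriv y * (remDeriv μ s 0 x - remDeriv μ s 0 y)| ≤ 3 * (K * 7.594 * |x - y|) := by
      rw [abs_mul, abs_of_nonneg (qcutDeriv_nonneg y)]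
      exact mul_le_mul (qcutDeriv_le y) b0 (abs_nonneg _) (by norm_num)
    have t3 : |(qcut x - qcut y) * remDeriv μ s 1 x| ≤ (3 * |x - y|) * (K * 7.594) := by
      rw [abs_mul]; gcongr
    have t4 : |qcut y * (remDeriv μ s 1 x - remDeriv μ s 1 y)| ≤ 1 * (K * 32.28 * |x - y|) := by
      rw [abs_mul, abs_of_nonneg (qcut_nonneg y)]
      exact mul_le_mul (qcut_le_one y) b1 (abs_nonneg _) (by norm_num)
    refine (abs_add_le _ _).trans ((add_le_add (abs_add_le _ _) (abs_add_le _ _)).trans ?_)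
    nlinarith [mul_nonneg hK0 d]
  have hclamp : ∀ x, x ∈ Ioc (-1:ℝ) (1/3) → glueErrDeriv μ s x = glueErrDeriv μ s (max x (-(1/3))) := by
    intro x _
    rcases le_total x (-(1/3)) with h | h
    · rw [max_eq_right h, glueErrDeriv, glueErrDeriv, qcutDeriv_of_le h, qcut_of_le h,
        qcutDeriv_of_le le_rfl, qcut_of_le le_rfl]; ring
    · rw [max_eq_left h]
  rw [hclamp x hx, hclamp y hy]
  have hm : ∀ x, x ∈ Ioc (-1:ℝ) (1/3) → max x (-(1/3)) ∈ Icc (-(1/3):ℝ) (1/3) :=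
    fun x hx => ⟨le_max_right _ _, max_le hx.2 (by norm_num)⟩
  refine (main _ (hm x hx) _ (hm y hy)).trans ?_
  exact mul_le_mul_of_nonneg_left (abs_max_sub_max_le_abs x y _) (by positivity)

include hsin

lemma glueErr_hasDerivAt {x : ℝ} (hx : x ∈ Ioo (-1:ℝ) 1) :
    HasDerivAt (glueErr μ s) (glueErrDeriv μ s x) x := by
  have hs' : s * s = 1 := by rw [← abs_mul_abs_self, hs, one_mul]
  refine ((qcut_hasDerivAt x).mul (remDeriv_hasDerivAt hμ s 0 hx)).congr_of_eventuallyEq ?_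
  filter_upwards [Ioo_mem_nhds hx.1 hx.2] with y hy
  exact glueErr_of_mem hμ hs' hsin hy

lemma abs_secondDiff_glueErr_le {z t : ℝ} (hz : z ∈ Ioc (-(1/3):ℝ) 0) (ht : t ∈ Ioc (0:ℝ) (1/3)) :
    |secondDiff (glueErr μ s) z t| ≤ √2 / (2 * π) / μ ^ 2 * 103.2 := by
  set M := √2 / (2 * π) / μ ^ 2 * 103.2 with hM
  have hD : ∀ w ∈ Icc (0:ℝ) (1/3), HasDerivAt
      (fun t => glueErr μ s (z + t) + glueErr μ s (z - t) - 2 * glueErr μ s z)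
      (glueErrDeriv μ s (z + w) - glueErrDeriv μ s (z - w)) w := by
    intro w hw
    have h1 := (glueErr_hasDerivAt hμ hs hsin (x := z + w)
      ⟨by linarith [hz.1, hw.1], by linarith [hz.2, hw.2]⟩).comp_const_add z w
    have h2 := (glueErr_hasDerivAt hμ hs hsin (x := z - w)
      ⟨by linarith [hz.1, hw.2], by linarith [hz.2, hw.1]⟩).comp_const_sub z w
    exact (h1.add h2).sub_const _
  have key := image_norm_le_of_norm_deriv_right_le_deriv_boundary
    (f := fun t => glueErr μ s (z + t) + glueErr μ s (z - t) - 2 * glueErr μ s z)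
    (f' := fun w => glueErrDeriv μ s (z + w) - glueErrDeriv μ s (z - w)) (a := 0) (b := 1/3)
    (B := fun t => M * t ^ 2) (B' := fun t => M * (2 * t))
    (fun w hw => (hD w hw).continuousAt.continuousWithinAt)
    (fun w hw => (hD w ⟨hw.1, hw.2.le⟩).hasDerivWithinAt) (by simp; ring_nf)
    (fun t => by simpa using (hasDerivAt_pow 2 t).const_mul M)
    (fun w hw => by
      refine (abs_glueErrDeriv_sub_le hμ hs ⟨by linarith [hz.1, hw.1], by linarith [hz.2, hw.2]⟩
        ⟨by linarith [hz.1, hw.2], by linarith [hz.2, hw.1]⟩).trans (le_of_eq ?_)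
      rw [show z + w - (z - w) = 2 * w by ring, abs_of_nonneg (by linarith [hw.1])])
    ⟨ht.1.le, ht.2⟩
  rw [secondDiff, abs_div, abs_of_pos (pow_pos ht.1 2), div_le_iff₀ (pow_pos ht.1 2)]
  exact key

end

lemma integral_inv_sq_add_inv_sq {z a b : ℝ} (hab : a ≤ b) (ha : -1 < z + a) (hb : z + b < 1) :
    IntegrableOn (fun t => 1 / (1 + (z + t)) ^ 2 + 1 / (1 - (z + t)) ^ 2) (Ioo a b) ∧
    ∫ t in Ioo a b, (1 / (1 + (z + t)) ^ 2 + 1 / (1 - (z + t)) ^ 2) =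
      (1 / (1 - (z + b)) - 1 / (1 + (z + b))) - (1 / (1 - (z + a)) - 1 / (1 + (z + a))) := by
  have h1 : ∀ t ∈ Icc a b, 1 + (z + t) ≠ 0 := fun t ht => by linarith [ht.1] |> fun h : 0 < 1 + (z + t) => h.ne'
  have h2 : ∀ t ∈ Icc a b, 1 - (z + t) ≠ 0 := fun t ht => by linarith [ht.2] |> fun h : 0 < 1 - (z + t) => h.ne'
  have hc : ContinuousOn (fun t => 1 / (1 + (z + t)) ^ 2 + 1 / (1 - (z + t)) ^ 2) (Icc a b) := by
    refine ContinuousOn.add (ContinuousOn.div (by fun_prop) (by fun_prop) fun t ht => pow_ne_zero 2 (h1 t ht))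
      (ContinuousOn.div (by fun_prop) (by fun_prop) fun t ht => pow_ne_zero 2 (h2 t ht))
  refine ⟨(hc.integrableOn_Icc).mono_set Ioo_subset_Icc_self, ?_⟩
  rw [← integral_Ioc_eq_integral_Ioo, ← intervalIntegral.integral_of_le hab]
  refine intervalIntegral.integral_eq_sub_of_hasDerivAt
    (f := fun t => 1 / (1 - (z + t)) - 1 / (1 + (z + t))) (fun t ht => ?_)
    (by rw [← uIcc_of_le hab] at hc; exact hc.intervalIntegrable)
  rw [uIcc_of_le hab] at ht
  have e1 : HasDerivAt (fun t => 1 + (z + t)) 1 t := ((hasDerivAt_id t).const_add z).const_add 1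
  have e2 : HasDerivAt (fun t => 1 - (z + t)) (-1) t := ((hasDerivAt_id t).const_add z).const_sub 1
  have d1 := (hasDerivAt_const t (1:ℝ)).div e1 (h1 t ht)
  have d2 := (hasDerivAt_const t (1:ℝ)).div e2 (h2 t ht)
  refine (d2.sub d1).congr_deriv ?_
  ring

lemma integral_rfun_comp_le {μ z b : ℝ} (hμ : 0 < μ) (hb : b ≤ 1 - z) :
    IntegrableOn (fun t => rfun (μ * (1 - (z + t)))) (Ioo b (1 - z)) ∧
    ∫ t in Ioo b (1 - z), rfun (μ * (1 - (z + t))) ≤ √2 / 4 / μ := by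
  have hc : ContinuousOn (fun t => rfun (μ * (1 - (z + t)))) (Icc b (1 - z)) :=
    rfun_continuousOn.comp (by fun_prop) fun t ht => mul_nonneg hμ.le (by linarith [ht.2])
  refine ⟨(hc.integrableOn_Icc).mono_set Ioo_subset_Icc_self, ?_⟩
  rw [← integral_Ioc_eq_integral_Ioo, ← intervalIntegral.integral_of_le hb]
  have e : (fun t => rfun (μ * (1 - (z + t)))) = fun t => rfun (μ * (1 - z) - μ * t) := by
    ext t; ring_nf
  rw [e, intervalIntegral.integral_comp_sub_mul _ hμ.ne', sub_self, smul_eq_mul, inv_mul_eq_div]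
  gcongr
  exact integral_rfun_le (by nlinarith)

section
variable {μ s : ℝ} (hμ : 0 < μ) (hs : |s| = 1)
  (hsin : ∀ x, Real.sin (μ * (1 - x) + π / 8) = s * Real.sin (μ * (1 + x) + π / 8))
include hμ

lemma rfun_scaled_le {x : ℝ} (hx : 0 < x) : rfun (μ * x) ≤ √2 / (2 * π) / μ ^ 2 * (1 / x ^ 2) := by
  refine (rfun_le (mul_pos hμ hx)).trans (le_of_eq ?_)
  rw [mul_pow]
  have := Real.pi_pos
  field_simp

lemma measurable_glueErr_div (z : ℝ) : Measurable fun t => glueErr μ s (z + t) / t ^ 2 :=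
  ((continuous_glueErr hμ s).measurable.comp (measurable_const_add z)).div (measurable_id.pow_const 2)

lemma intBd_far {z : ℝ} (hz : z ≤ 0) :
    IntBd (fun t => glueErr μ s (z + t) / t ^ 2) (Ioi (1 - z))
      (√2 / (2 * π) / μ ^ 2 * (1 / 4) * (1 / (1 - z)) + 2 / (μ * (1 - z) ^ 2)) := by
  have hd : 0 < 1 - z := by linarith
  have h2 := intBd_sin_div_sq (α := μ * (1 + z) + π / 8 + π) hμ hd
  have h1 : IntBd (fun t => (glueErr μ s (z + t) + Real.sin (μ * (1 + (z + t)) + π / 8)) / t ^ 2)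
      (Ioi (1 - z)) (√2 / (2 * π) / μ ^ 2 * (1 / 4) * (1 / (1 - z))) := by
    refine IntBd.of_abs_le measurableSet_Ioi ?_
      ((integrableOn_inv_sq_Ioi hd).const_mul (√2 / (2 * π) / μ ^ 2 * (1 / 4))) ?_
      (by rw [integral_const_mul, integral_inv_sq_Ioi hd])
    · exact (((continuous_glueErr hμ s).measurable.comp (measurable_const_add z)).add
        (by fun_prop)).div (measurable_id.pow_const 2)
    · intro t (ht : 1 - z < t)
      have ht0 : 0 < t := hd.trans ht
      rw [glueErr_of_ge (by linarith), sub_add_cancel, abs_div, abs_of_nonneg (rfun_nonneg _),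
        abs_of_pos (pow_pos ht0 2), div_eq_mul_one_div]
      refine mul_le_mul_of_nonneg_right ((rfun_scaled_le hμ (by linarith)).trans ?_) (by positivity)
      refine mul_le_mul_of_nonneg_left ?_ (by have := Real.pi_pos; positivity)
      rw [show (4:ℝ) = 2 ^ 2 by norm_num]
      gcongr
      linarith
  refine (h1.add h2).congr measurableSet_Ioi fun t _ => ?_
  rw [show μ * (1 + z) + π / 8 + π + μ * t = μ * (1 + (z + t)) + π / 8 + π by ring, Real.sin_add_pi]
  ring

include hs hsin

lemma intBd_edge {z : ℝ} (hz : z ≤ 0) :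
    IntBd (fun t => glueErr μ s (z + t) / t ^ 2) (Ioo (2/3 - z) (1 - z))
      ((√2 / (2 * π) / μ ^ 2 * (3 / 25) + √2 / 4 / μ) * (1 / (2/3 - z) ^ 2)) := by
  have hs' : s * s = 1 := by rw [← abs_mul_abs_self, hs, one_mul]
  obtain ⟨hi, hI⟩ := integral_rfun_comp_le (μ := μ) (z := z) (b := 2/3 - z) hμ (by linarith)
  have hci : IntegrableOn (fun _ => √2 / (2 * π) / μ ^ 2 * (9 / 25)) (Ioo (2/3 - z) (1 - z)) :=
    continuous_const.integrableOn_Icc.mono_set Ioo_subset_Icc_self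
  have hsum : IntegrableOn (fun t => √2 / (2 * π) / μ ^ 2 * (9 / 25) + rfun (μ * (1 - (z + t))))
      (Ioo (2/3 - z) (1 - z)) := hci.add hi
  refine IntBd.of_abs_le (h := fun t => (√2 / (2 * π) / μ ^ 2 * (9 / 25) +
    rfun (μ * (1 - (z + t)))) * (1 / (2/3 - z) ^ 2)) measurableSet_Ioo (measurable_glueErr_div hμ z)
    (Integrable.mul_const hsum _) ?_ ?_
  · intro t ht
    have hb : 0 < 2/3 - z := by linarith
    have ht0 : 0 < t := hb.trans ht.1
    have h1 : 0 ≤ μ * (1 + (z + t)) := mul_nonneg hμ.le (by linarith [ht.1])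
    have h2 : 0 ≤ μ * (1 - (z + t)) := mul_nonneg hμ.le (by linarith [ht.2])
    rw [glueErr_of_mem hμ hs' hsin ⟨by linarith [ht.1], by linarith [ht.2]⟩,
      qcut_of_ge (by linarith [ht.1]), one_mul, abs_div, abs_of_pos (pow_pos ht0 2), div_eq_mul_one_div]
    refine mul_le_mul ?_ ?_ (by positivity) (add_nonneg (by have := Real.pi_pos; positivity) (rfun_nonneg _))
    · rw [remDeriv, pow_zero, one_mul, pow_zero, mul_one, ← rfun_eq_rDeriv h1, ← rfun_eq_rDeriv h2]
      refine (abs_sub _ _).trans (add_le_add ?_ ?_)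
      · rw [abs_of_nonneg (rfun_nonneg _)]
        refine (rfun_scaled_le hμ (by linarith [ht.1])).trans ?_
        refine mul_le_mul_of_nonneg_left ?_ (by have := Real.pi_pos; positivity)
        rw [show (9:ℝ) / 25 = 1 / (5 / 3) ^ 2 by norm_num]
        gcongr
        linarith [ht.1]
      · rw [abs_mul, hs, one_mul, abs_of_nonneg (rfun_nonneg _)]
    · gcongr
      exact ht.1.le
  · rw [integral_mul_const, integral_add hci hi]
    refine mul_le_mul_of_nonneg_right (add_le_add (le_of_eq ?_) hI) (by positivity)
    rw [setIntegral_const, measureReal_def, Real.volume_Ioo, smul_eq_mul,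
      show 1 - z - (2/3 - z) = 1/3 by ring, ENNReal.toReal_ofReal (by norm_num)]
    ring

lemma intBd_middle {z a C : ℝ} (haz : a ≤ 2/3 - z) (ha : -1 < z + a) (ha0 : 0 ≤ a) (hC : 0 ≤ C)
    (hq : ∀ t ∈ Ioo a (2/3 - z), qcut (z + t) ≤ C * t ^ 2) :
    IntBd (fun t => glueErr μ s (z + t) / t ^ 2) (Ioo a (2/3 - z))
      (C * (√2 / (2 * π) / μ ^ 2) * (12/5 - (1 / (1 - (z + a)) - 1 / (1 + (z + a))))) := by
  have hs' : s * s = 1 := by rw [← abs_mul_abs_self, hs, one_mul]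
  obtain ⟨hi, hI⟩ := integral_inv_sq_add_inv_sq (z := z) haz ha (by linarith)
  refine IntBd.of_abs_le measurableSet_Ioo (measurable_glueErr_div hμ z)
    (hi.const_mul (C * (√2 / (2 * π) / μ ^ 2))) ?_ ?_
  · intro t ht
    have ht0 : 0 < t := ha0.trans_lt ht.1
    have hm : z + t ∈ Ioo (-1:ℝ) 1 := ⟨by linarith [ht.1], by linarith [ht.2]⟩
    have h0 := abs_remDeriv_le hμ hs 0 hm
    norm_num only [Nat.factorial] at h0
    rw [glueErr_of_mem hμ hs' hsin hm, abs_div, abs_mul, abs_of_nonneg (qcut_nonneg _),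
      abs_of_pos (pow_pos ht0 2), div_le_iff₀ (pow_pos ht0 2)]
    calc _ ≤ (C * t ^ 2) * _ := mul_le_mul (hq t ht) h0 (abs_nonneg _) (by positivity)
      _ = _ := by ring
  · rw [integral_const_mul, hI]
    refine le_of_eq ?_
    congr 2
    rw [show z + (2/3 - z) = 2/3 by ring]; norm_num

lemma abs_integral_secondDiff_glueErr_le_left {z : ℝ} (hz : z ∈ Ioc (-1:ℝ) (-(1/3))) :
    IntBd (secondDiff (glueErr μ s) z) (Ioi 0)
      (√2 / (2 * π) / μ ^ 2 * 14.4825 + (√2 / 4 + 9 / 8) / μ) := by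
  have hK : 0 ≤ √2 / (2 * π) / μ ^ 2 := by have := Real.pi_pos; positivity
  have hz1 := hz.1
  have hz2 := hz.2
  have h1 := intBd_far (s := s) hμ (z := z) (by linarith)
  have h2 := intBd_edge hμ hs hsin (z := z) (by linarith)
  have h3 := intBd_middle hμ hs hsin (z := z) (a := -(1/3) - z) (C := 9/2) (by linarith) (by linarith)
    (by linarith) (by norm_num) (fun t ht => by
      refine (qcut_le_sq (by linarith [ht.1])).trans ?_
      gcongr
      · linarith [ht.1]
      · linarith)
  have h4 : IntBd (fun t => glueErr μ s (z + t) / t ^ 2) (Ioo 0 (-(1/3) - z)) 0 := by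
    have h0 : IntBd (fun _ => (0:ℝ)) (Ioo 0 (-(1/3) - z)) 0 := ⟨integrableOn_zero, by simp⟩
    refine h0.congr measurableSet_Ioo fun t ht => ?_
    rw [glueErr_of_le (by linarith [ht.2]), zero_div]
  have h := h4.Ioi_of_Ioo (by linarith) (h3.Ioi_of_Ioo (by linarith) (h2.Ioi_of_Ioo (by linarith) h1))
  refine (h.congr measurableSet_Ioi fun t (ht : 0 < t) => ?_).mono ?_
  · rw [secondDiff, glueErr_of_le hz2, glueErr_of_le (x := z - t) (by linarith)]; ring
  · have a1 : 1 / (2/3 - z) ^ 2 ≤ 1 := by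
      rw [div_le_one (by nlinarith)]; nlinarith
    have a2 : 1 / (1 - z) ≤ 3 / 4 := by
      rw [div_le_iff₀ (by linarith)]; linarith
    have a3 : 2 / (μ * (1 - z) ^ 2) ≤ 9 / 8 / μ := by
      rw [div_le_div_iff₀ (by nlinarith [mul_pos hμ (show 0 < (1 - z) ^ 2 by nlinarith)]) hμ]
      nlinarith [mul_nonneg hμ.le (show 0 ≤ (1 - z) ^ 2 - 16 / 9 by nlinarith)]
    have a4 : (√2 / (2 * π) / μ ^ 2 * (3 / 25) + √2 / 4 / μ) * (1 / (2/3 - z) ^ 2) ≤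
        (√2 / (2 * π) / μ ^ 2 * (3 / 25) + √2 / 4 / μ) * 1 :=
      mul_le_mul_of_nonneg_left a1 (by positivity)
    have a5 := mul_le_mul_of_nonneg_left a2 (show 0 ≤ √2 / (2 * π) / μ ^ 2 * (1 / 4) by positivity)
    rw [add_div]
    rw [show z + (-(1/3) - z) = -(1/3) by ring]
    norm_num only
    linarith

lemma abs_integral_secondDiff_glueErr_le_right {z : ℝ} (hz : z ∈ Ioc (-(1/3):ℝ) 0) :
    IntegrableOn (secondDiff (glueErr μ s) z) (Ioi 0) ∧
    |(∫ t in Ioi 0, secondDiff (glueErr μ s) z t) + 6 * glueErr μ s z| ≤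
      √2 / (2 * π) / μ ^ 2 * 56.52 + (9 * √2 / 16 + 2) / μ := by
  have hK : 0 ≤ √2 / (2 * π) / μ ^ 2 := by have := Real.pi_pos; positivity
  have hz1 := hz.1
  have hz2 := hz.2
  have h1 := intBd_far (s := s) hμ (z := z) (by linarith)
  have h2 := intBd_edge hμ hs hsin (z := z) (by linarith)
  have h3 := intBd_middle hμ hs hsin (z := z) (a := 1/3) (C := 9) (by linarith) (by linarith)
    (by norm_num) (by norm_num) (fun t ht => by
      refine (qcut_le_one _).trans ?_
      nlinarith [ht.1])
  have h := h3.Ioi_of_Ioo (by linarith) (h2.Ioi_of_Ioo (by linarith) h1)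
  have hinv := (integrableOn_inv_sq_Ioi (a := 1/3) (by norm_num)).const_mul (2 * glueErr μ s z)
  have hinvI : ∫ t in Ioi (1/3 : ℝ), 2 * glueErr μ s z * (1 / t ^ 2) = 6 * glueErr μ s z := by
    rw [integral_const_mul, integral_inv_sq_Ioi (by norm_num)]; ring
  have heq : ∀ t ∈ Ioi (1/3 : ℝ), secondDiff (glueErr μ s) z t =
      glueErr μ s (z + t) / t ^ 2 - 2 * glueErr μ s z * (1 / t ^ 2) := by
    intro t (ht : 1/3 < t)
    rw [secondDiff, glueErr_of_le (x := z - t) (by linarith)]; ring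
  have hi1 : IntegrableOn (secondDiff (glueErr μ s) z) (Ioi (1/3)) :=
    (h.1.sub hinv).congr_fun (fun t ht => (heq t ht).symm) measurableSet_Ioi
  have hI1 : ∫ t in Ioi (1/3 : ℝ), secondDiff (glueErr μ s) z t =
      (∫ t in Ioi (1/3 : ℝ), glueErr μ s (z + t) / t ^ 2) - 6 * glueErr μ s z := by
    rw [setIntegral_congr_fun measurableSet_Ioi heq, integral_sub h.1 hinv, hinvI]
  have h0 : IntBd (secondDiff (glueErr μ s) z) (Ioc 0 (1/3)) (√2 / (2 * π) / μ ^ 2 * 103.2 / 3) := by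
    refine IntBd.of_abs_le (h := fun _ => √2 / (2 * π) / μ ^ 2 * 103.2) measurableSet_Ioc
      (measurable_secondDiff (continuous_glueErr hμ s).measurable z) (continuous_const.integrableOn_Icc.mono_set Ioc_subset_Icc_self)
      (fun t ht => abs_secondDiff_glueErr_le hμ hs hsin hz ht) (le_of_eq ?_)
    rw [setIntegral_const, measureReal_def, Real.volume_Ioc, smul_eq_mul, sub_zero,
      ENNReal.toReal_ofReal (by norm_num)]
    ring
  rw [← Ioc_union_Ioi_eq_Ioi (show (0:ℝ) ≤ 1/3 by norm_num)]
  refine ⟨h0.1.union hi1, ?_⟩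
  rw [setIntegral_union Ioc_disjoint_Ioi_same measurableSet_Ioi h0.1 hi1, hI1]
  rw [show ∀ a b c : ℝ, a + (b - c) + c = a + b by intros; ring]
  refine (abs_add_le _ _).trans ((add_le_add h0.2 h.2).trans ?_)
  have a1 : 1 / (2/3 - z) ^ 2 ≤ 9 / 4 := by
    rw [div_le_iff₀ (by nlinarith)]; nlinarith
  have a2 : 1 / (1 - z) ≤ 1 := by
    rw [div_le_iff₀ (by linarith)]; linarith
  have a3 : 2 / (μ * (1 - z) ^ 2) ≤ 2 / μ := by
    gcongr
    nlinarith [mul_nonneg hμ.le (show 0 ≤ (1 - z) ^ 2 - 1 by nlinarith)]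
  have a4 : (√2 / (2 * π) / μ ^ 2 * (3 / 25) + √2 / 4 / μ) * (1 / (2/3 - z) ^ 2) ≤
      (√2 / (2 * π) / μ ^ 2 * (3 / 25) + √2 / 4 / μ) * (9 / 4) :=
    mul_le_mul_of_nonneg_left a1 (by positivity)
  have a5 := mul_le_mul_of_nonneg_left a2 (show 0 ≤ √2 / (2 * π) / μ ^ 2 * (1 / 4) by positivity)
  have a6 : 12/5 - (1 / (1 - (z + 1/3)) - 1 / (1 + (z + 1/3))) ≤ 12/5 := by
    have : 1 / (1 + (z + 1/3)) ≤ 1 / (1 - (z + 1/3)) := by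
      gcongr <;> linarith
    linarith
  have a7 := mul_le_mul_of_nonneg_left a6 (show 0 ≤ 9 * (√2 / (2 * π) / μ ^ 2) by positivity)
  have a8 : (9 * √2 / 16 + 2) / μ = √2 / 4 / μ * (9 / 4) + 2 / μ := by field_simp; ring
  rw [a8]
  linarith

lemma abs_glueErr_le {z : ℝ} (hz : z ∈ Ioc (-(1/3):ℝ) 0) :
    |glueErr μ s z| ≤ √2 / (2 * π) / μ ^ 2 := by
  have hK : 0 ≤ √2 / (2 * π) / μ ^ 2 := by have := Real.pi_pos; positivity
  have hs' : s * s = 1 := by rw [← abs_mul_abs_self, hs, one_mul]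
  have hm : z ∈ Ioo (-1:ℝ) 1 := ⟨by linarith [hz.1], by linarith [hz.2]⟩
  have h0 := abs_remDeriv_le hμ hs 0 hm
  norm_num only [Nat.factorial] at h0
  rw [glueErr_of_mem hμ hs' hsin hm, abs_mul, abs_of_nonneg (qcut_nonneg _)]
  have h1 : 0 < 1 + z := by linarith [hm.1]
  have h2 : 0 < 1 - z := by linarith [hm.2]
  have e : 1 / (1 + z) ^ 2 + 1 / (1 - z) ^ 2 = (2 + 2 * z ^ 2) / (1 - z ^ 2) ^ 2 := by
    rw [show 1 - z ^ 2 = (1 + z) * (1 - z) by ring]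
    field_simp; ring
  have key : qcut z * (1 / (1 + z) ^ 2 + 1 / (1 - z) ^ 2) ≤ 1 := by
    rw [e, qcut_of_mem ⟨hz.1.le, hz.2⟩, ← mul_div_assoc, div_le_one (by
      have : 0 < 1 - z ^ 2 := by nlinarith
      positivity)]
    have : 0 ≤ -z * (6 + 12 * z + 6 * z ^ 2 + 8 * z ^ 3) := by
      refine mul_nonneg (by linarith [hz.2]) ?_
      nlinarith [hz.1, hz.2, sq_nonneg z, mul_nonneg (sq_nonneg z) (show 0 ≤ z + 1/3 by linarith [hz.1])]
    nlinarith
  calc _ ≤ qcut z * _ := mul_le_mul_of_nonneg_left h0 (qcut_nonneg _)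
    _ = √2 / (2 * π) / μ ^ 2 * (qcut z * (1 / (1 + z) ^ 2 + 1 / (1 - z) ^ 2)) := by ring
    _ ≤ _ := mul_le_of_le_one_right hK key

end

lemma sqrt_two_div_two_pi_le : √2 / (2 * π) ≤ 0.2251 := by
  have h1 : √2 ≤ 1.41422 := Real.sqrt_le_iff.2 ⟨by norm_num, by norm_num⟩
  have h2 := Real.pi_gt_d4
  rw [div_le_iff₀ (by positivity)]
  linarith

section
variable {μ s : ℝ} (hμ : 3 * π / 8 ≤ μ) (hs : |s| = 1)
  (hsin : ∀ x, Real.sin (μ * (1 - x) + π / 8) = s * Real.sin (μ * (1 + x) + π / 8))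
include hμ hs hsin

lemma integral_secondDiff_glue {z : ℝ} (hz : z ∈ Ioc (-1:ℝ) 0) :
    IntegrableOn (secondDiff (glue μ s) z) (Ioi 0) ∧
    (1 / π) * (∫ t in Ioi 0, secondDiff (glue μ s) z t) + μ * glue μ s z =
      (1 / π) * (∫ t in Ioi 0, secondDiff (glueErr μ s) z t) + μ * glueErr μ s z := by
  have hμ0 : 0 < μ := lt_of_lt_of_le (by have := Real.pi_pos; positivity) hμ
  obtain ⟨h1, h1'⟩ := integral_secondDiff_psiShift hμ0 hz.1
  have h2 : IntegrableOn (secondDiff (glueErr μ s) z) (Ioi 0) := by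
    rcases le_or_gt z (-(1/3)) with h | h
    · exact (abs_integral_secondDiff_glueErr_le_left hμ0 hs hsin ⟨hz.1, h⟩).1
    · exact (abs_integral_secondDiff_glueErr_le_right hμ0 hs hsin ⟨h, hz.2⟩).1
  have e : secondDiff (glue μ s) z =
      fun t => secondDiff (psiShift μ) z t + secondDiff (glueErr μ s) z t := by
    ext t
    rw [← secondDiff_add]
    simp only [glueErr, add_sub_cancel]
  rw [e]
  refine ⟨h1.add h2, ?_⟩
  rw [integral_add h1 h2, h1', glueErr]
  have := Real.pi_pos
  field_simp
  ring

lemma abs_residual_le_left {z : ℝ} (hz : z ∈ Ioc (-1:ℝ) (-(1/3))) :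
    |(1 / π) * (∫ t in Ioi 0, secondDiff (glue μ s) z t) + μ * glue μ s z| ≤
      (0.48 + 1.06 / μ) / μ := by
  have hμ0 : 0 < μ := lt_of_lt_of_le (by have := Real.pi_pos; positivity) hμ
  have hpi := Real.pi_gt_d4
  rw [(integral_secondDiff_glue hμ hs hsin ⟨hz.1, by linarith [hz.2]⟩).2, glueErr_of_le hz.2,
    mul_zero, add_zero, abs_mul, abs_of_pos (a := 1 / π) (by positivity), one_div,
    inv_mul_le_iff₀ (by positivity)]
  refine (abs_integral_secondDiff_glueErr_le_left hμ0 hs hsin hz).2.trans ?_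
  have h1 : √2 ≤ 1.41422 := Real.sqrt_le_iff.2 ⟨by norm_num, by norm_num⟩
  calc _ ≤ 0.2251 / μ ^ 2 * 14.4825 + (1.41422 / 4 + 9 / 8) / μ := by
        gcongr
        exact sqrt_two_div_two_pi_le
    _ = ((1.41422 / 4 + 9 / 8) + 0.2251 * 14.4825 / μ) / μ := by field_simp; ring
    _ ≤ (π * 0.48 + π * 1.06 / μ) / μ :=
        div_le_div_of_nonneg_right (add_le_add (by linarith)
          (div_le_div_of_nonneg_right (by linarith) hμ0.le)) hμ0.le
    _ = _ := by ring

lemma abs_residual_le_right {z : ℝ} (hz : z ∈ Ioc (-(1/3):ℝ) 0) :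
    |(1 / π) * (∫ t in Ioi 0, secondDiff (glue μ s) z t) + μ * glue μ s z| ≤
      (1.13 + 4.1 / μ) / μ := by
  have hμ0 : 0 < μ := lt_of_lt_of_le (by have := Real.pi_pos; positivity) hμ
  have hpi := Real.pi_gt_d4
  have h1 : √2 ≤ 1.41422 := Real.sqrt_le_iff.2 ⟨by norm_num, by norm_num⟩
  rw [(integral_secondDiff_glue hμ hs hsin ⟨by linarith [hz.1], hz.2⟩).2]
  have hS := (abs_integral_secondDiff_glueErr_le_right hμ0 hs hsin hz).2
  have hg := abs_glueErr_le hμ0 hs hsin hz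
  set S := ∫ t in Ioi 0, secondDiff (glueErr μ s) z t
  have e : 1 / π * S + μ * glueErr μ s z =
      1 / π * (S + 6 * glueErr μ s z) + (μ - 6 / π) * glueErr μ s z := by ring
  have hc : |μ - 6 / π| ≤ μ := by
    have : 6 / π ≤ 2 * μ := by
      rw [div_le_iff₀ (by positivity)]
      nlinarith
    have : 0 < 6 / π := by positivity
    rw [abs_le]
    constructor <;> linarith
  rw [e]
  refine (abs_add_le _ _).trans ?_
  rw [abs_mul, abs_mul, abs_of_pos (a := 1 / π) (by positivity)]
  have hK : √2 / (2 * π) / μ ^ 2 ≤ 0.2251 / μ ^ 2 := by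
    gcongr
    exact sqrt_two_div_two_pi_le
  calc _ ≤ 1 / 3.1415 * (0.2251 / μ ^ 2 * 56.52 + (9 * 1.41422 / 16 + 2) / μ) +
        μ * (0.2251 / μ ^ 2) := by
        refine add_le_add (mul_le_mul ?_ (hS.trans ?_) (abs_nonneg _) (by norm_num))
          (mul_le_mul hc (hg.trans hK) (abs_nonneg _) hμ0.le)
        · gcongr
        · gcongr
    _ = ((1 / 3.1415) * (9 * 1.41422 / 16 + 2) + 0.2251 +
          (1 / 3.1415 * (0.2251 * 56.52)) / μ) / μ := by
        field_simp
        ring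
    _ ≤ _ := by
        gcongr <;> norm_num

end

lemma secondDiff_glue_neg {s : ℝ} (hs : s * s = 1) (μ z t : ℝ) :
    secondDiff (glue μ s) (-z) t = s * secondDiff (glue μ s) z t := by
  rw [secondDiff, secondDiff, show -z + t = -(z - t) by ring, show -z - t = -(z + t) by ring,
    glue_neg hs, glue_neg hs, glue_neg hs]
  ring

section
variable {μ s : ℝ} (hμ : 3 * π / 8 ≤ μ) (hs : |s| = 1)
  (hsin : ∀ x, Real.sin (μ * (1 - x) + π / 8) = s * Real.sin (μ * (1 + x) + π / 8))
include hμ hs hsin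

lemma integrableOn_secondDiff_glue {z : ℝ} (hz : z ∈ Ioo (-1:ℝ) 1) :
    IntegrableOn (secondDiff (glue μ s) z) (Ioi 0) := by
  have hs' : s * s = 1 := by rw [← abs_mul_abs_self, hs, one_mul]
  rcases le_total z 0 with h | h
  · exact (integral_secondDiff_glue hμ hs hsin ⟨hz.1, h⟩).1
  · have h1 := (integral_secondDiff_glue hμ hs hsin (z := -z) ⟨by linarith [hz.2], by linarith⟩).1
    refine IntegrableOn.congr_fun (f := fun t => s * secondDiff (glue μ s) (-z) t)
      (h1.const_mul s) (fun t _ => ?_) measurableSet_Ioi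
    show s * secondDiff (glue μ s) (-z) t = secondDiff (glue μ s) z t
    rw [secondDiff_glue_neg hs', ← mul_assoc, hs', one_mul]

lemma residual_sq_le {z : ℝ} (hz : z ∈ Ioo (-1:ℝ) 1) :
    ((1 / π) * (∫ t in Ioi 0, secondDiff (glue μ s) z t) + μ * glue μ s z) ^ 2 ≤
      ((0.48 + 1.06 / μ) / μ) ^ 2 + indicator (Ioo (-(1/3)) (1/3))
        (fun _ => ((1.13 + 4.1 / μ) / μ) ^ 2 - ((0.48 + 1.06 / μ) / μ) ^ 2) z := by
  have hs' : s * s = 1 := by rw [← abs_mul_abs_self, hs, one_mul]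
  have main : ∀ z ∈ Ioc (-1:ℝ) 0,
      ((1 / π) * (∫ t in Ioi 0, secondDiff (glue μ s) z t) + μ * glue μ s z) ^ 2 ≤
      ((0.48 + 1.06 / μ) / μ) ^ 2 + indicator (Ioo (-(1/3)) (1/3))
        (fun _ => ((1.13 + 4.1 / μ) / μ) ^ 2 - ((0.48 + 1.06 / μ) / μ) ^ 2) z := by
    intro z hz
    rw [← sq_abs]
    rcases le_or_gt z (-(1/3)) with h | h
    · rw [indicator_of_notMem (fun hm => by linarith [hm.1]), add_zero]
      gcongr
      exact abs_residual_le_left hμ hs hsin ⟨hz.1, h⟩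
    · rw [indicator_of_mem (show z ∈ Ioo (-(1/3):ℝ) (1/3) from ⟨h, by linarith [hz.2]⟩), add_sub_cancel]
      gcongr
      exact abs_residual_le_right hμ hs hsin ⟨h, hz.2⟩
  rcases le_total z 0 with h | h
  · exact main z ⟨hz.1, h⟩
  · have h1 := main (-z) ⟨by linarith [hz.2], by linarith⟩
    simp only [secondDiff_glue_neg hs', glue_neg hs', integral_const_mul] at h1
    have e1 : indicator (Ioo (-(1/3):ℝ) (1/3))
        (fun _ => ((1.13 + 4.1 / μ) / μ) ^ 2 - ((0.48 + 1.06 / μ) / μ) ^ 2) (-z) =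
        indicator (Ioo (-(1/3):ℝ) (1/3))
        (fun _ => ((1.13 + 4.1 / μ) / μ) ^ 2 - ((0.48 + 1.06 / μ) / μ) ^ 2) z := by
      simp only [indicator, mem_Ioo, neg_lt_neg_iff]
      congr 1
      rw [neg_lt, and_comm]
    rw [e1] at h1
    refine le_trans (le_of_eq ?_) h1
    rw [show ∀ a b c d : ℝ, a * (s * b) + c * (s * d) = s * (a * b + c * d) by intros; ring, mul_pow,
      sq s, hs', one_mul]

lemma integral_residual_sq_le :
    ∫ z in Ioo (-1:ℝ) 1,
      ((1 / π) * (∫ t in Ioi 0, secondDiff (glue μ s) z t) + μ * glue μ s z) ^ 2 ≤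
      4 / 3 * ((0.48 + 1.06 / μ) / μ) ^ 2 + 2 / 3 * ((1.13 + 4.1 / μ) / μ) ^ 2 := by
  set P := ((0.48 + 1.06 / μ) / μ) ^ 2 with hP
  set Q := ((1.13 + 4.1 / μ) / μ) ^ 2 with hQ
  have i1 : IntegrableOn (fun _ : ℝ => P) (Ioo (-1:ℝ) 1) :=
    continuous_const.integrableOn_Icc.mono_set Ioo_subset_Icc_self
  have i2 : IntegrableOn (indicator (Ioo (-(1/3):ℝ) (1/3)) (fun _ => Q - P)) (Ioo (-1:ℝ) 1) :=
    IntegrableOn.indicator (continuous_const.integrableOn_Icc.mono_set Ioo_subset_Icc_self)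
      measurableSet_Ioo
  have hI : ∫ z in Ioo (-1:ℝ) 1, (P + indicator (Ioo (-(1/3):ℝ) (1/3)) (fun _ => Q - P) z) =
      4 / 3 * P + 2 / 3 * Q := by
    rw [integral_add i1 i2, setIntegral_indicator measurableSet_Ioo,
      inter_eq_self_of_subset_right (Ioo_subset_Ioo (by norm_num) (by norm_num)),
      setIntegral_const, setIntegral_const, measureReal_def, measureReal_def, Real.volume_Ioo,
      Real.volume_Ioo, ENNReal.toReal_ofReal (by norm_num), ENNReal.toReal_ofReal (by norm_num),
      smul_eq_mul, smul_eq_mul]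
    ring
  rw [← hI]
  refine integral_mono_of_nonneg (Eventually.of_forall fun z => sq_nonneg _) (i1.add i2) ?_
  filter_upwards [ae_restrict_mem measurableSet_Ioo] with z hz
  exact residual_sq_le hμ hs hsin hz

end

theorem approx_eigenfunction_bound (n : ℕ) (hn : 1 ≤ n) :
    ∃ A : ℝ → ℝ,
      (∀ z ∈ Ioo (-1 : ℝ) 1,
        Tendsto (fun ε : ℝ =>
            (1 / Real.pi) * ∫ x in {x : ℝ | ε < |x - z|},
              (phiApprox n x - phiApprox n z) / (x - z) ^ 2)
          (𝓝[>] 0) (𝓝 (A z))) ∧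
      Real.sqrt (∫ z in Ioo (-1 : ℝ) 1,
          (A z + (n * Real.pi / 2 - Real.pi / 8) * phiApprox n z) ^ 2)
        < Real.sqrt (1.21 + 8.00 / (n * Real.pi / 2 - Real.pi / 8)
            + 13.66 / (n * Real.pi / 2 - Real.pi / 8) ^ 2)
          * (1 / (n * Real.pi / 2 - Real.pi / 8)) := by
  have hphi : phiApprox n = glue (n * Real.pi / 2 - Real.pi / 8) ((-1) ^ (n + 1)) := rfl
  have hs : |(-1 : ℝ) ^ (n + 1)| = 1 := by simp
  have hsin : ∀ x, Real.sin ((n * π / 2 - π / 8) * (1 - x) + π / 8) =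
      (-1 : ℝ) ^ (n + 1) * Real.sin ((n * π / 2 - π / 8) * (1 + x) + π / 8) := by
    intro x
    rw [show (n * π / 2 - π / 8) * (1 - x) + π / 8 =
      n * π - ((n * π / 2 - π / 8) * (1 + x) + π / 8) by ring, Real.sin_nat_mul_pi_sub]
    ring
  have hn' : (1:ℝ) ≤ n := by exact_mod_cast hn
  have hμ : 3 * π / 8 ≤ n * π / 2 - π / 8 := by nlinarith [Real.pi_pos]
  rw [hphi]
  set μ := n * π / 2 - π / 8
  set s : ℝ := (-1) ^ (n + 1)
  have hμ0 : 0 < μ := lt_of_lt_of_le (by have := Real.pi_pos; positivity) hμ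
  refine ⟨fun z => (1 / π) * ∫ t in Ioi 0, secondDiff (glue μ s) z t, fun z hz => ?_, ?_⟩
  · obtain ⟨B, hB⟩ := glue_bounded (s := s) hμ0 hs
    exact (tendsto_pv (continuous_glue hμ0 s).measurable hB
      (integrableOn_secondDiff_glue hμ hs hsin hz)).const_mul _
  · rw [← Real.sqrt_sq (show 0 ≤ 1 / μ by positivity), ← Real.sqrt_mul (by positivity)]
    refine Real.sqrt_lt_sqrt (integral_nonneg fun z => sq_nonneg _)
      ((integral_residual_sq_le hμ hs hsin).trans_lt ?_)
    have e : ∀ a b : ℝ, (a + b / μ) / μ = (a + b * (1 / μ)) * (1 / μ) := by intros; ring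
    rw [e, e, div_eq_mul_one_div 8.00, div_eq_mul_one_div 13.66, ← one_div_pow]
    have hm : 0 < 1 / μ := by positivity
    generalize 1 / μ = m at hm ⊢
    have h2 : 0 < m ^ 2 := by positivity
    have h3 : 0 < m ^ 3 := by positivity
    have h4 : 0 < m ^ 4 := by positivity
    nlinarith
end

section
/- For all nonnegative integers m, n, the moments of the Green kernel are: ∫_{−1}^1 ∫_{−1}^1 G(x,y)·x^m·y^n dx dy = 0 if m+n is odd; = (1/(m+n+2))·(Γ((m+1)/2)/Γ(m/2+1))·(Γ((n+1)/2)/Γ(n/2+1)) if m and n are both even; and = (1/(m+n+2))·(Γ(m/2+1)/Γ((m+3)/2))·(Γ(n/2+1)/Γ((n+3)/2)) if m and n are both odd. -/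
open Real MeasureTheory Set

/-- The Green function of the Cauchy process on the interval `(−1,1)`. -/
noncomputable def greenG (x y : ℝ) : ℝ :=
  (1 / Real.pi) *
    Real.log ((1 - x * y + Real.sqrt (1 - x ^ 2) * Real.sqrt (1 - y ^ 2)) / |x - y|)

/-- The monomial `x ^ k` weighted by the arcsine density of radius `r`; it vanishes for `r ≤ |x|`
because of the conventions for `√` and division. -/
noncomputable def arcsineMonomial (k : ℕ) (r x : ℝ) : ℝ := x ^ k / √(r ^ 2 - x ^ 2)

theorem arcsineMonomial_eq_zero {k : ℕ} {r x : ℝ} (h : r ^ 2 ≤ x ^ 2) :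
    arcsineMonomial k r x = 0 := by
  simp [arcsineMonomial, Real.sqrt_eq_zero_of_nonpos (sub_nonpos.2 h)]

theorem arcsineMonomial_neg (k : ℕ) (r x : ℝ) :
    arcsineMonomial k r (-x) = (-1) ^ k * arcsineMonomial k r x := by
  rw [arcsineMonomial, arcsineMonomial, neg_pow]
  simp [mul_div_assoc]

theorem arcsineMonomial_mul {r : ℝ} (hr : 0 < r) (k : ℕ) (x : ℝ) :
    arcsineMonomial k r (r * x) = r ^ k * r⁻¹ * arcsineMonomial k 1 x := by
  have h : √(r ^ 2 - (r * x) ^ 2) = r * √(1 ^ 2 - x ^ 2) := by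
    rw [show r ^ 2 - (r * x) ^ 2 = r ^ 2 * (1 ^ 2 - x ^ 2) by ring,
      Real.sqrt_mul (sq_nonneg r), Real.sqrt_sq hr.le]
  rw [arcsineMonomial, arcsineMonomial, h, mul_pow, mul_div_mul_comm, div_eq_mul_inv]

theorem arcsineMonomial_eq_comp {r : ℝ} (hr : 0 < r) (k : ℕ) (x : ℝ) :
    arcsineMonomial k r x = r ^ k * r⁻¹ * arcsineMonomial k 1 (r⁻¹ * x) := by
  rw [← arcsineMonomial_mul hr, mul_inv_cancel_left₀ hr.ne']

theorem integrable_arcsineMonomial_zero : Integrable (arcsineMonomial 0 1) := by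
  have h : IntegrableOn (fun x : ℝ => 1 / √(1 - x ^ 2)) (Ioc (-1) 1) :=
    intervalIntegral.integrableOn_deriv_of_nonneg Real.continuous_arcsin.continuousOn
      (fun x hx => Real.hasDerivAt_arcsin hx.1.ne' hx.2.ne) (fun x _ => by positivity)
  refine (integrableOn_iff_integrable_of_support_subset (s := Ioc (-1) 1) ?_).1
    (h.congr_fun (fun x _ => by simp [arcsineMonomial]) measurableSet_Ioc)
  intro x hx
  by_contra hx'
  refine hx (arcsineMonomial_eq_zero ?_)
  rw [sq_le_sq, abs_one]
  by_contra! hlt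
  exact hx' ⟨(abs_lt.1 hlt).1, (abs_lt.1 hlt).2.le⟩

theorem measurable_arcsineMonomial (k : ℕ) :
    Measurable (fun p : ℝ × ℝ => arcsineMonomial k p.1 p.2) := by
  unfold arcsineMonomial
  fun_prop

theorem integrable_arcsineMonomial_one (k : ℕ) : Integrable (arcsineMonomial k 1) := by
  refine integrable_arcsineMonomial_zero.mono
    ((measurable_arcsineMonomial k).comp measurable_prodMk_left).aestronglyMeasurable
    (.of_forall fun x => ?_)
  rcases le_total (1 ^ 2) (x ^ 2) with h | h
  · rw [arcsineMonomial_eq_zero h, norm_zero]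
    positivity
  · simp only [arcsineMonomial, norm_div, norm_pow, pow_zero]
    rw [norm_one]
    gcongr
    exact pow_le_one₀ (norm_nonneg x) (by simpa using sq_le_sq.1 h)

theorem integrable_arcsineMonomial {r : ℝ} (hr : 0 < r) (k : ℕ) :
    Integrable (arcsineMonomial k r) := by
  rw [funext (arcsineMonomial_eq_comp hr k)]
  exact ((integrable_comp_mul_left_iff _ (inv_ne_zero hr.ne')).2
    (integrable_arcsineMonomial_one k)).const_mul _

theorem integral_arcsineMonomial_eq_pow_mul {r : ℝ} (hr : 0 < r) (k : ℕ) :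
    ∫ x, arcsineMonomial k r x = r ^ k * ∫ x, arcsineMonomial k 1 x := by
  simp_rw [arcsineMonomial_eq_comp hr k]
  rw [integral_const_mul, Measure.integral_comp_mul_left, inv_inv, abs_of_pos hr, smul_eq_mul]
  field_simp

theorem integral_norm_arcsineMonomial {r : ℝ} (hr : 0 < r) (k : ℕ) :
    ∫ x, ‖arcsineMonomial k r x‖ = r ^ k * ∫ x, ‖arcsineMonomial k 1 x‖ := by
  simp_rw [arcsineMonomial_eq_comp hr k, norm_mul]
  rw [integral_const_mul,
    Measure.integral_comp_mul_left (fun x => ‖arcsineMonomial k 1 x‖), inv_inv, abs_of_pos hr,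
    smul_eq_mul, norm_pow, norm_inv, Real.norm_of_nonneg hr.le]
  field_simp

theorem integral_arcsineMonomial_of_odd {k : ℕ} (hk : Odd k) (r : ℝ) :
    ∫ x, arcsineMonomial k r x = 0 := by
  have h := integral_neg_eq_self (arcsineMonomial k r) volume
  simp only [arcsineMonomial_neg, hk.neg_one_pow, neg_one_mul, integral_neg] at h
  linarith

theorem integral_arcsineMonomial_eq_intervalIntegral (k : ℕ) :
    ∫ x, arcsineMonomial k 1 x = ∫ x in (-1)..1, arcsineMonomial k 1 x := by
  rw [intervalIntegral.integral_of_le (by norm_num),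
    setIntegral_eq_integral_of_forall_compl_eq_zero]
  intro x hx
  refine arcsineMonomial_eq_zero ?_
  rw [sq_le_sq, abs_one]
  by_contra! hlt
  exact hx ⟨(abs_lt.1 hlt).1, (abs_lt.1 hlt).2.le⟩

theorem integral_arcsineMonomial_zero : ∫ x, arcsineMonomial 0 1 x = π := by
  rw [integral_arcsineMonomial_eq_intervalIntegral,
    intervalIntegral.integral_eq_sub_of_hasDerivAt_of_le (by norm_num)
      Real.continuous_arcsin.continuousOn _ integrable_arcsineMonomial_zero.intervalIntegrable]
  · rw [Real.arcsin_one, Real.arcsin_neg_one]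
    ring
  · intro x hx
    simpa [arcsineMonomial] using Real.hasDerivAt_arcsin hx.1.ne' hx.2.ne

theorem integral_arcsineMonomial_add_two (k : ℕ) :
    (k + 2 : ℝ) * ∫ x, arcsineMonomial (k + 2) 1 x = (k + 1) * ∫ x, arcsineMonomial k 1 x := by
  have h := intervalIntegral.integral_eq_sub_of_hasDerivAt_of_le
    (a := -1) (b := 1) (f := fun x : ℝ => x ^ (k + 1) * √(1 - x ^ 2))
    (f' := fun x => (k + 1) * arcsineMonomial k 1 x - (k + 2) * arcsineMonomial (k + 2) 1 x)
    (by norm_num) (by fun_prop) (fun x hx => ?_)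
    ((((integrable_arcsineMonomial_one k).const_mul _).sub
      ((integrable_arcsineMonomial_one (k + 2)).const_mul _)).intervalIntegrable)
  · rw [intervalIntegral.integral_sub
      ((integrable_arcsineMonomial_one k).const_mul _).intervalIntegrable
      ((integrable_arcsineMonomial_one (k + 2)).const_mul _).intervalIntegrable,
      intervalIntegral.integral_const_mul, intervalIntegral.integral_const_mul,
      ← integral_arcsineMonomial_eq_intervalIntegral,
      ← integral_arcsineMonomial_eq_intervalIntegral] at h
    norm_num at h
    linarith
  · have hx0 : 0 < 1 - x ^ 2 := by nlinarith [hx.1, hx.2]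
    have hs := Real.sqrt_pos.2 hx0
    have hsq := Real.sq_sqrt hx0.le
    have h1 := (hasDerivAt_pow (k + 1) x).mul
      ((((hasDerivAt_pow 2 x).const_sub 1)).sqrt hx0.ne')
    refine h1.congr_deriv ?_
    simp only [arcsineMonomial, one_pow]
    field_simp
    rw [hsq]
    push_cast
    ring

theorem integral_arcsineMonomial_of_even {k : ℕ} (hk : Even k) :
    ∫ x, arcsineMonomial k 1 x = √π * (Real.Gamma ((k + 1) / 2) / Real.Gamma ((k : ℝ) / 2 + 1)) := by
  obtain ⟨j, rfl⟩ := hk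
  induction j with
  | zero =>
    simp only [add_zero, integral_arcsineMonomial_zero]
    norm_num
    rw [Real.Gamma_one_half_eq, Real.mul_self_sqrt pi_pos.le]
  | succ j ih =>
    have h := integral_arcsineMonomial_add_two (j + j)
    rw [ih] at h
    rw [show j + 1 + (j + 1) = j + j + 2 by ring]
    push_cast at h ⊢
    rw [show ((j : ℝ) + j + 2 + 1) / 2 = (j + j + 1) / 2 + 1 by ring,
      show ((j : ℝ) + j + 2) / 2 + 1 = ((j + j) / 2 + 1) + 1 by ring,
      Real.Gamma_add_one (s := ((j : ℝ) + j + 1) / 2) (by positivity),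
      Real.Gamma_add_one (s := ((j : ℝ) + j) / 2 + 1) (by positivity)]
    have hG : Real.Gamma (((j : ℝ) + j) / 2 + 1) ≠ 0 := (Real.Gamma_pos_of_pos (by positivity)).ne'
    have hj : (j : ℝ) + j + 2 ≠ 0 := by positivity
    refine mul_left_cancel₀ hj (h.trans ?_)
    field_simp

/-- An antiderivative, in the radius `r`, of the kernel of `integral_radial_kernel`. -/
noncomputable def radialPrimitive (x y r : ℝ) : ℝ :=
  Real.log (r ^ 2 - x * y + √(r ^ 2 - x ^ 2) * √(r ^ 2 - y ^ 2)) - Real.log r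

theorem sq_sub_mul_pos {x y r : ℝ} (hxy : x ≠ y) (hx : |x| ≤ r) (hy : |y| ≤ r) :
    0 < r ^ 2 - x * y := by
  have h1 := sq_le_sq' (abs_le.1 hx).1 (abs_le.1 hx).2
  have h2 := sq_le_sq' (abs_le.1 hy).1 (abs_le.1 hy).2
  nlinarith [sq_pos_of_ne_zero (sub_ne_zero.2 hxy)]

theorem max_abs_pos {x y : ℝ} (hxy : x ≠ y) : 0 < max |x| |y| := by
  by_contra! h
  have hx : x = 0 := abs_nonpos_iff.1 ((le_max_left _ _).trans h)
  have hy : y = 0 := abs_nonpos_iff.1 ((le_max_right _ _).trans h)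
  exact hxy (hx.trans hy.symm)

theorem continuousOn_radialPrimitive {x y : ℝ} (hxy : x ≠ y) :
    ContinuousOn (radialPrimitive x y) (Ici (max |x| |y|)) := by
  unfold radialPrimitive
  refine ContinuousOn.sub (ContinuousOn.log (by fun_prop) fun r hr => ?_)
    (ContinuousOn.log (by fun_prop) fun r hr => ((max_abs_pos hxy).trans_le hr).ne')
  have := sq_sub_mul_pos hxy ((le_max_left _ _).trans hr) ((le_max_right _ _).trans hr)
  positivity

theorem hasDerivAt_radialPrimitive {x y r : ℝ} (hxy : x ≠ y) (hr : max |x| |y| < r) :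
    HasDerivAt (radialPrimitive x y)
      (r * (arcsineMonomial 0 r x * arcsineMonomial 0 r y) +
        r⁻¹ * (arcsineMonomial 1 r x * arcsineMonomial 1 r y)) r := by
  have hx := (le_max_left _ _).trans_lt hr
  have hy := (le_max_right _ _).trans_lt hr
  have hr0 : 0 < r := (max_abs_pos hxy).trans hr
  have hX : 0 < r ^ 2 - x ^ 2 := sub_pos.2 (sq_lt_sq' (abs_lt.1 hx).1 (abs_lt.1 hx).2)
  have hY : 0 < r ^ 2 - y ^ 2 := sub_pos.2 (sq_lt_sq' (abs_lt.1 hy).1 (abs_lt.1 hy).2)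
  have hD := sq_sub_mul_pos hxy hx.le hy.le
  have hu := Real.sqrt_pos.2 hX
  have hv := Real.sqrt_pos.2 hY
  have hu2 := Real.sq_sqrt hX.le
  have hv2 := Real.sq_sqrt hY.le
  have hne : r ^ 2 - x * y + √(r ^ 2 - x ^ 2) * √(r ^ 2 - y ^ 2) ≠ 0 := by positivity
  have h := ((((hasDerivAt_pow 2 r).sub_const (x * y)).add
    ((((hasDerivAt_pow 2 r).sub_const (x ^ 2)).sqrt hX.ne').mul
      (((hasDerivAt_pow 2 r).sub_const (y ^ 2)).sqrt hY.ne'))).log hne).sub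
        (Real.hasDerivAt_log hr0.ne')
  refine h.congr_deriv ?_
  simp only [arcsineMonomial, Pi.add_apply, Pi.mul_apply]
  generalize √(r ^ 2 - x ^ 2) = u at *
  generalize √(r ^ 2 - y ^ 2) = v at *
  field_simp
  norm_num
  have hxx : x ^ 2 = r ^ 2 - u ^ 2 := by linarith
  have hyy : y ^ 2 = r ^ 2 - v ^ 2 := by linarith
  linear_combination 2 * y ^ 2 * hxx + 2 * (r ^ 2 - u ^ 2) * hyy

theorem radialPrimitive_max {x y : ℝ} (hxy : x ≠ y) :
    radialPrimitive x y (max |x| |y|) = Real.log |x - y| := by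
  wlog h : |y| ≤ |x| generalizing x y
  · rw [max_comm, abs_sub_comm, ← this hxy.symm (le_of_not_ge h)]
    simp only [radialPrimitive, mul_comm]
  · have hM := max_abs_pos hxy
    have hD := sq_sub_mul_pos hxy le_rfl h
    rw [max_eq_left h] at hM ⊢
    have hx : |x| ^ 2 - x * y = |x| * |x - y| := by
      rw [← abs_mul, ← abs_of_pos hD, sq_abs]
      ring_nf
    rw [radialPrimitive, sq_abs, sub_self, Real.sqrt_zero, zero_mul, add_zero, ← sq_abs, hx,
      Real.log_mul hM.ne' (abs_pos.2 (sub_ne_zero.2 hxy)).ne', add_sub_cancel_left]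

theorem integral_radial_kernel {x y : ℝ} (hxy : x ≠ y) (hx : |x| < 1) (hy : |y| < 1) :
    ∫ r in Ioo (0 : ℝ) 1, (r * (arcsineMonomial 0 r x * arcsineMonomial 0 r y) +
        r⁻¹ * (arcsineMonomial 1 r x * arcsineMonomial 1 r y)) = π * greenG x y := by
  have hM := max_abs_pos hxy
  have hM1 : max |x| |y| < 1 := max_lt hx hy
  have hcont := (continuousOn_radialPrimitive hxy).mono (Icc_subset_Ici_self (a := 1))
  have hderiv : ∀ r ∈ Ioo (max |x| |y|) 1, HasDerivAt (radialPrimitive x y) _ r :=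
    fun r hr => hasDerivAt_radialPrimitive hxy hr.1
  have hint := intervalIntegral.integrableOn_deriv_of_nonneg hcont hderiv fun r hr => by
    have hr0 := hM.trans hr.1
    have hxy' : |x * y| ≤ r ^ 2 := by
      rw [abs_mul, sq]
      exact mul_le_mul ((le_max_left _ _).trans hr.1.le) ((le_max_right _ _).trans hr.1.le)
        (abs_nonneg y) hr0.le
    have : r * (arcsineMonomial 0 r x * arcsineMonomial 0 r y) +
        r⁻¹ * (arcsineMonomial 1 r x * arcsineMonomial 1 r y) =
        r⁻¹ * (r ^ 2 + x * y) * ((√(r ^ 2 - x ^ 2))⁻¹ * (√(r ^ 2 - y ^ 2))⁻¹) := by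
      simp only [arcsineMonomial, div_eq_mul_inv]
      field_simp
    rw [this]
    have : 0 ≤ r ^ 2 + x * y := by linarith [(abs_le.1 hxy').1]
    positivity
  have hFTC := intervalIntegral.integral_eq_sub_of_hasDerivAt_of_le hM1.le hcont hderiv
    ((intervalIntegrable_iff_integrableOn_Ioc_of_le hM1.le).2 hint)
  have hset : ∫ r in Ioo (0 : ℝ) 1, (r * (arcsineMonomial 0 r x * arcsineMonomial 0 r y) +
        r⁻¹ * (arcsineMonomial 1 r x * arcsineMonomial 1 r y)) =
      ∫ r in max |x| |y|..1, (r * (arcsineMonomial 0 r x * arcsineMonomial 0 r y) +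
        r⁻¹ * (arcsineMonomial 1 r x * arcsineMonomial 1 r y)) := by
    rw [intervalIntegral.integral_of_le hM1.le, ← integral_Ioc_eq_integral_Ioo]
    refine setIntegral_eq_of_subset_of_forall_sdiff_eq_zero measurableSet_Ioc
      (Ioc_subset_Ioc_left hM.le) fun r hr => ?_
    have hrM : r ≤ max |x| |y| := not_lt.1 fun h => hr.2 ⟨h, hr.1.2⟩
    rcases le_max_iff.1 hrM with h | h
    · have h' : r ^ 2 ≤ x ^ 2 := sq_le_sq.2 (by rwa [abs_of_pos hr.1.1])
      simp [arcsineMonomial_eq_zero h']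
    · have h' : r ^ 2 ≤ y ^ 2 := sq_le_sq.2 (by rwa [abs_of_pos hr.1.1])
      simp [arcsineMonomial_eq_zero h']
  have hD := sq_sub_mul_pos hxy hx.le hy.le
  rw [hset, hFTC, radialPrimitive_max hxy, radialPrimitive, greenG]
  rw [Real.log_div _ (abs_pos.2 (sub_ne_zero.2 hxy)).ne']
  · simp only [one_pow, Real.log_one, sub_zero]
    field_simp
  · rw [one_pow] at hD
    positivity

theorem integrable_arcsineMonomial_prod {c : ℝ → ℝ} (hc : Measurable c) (a b : ℕ)
    (h : IntegrableOn (fun r => c r * r ^ (a + b)) (Ioo 0 1)) :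
    Integrable (fun p : ℝ × ℝ × ℝ =>
        c p.1 * (arcsineMonomial a p.1 p.2.1 * arcsineMonomial b p.1 p.2.2))
      ((volume.restrict (Ioo 0 1)).prod (volume.prod volume)) := by
  have hmeas : Measurable (fun p : ℝ × ℝ × ℝ =>
      c p.1 * (arcsineMonomial a p.1 p.2.1 * arcsineMonomial b p.1 p.2.2)) := by
    unfold arcsineMonomial
    fun_prop
  refine (integrable_prod_iff hmeas.aestronglyMeasurable).2 ⟨?_, ?_⟩
  · refine (ae_restrict_mem measurableSet_Ioo).mono fun r hr => ?_
    exact ((integrable_arcsineMonomial hr.1 a).mul_prod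
      (integrable_arcsineMonomial hr.1 b)).const_mul (c r)
  · refine Integrable.congr (h.norm.mul_const
      ((∫ x, ‖arcsineMonomial a 1 x‖) * ∫ x, ‖arcsineMonomial b 1 x‖)) ?_
    refine (ae_restrict_mem measurableSet_Ioo).mono fun r hr => ?_
    simp only [norm_mul]
    rw [integral_const_mul, integral_prod_mul (fun x => ‖arcsineMonomial a r x‖)
      (fun x => ‖arcsineMonomial b r x‖), integral_norm_arcsineMonomial hr.1,
      integral_norm_arcsineMonomial hr.1, norm_pow, Real.norm_of_nonneg hr.1.le]
    ring

/-- The Green moments in terms of the moments of the arcsine density. -/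
theorem integral_greenG_mul_pow (m n : ℕ) :
    ∫ y in Ioo (-1 : ℝ) 1, ∫ x in Ioo (-1 : ℝ) 1, greenG x y * x ^ m * y ^ n =
      π⁻¹ * (1 / (m + n + 2)) *
        ((∫ x, arcsineMonomial n 1 x) * (∫ x, arcsineMonomial m 1 x) +
          (∫ x, arcsineMonomial (n + 1) 1 x) * ∫ x, arcsineMonomial (m + 1) 1 x) := by
  let F : ℝ → ℝ × ℝ → ℝ := fun r z =>
    r * (arcsineMonomial n r z.1 * arcsineMonomial m r z.2) +
      r⁻¹ * (arcsineMonomial (n + 1) r z.1 * arcsineMonomial (m + 1) r z.2)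
  have hpow (k : ℕ) : IntegrableOn (fun r : ℝ => r ^ k) (Ioo 0 1) :=
    ((continuous_pow k).integrableOn_Icc).mono_set Ioo_subset_Icc_self
  have hF1 := integrable_arcsineMonomial_prod measurable_id n m
    ((hpow (n + m + 1)).congr_fun (fun r _ => by simp only [id]; ring) measurableSet_Ioo)
  have hF2 := integrable_arcsineMonomial_prod measurable_inv (n + 1) (m + 1)
    ((hpow (n + m + 1)).congr_fun (fun r hr => by
      have := hr.1.ne'
      field_simp
      ring) measurableSet_Ioo)
  have hF : Integrable (Function.uncurry F)
      ((volume.restrict (Ioo 0 1)).prod (volume.prod volume)) := hF1.add hF2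
  have hzero (z : ℝ × ℝ) (hz : z.1 ∉ Ioo (-1 : ℝ) 1 ∨ z.2 ∉ Ioo (-1 : ℝ) 1) :
      ∫ r in Ioo (0 : ℝ) 1, F r z = 0 := by
    refine setIntegral_eq_zero_of_forall_eq_zero fun r hr => ?_
    have key (t : ℝ) (ht : t ∉ Ioo (-1 : ℝ) 1) : r ^ 2 ≤ t ^ 2 := by
      rw [sq_le_sq, abs_of_pos hr.1]
      by_contra! hlt
      exact ht (abs_lt.1 (hlt.trans hr.2))
    rcases hz with hz | hz <;> simp [F, arcsineMonomial_eq_zero (key _ hz)]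
  have hgreen (y : ℝ) (hy : y ∈ Ioo (-1 : ℝ) 1) :
      ∫ x in Ioo (-1 : ℝ) 1, greenG x y * x ^ m * y ^ n =
        ∫ x, π⁻¹ * ∫ r in Ioo (0 : ℝ) 1, F r (y, x) := by
    rw [← setIntegral_eq_integral_of_forall_compl_eq_zero (s := Ioo (-1 : ℝ) 1)
      (f := fun x => π⁻¹ * ∫ r in Ioo (0 : ℝ) 1, F r (y, x))
      fun x hx => by rw [hzero _ (.inr hx), mul_zero]]
    refine setIntegral_congr_ae measurableSet_Ioo ?_
    filter_upwards [(measure_eq_zero_iff_ae_notMem.1 (measure_singleton y))] with x hxy hx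
    have hxy : x ≠ y := hxy
    have hg := integral_radial_kernel hxy (abs_lt.2 hx) (abs_lt.2 hy)
    have hFr : ∀ r, F r (y, x) = (r * (arcsineMonomial 0 r x * arcsineMonomial 0 r y) +
        r⁻¹ * (arcsineMonomial 1 r x * arcsineMonomial 1 r y)) * (x ^ m * y ^ n) := by
      intro r
      simp only [F, arcsineMonomial]
      ring
    simp_rw [hFr]
    rw [integral_mul_const, hg]
    field_simp
  rw [setIntegral_congr_fun measurableSet_Ioo hgreen,
    setIntegral_eq_integral_of_forall_compl_eq_zero fun y hy => by
      simp [hzero (y, _) (.inl hy)]]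
  simp_rw [integral_const_mul]
  rw [← integral_prod (fun z => ∫ r in Ioo (0 : ℝ) 1, F r z) hF.integral_prod_right,
    ← integral_integral_swap hF]
  have hr : EqOn (fun r => ∫ z, F r z ∂(volume.prod volume)) (fun r => r ^ (m + n + 1) *
      ((∫ x, arcsineMonomial n 1 x) * (∫ x, arcsineMonomial m 1 x) +
        (∫ x, arcsineMonomial (n + 1) 1 x) * ∫ x, arcsineMonomial (m + 1) 1 x)) (Ioo 0 1) := by
    intro r hr
    have hI (a b : ℕ) := (integrable_arcsineMonomial hr.1 a).mul_prod
      (integrable_arcsineMonomial hr.1 b)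
    have hr0 := hr.1.ne'
    simp only [F]
    rw [integral_add ((hI n m).const_mul r) ((hI (n + 1) (m + 1)).const_mul r⁻¹),
      integral_const_mul, integral_const_mul, integral_prod_mul, integral_prod_mul]
    simp only [integral_arcsineMonomial_eq_pow_mul hr.1 n, integral_arcsineMonomial_eq_pow_mul hr.1 m,
      integral_arcsineMonomial_eq_pow_mul hr.1 (n + 1), integral_arcsineMonomial_eq_pow_mul hr.1 (m + 1)]
    field_simp
    ring
  rw [setIntegral_congr_fun measurableSet_Ioo hr, integral_mul_const,
    ← integral_Ioc_eq_integral_Ioo, ← intervalIntegral.integral_of_le zero_le_one, integral_pow]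
  push_cast
  rw [one_pow, zero_pow (by omega), sub_zero, mul_assoc, add_assoc _ (1 : ℝ) 1, one_add_one_eq_two]

theorem green_moments (m n : ℕ) :
    (Odd (m + n) →
      (∫ y in Ioo (-1 : ℝ) 1, ∫ x in Ioo (-1 : ℝ) 1, greenG x y * x ^ m * y ^ n) = 0) ∧
    (Even m → Even n →
      (∫ y in Ioo (-1 : ℝ) 1, ∫ x in Ioo (-1 : ℝ) 1, greenG x y * x ^ m * y ^ n)
        = (1 / (m + n + 2)) * (Real.Gamma ((m + 1) / 2) / Real.Gamma ((m : ℝ) / 2 + 1))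
            * (Real.Gamma ((n + 1) / 2) / Real.Gamma ((n : ℝ) / 2 + 1))) ∧
    (Odd m → Odd n →
      (∫ y in Ioo (-1 : ℝ) 1, ∫ x in Ioo (-1 : ℝ) 1, greenG x y * x ^ m * y ^ n)
        = (1 / (m + n + 2)) * (Real.Gamma ((m : ℝ) / 2 + 1) / Real.Gamma ((m + 3) / 2))
            * (Real.Gamma ((n : ℝ) / 2 + 1) / Real.Gamma ((n + 3) / 2))) := by
  have hpi : π⁻¹ * (√π * √π) = 1 := by
    rw [Real.mul_self_sqrt pi_pos.le, inv_mul_cancel₀ pi_ne_zero]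
  refine ⟨fun h => ?_, fun hm hn => ?_, fun hm hn => ?_⟩ <;> rw [integral_greenG_mul_pow]
  · rcases Nat.even_or_odd m with hm | hm
    · have hn : Odd n := by grind
      rw [integral_arcsineMonomial_of_odd hn, integral_arcsineMonomial_of_odd hm.add_one]
      ring
    · have hn : Even n := by grind
      rw [integral_arcsineMonomial_of_odd hm, integral_arcsineMonomial_of_odd hn.add_one]
      ring
  · rw [integral_arcsineMonomial_of_even hm, integral_arcsineMonomial_of_even hn,
      integral_arcsineMonomial_of_odd hm.add_one]
    linear_combination (1 / (m + n + 2)) * (Real.Gamma ((m + 1) / 2) / Real.Gamma ((m : ℝ) / 2 + 1))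
      * (Real.Gamma ((n + 1) / 2) / Real.Gamma ((n : ℝ) / 2 + 1)) * hpi
  · rw [integral_arcsineMonomial_of_odd hm, integral_arcsineMonomial_of_even hm.add_one,
      integral_arcsineMonomial_of_even hn.add_one]
    have h1 (k : ℕ) : (((k + 1 : ℕ) : ℝ) + 1) / 2 = (k : ℝ) / 2 + 1 := by
      push_cast
      ring
    have h2 (k : ℕ) : ((k + 1 : ℕ) : ℝ) / 2 + 1 = ((k : ℝ) + 3) / 2 := by
      push_cast
      ring
    rw [h1, h1, h2, h2]
    linear_combination (1 / (m + n + 2)) * (Real.Gamma ((m : ℝ) / 2 + 1) / Real.Gamma ((m + 3) / 2))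
      * (Real.Gamma ((n : ℝ) / 2 + 1) / Real.Gamma ((n + 3) / 2)) * hpi
end
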